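/- arXiv:1906.10360 — 3 statements merged into one kernel-verified Lean document; each statement's English description precedes it below -/
import Mathlib

section
/- Fix α ∈ (0,1). For every positive d and r_max with d < r_max there exists a constant C(d, r_max, α) with the following property. Let R satisfy d ≤ R ≤ r_max, let Ω' = {x ∈ ℝ² : R + d/3 < |x| < R + 2d/3}, and let f : ℝ² → ℝ be α-Hölder continuous with compact support contained in Ω'. Define G_N(x,y) = −(1/2π)log|y − x| − (1/2π)log|y − x*| + |y|²/(4πR²), where x* = (R²/|x|²)x is the inversion of x with respect to B_R(0), and set u(x) = ∫_{ℝ²} f(y) G_N(x,y) dy. Then on the annulus B_{R+d}(0) ∖ B̄_R(0): ‖Du‖_∞ + [Du]_{0,α} + ‖D²u‖_∞ + [D²u]_{0,α} ≤ C(d, r_max, α) (‖f‖_∞ + [f]_{0,α}). -/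
/-- The Neumann-type kernel for the disk `B_R(0)`:
`G_N(x,y) = −(1/2π)log|y−x| − (1/2π)log|y−x*| + |y|²/(4πR²)`,
where `x* = (R²/|x|²)x` is the inversion of `x` with respect to `B_R(0)`. -/
noncomputable def GN (R : ℝ) (x y : ℂ) : ℝ :=
  -(1 / (2 * Real.pi)) * Real.log ‖y - x‖ -
    (1 / (2 * Real.pi)) * Real.log ‖y - (R ^ 2 / ‖x‖ ^ 2 : ℝ) • x‖ +
    ‖y‖ ^ 2 / (4 * Real.pi * R ^ 2)

open MeasureTheory Filter Topology ComplexConjugate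

/-- The real-linear functional `v ↦ Re (a v)` on `ℂ`, as a linear function of `a`. -/
noncomputable def reMul : ℂ →L[ℝ] ℂ →L[ℝ] ℝ :=
  (ContinuousLinearMap.compL ℝ ℂ ℂ ℝ Complex.reCLM).comp (ContinuousLinearMap.mul ℝ ℂ)

@[simp]
lemma reMul_apply (a v : ℂ) : reMul a v = (a * v).re := rfl

lemma norm_reMul_apply_le (a : ℂ) : ‖reMul a‖ ≤ ‖a‖ :=
  ContinuousLinearMap.opNorm_le_bound _ (norm_nonneg _) fun v => by
    rw [reMul_apply, ← norm_mul]
    exact Complex.abs_re_le_norm _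

lemma norm_reMul_le : ‖reMul‖ ≤ 1 :=
  ContinuousLinearMap.opNorm_le_bound _ zero_le_one fun a => by
    simpa using norm_reMul_apply_le a

/-- The real-linear map `v ↦ a v + b v̄` on `ℂ`. -/
noncomputable def mulAddMulConj (a b : ℂ) : ℂ →L[ℝ] ℂ :=
  a • (1 : ℂ →L[ℝ] ℂ) + b • (Complex.conjCLE : ℂ →L[ℝ] ℂ)

@[simp]
lemma mulAddMulConj_apply (a b v : ℂ) : mulAddMulConj a b v = a * v + b * conj v := by
  simp [mulAddMulConj]

lemma norm_mulAddMulConj_le (a b : ℂ) : ‖mulAddMulConj a b‖ ≤ ‖a‖ + ‖b‖ :=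
  ContinuousLinearMap.opNorm_le_bound _ (by positivity) fun v => by
    rw [mulAddMulConj_apply, add_mul]
    refine (norm_add_le _ _).trans ?_
    simp

lemma mulAddMulConj_sub (a b a' b' : ℂ) :
    mulAddMulConj a b - mulAddMulConj a' b' = mulAddMulConj (a - a') (b - b') := by
  ext v; simp; ring

lemma smul_mulAddMulConj_add (c a b a' b' : ℂ) :
    c • (mulAddMulConj a b + mulAddMulConj a' b') =
      mulAddMulConj (c * (a + a')) (c * (b + b')) := by
  ext v; simp; ring

lemma continuous_mulAddMulConj : Continuous fun p : ℂ × ℂ => mulAddMulConj p.1 p.2 := by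
  unfold mulAddMulConj
  fun_prop

/-- The regularization `½ log (|z|² + e²)` of `log |z|`. -/
noncomputable def regLog (e : ℝ) (z : ℂ) : ℝ := 1 / 2 * Real.log (‖z‖ ^ 2 + e ^ 2)

/-- The regularized Cauchy kernel `z̄ / (|z|² + e²)`. -/
noncomputable def regCauchy (e : ℝ) (z : ℂ) : ℂ := conj z / (z * conj z + (e : ℂ) ^ 2)

/-- The approximate identity `e² / (|z|² + e²)²` (up to a constant factor). -/
noncomputable def poissonKer (e : ℝ) (z : ℂ) : ℂ := (e : ℂ) ^ 2 / (z * conj z + (e : ℂ) ^ 2) ^ 2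

lemma mul_conj_add_sq (e : ℝ) (z : ℂ) :
    z * conj z + (e : ℂ) ^ 2 = ((‖z‖ ^ 2 + e ^ 2 : ℝ) : ℂ) := by
  rw [Complex.mul_conj, Complex.normSq_eq_norm_sq]; push_cast; rfl

lemma mul_conj_add_sq_ne_zero {e : ℝ} (he : 0 < e) (z : ℂ) : z * conj z + (e : ℂ) ^ 2 ≠ 0 := by
  rw [mul_conj_add_sq]
  have : 0 < ‖z‖ ^ 2 + e ^ 2 := by positivity
  exact_mod_cast this.ne'

lemma hasFDerivAt_mul_conj_add_sq (e : ℝ) (z : ℂ) :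
    HasFDerivAt (fun z : ℂ => z * conj z + (e : ℂ) ^ 2) (mulAddMulConj (conj z) z) z := by
  have h1 : HasFDerivAt (fun z : ℂ => z) (ContinuousLinearMap.id ℝ ℂ) z := hasFDerivAt_id z
  have h2 : HasFDerivAt (fun z : ℂ => conj z) (Complex.conjCLE : ℂ →L[ℝ] ℂ) z :=
    Complex.conjCLE.hasFDerivAt
  refine ((h1.mul h2).add_const _).congr_fderiv ?_
  ext v
  simp
  ring

lemma hasFDerivAt_regLog {e : ℝ} (he : 0 < e) (z : ℂ) :
    HasFDerivAt (regLog e) (reMul (regCauchy e z)) z := by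
  have h := (Complex.reCLM.hasFDerivAt.comp z (hasFDerivAt_mul_conj_add_sq e z))
  have hpos : 0 < ‖z‖ ^ 2 + e ^ 2 := by positivity
  have h0 : (Complex.reCLM ∘ fun z : ℂ => z * conj z + (e : ℂ) ^ 2) =
      fun z => ‖z‖ ^ 2 + e ^ 2 := by
    ext w; simp only [Function.comp, mul_conj_add_sq, Complex.reCLM_apply, Complex.ofReal_re]
  rw [h0] at h
  have h3 := (h.log hpos.ne').const_mul (1 / 2)
  refine h3.congr_fderiv ?_
  ext v
  simp only [regCauchy, mul_conj_add_sq, reMul_apply]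
  rw [div_mul_eq_mul_div, Complex.div_ofReal_re]
  simp
  ring

lemma hasFDerivAt_regCauchy {e : ℝ} (he : 0 < e) (z : ℂ) :
    HasFDerivAt (regCauchy e) (mulAddMulConj (-(regCauchy e z) ^ 2) (poissonKer e z)) z := by
  have h2 : HasFDerivAt (fun z : ℂ => conj z) (Complex.conjCLE : ℂ →L[ℝ] ℂ) z :=
    Complex.conjCLE.hasFDerivAt
  have hne := mul_conj_add_sq_ne_zero he z
  have h3 := ((hasDerivAt_inv hne).hasFDerivAt.restrictScalars ℝ).comp z
    (hasFDerivAt_mul_conj_add_sq e z)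
  refine (h2.mul h3).congr_fderiv ?_
  ext v
  simp [regCauchy, poissonKer]
  field_simp
  ring

lemma hasFDerivAt_regCauchy_sq {e : ℝ} (he : 0 < e) (z : ℂ) :
    HasFDerivAt (fun z => regCauchy e z ^ 2)
      (mulAddMulConj (-(2 * regCauchy e z ^ 3)) (2 * (regCauchy e z * poissonKer e z))) z := by
  have h := hasFDerivAt_regCauchy he z
  have h2 := h.mul h
  simp only [← pow_two] at h2
  refine h2.congr_fderiv ?_
  ext v
  simp
  ring

lemma continuous_regLog {e : ℝ} (he : 0 < e) : Continuous (regLog e) :=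
  continuous_iff_continuousAt.2 fun z => (hasFDerivAt_regLog he z).continuousAt

lemma continuous_regCauchy {e : ℝ} (he : 0 < e) : Continuous (regCauchy e) :=
  continuous_iff_continuousAt.2 fun z => (hasFDerivAt_regCauchy he z).continuousAt

lemma continuous_poissonKer {e : ℝ} (he : 0 < e) : Continuous (poissonKer e) := by
  unfold poissonKer
  exact continuous_const.div (by fun_prop) fun z => pow_ne_zero 2 (mul_conj_add_sq_ne_zero he z)

lemma regCauchy_eq_scaled {e : ℝ} (he : 0 < e) (t : ℝ) (z : ℂ) :
    regCauchy (e * t) z = (e : ℂ)⁻¹ * regCauchy t (e⁻¹ • z) := by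
  have : (e : ℂ) ≠ 0 := by exact_mod_cast he.ne'
  simp only [regCauchy, Complex.real_smul, map_mul, Complex.conj_ofReal]
  push_cast
  have h : (z * conj z + ((e : ℂ) * t) ^ 2) =
    e ^ 2 * ((e : ℂ)⁻¹ * z * ((e : ℂ)⁻¹ * conj z) + (t : ℂ) ^ 2) := by field_simp
  rw [h, div_eq_mul_inv, div_eq_mul_inv, mul_inv]
  field_simp

lemma poissonKer_eq_scaled {e : ℝ} (he : 0 < e) (z : ℂ) :
    poissonKer e z = ((e : ℂ)⁻¹) ^ 2 * poissonKer 1 (e⁻¹ • z) := by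
  have : (e : ℂ) ≠ 0 := by exact_mod_cast he.ne'
  simp only [poissonKer, Complex.real_smul, map_mul, Complex.conj_ofReal]
  push_cast
  have h : (z * conj z + (e : ℂ) ^ 2) =
    e ^ 2 * ((e : ℂ)⁻¹ * z * ((e : ℂ)⁻¹ * conj z) + (1 : ℂ) ^ 2) := by field_simp
  rw [h, div_eq_mul_inv, div_eq_mul_inv, mul_pow, mul_inv]
  field_simp

lemma norm_regCauchy {e : ℝ} (z : ℂ) :
    ‖regCauchy e z‖ = ‖z‖ / (‖z‖ ^ 2 + e ^ 2) := by
  rw [regCauchy, mul_conj_add_sq, norm_div, Complex.norm_real, RCLike.norm_conj,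
    Real.norm_of_nonneg (by positivity)]

lemma norm_poissonKer {e : ℝ} (z : ℂ) :
    ‖poissonKer e z‖ = e ^ 2 / (‖z‖ ^ 2 + e ^ 2) ^ 2 := by
  rw [poissonKer, mul_conj_add_sq, norm_div, norm_pow, norm_pow, Complex.norm_real,
    Complex.norm_real, Real.norm_of_nonneg (by positivity : 0 ≤ ‖z‖ ^ 2 + e ^ 2),
    Real.norm_eq_abs, sq_abs]

lemma regCauchy_I_mul (e : ℝ) (z : ℂ) :
    regCauchy e (Complex.I * z) = -Complex.I * regCauchy e z := by
  have : Complex.I * z * (-Complex.I * conj z) = z * conj z := by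
    linear_combination (- z * conj z) * Complex.I_sq
  simp only [regCauchy, map_mul, Complex.conj_I, this]
  rw [mul_div_assoc]

lemma poissonKer_I_mul (e : ℝ) (z : ℂ) : poissonKer e (Complex.I * z) = poissonKer e z := by
  have : Complex.I * z * (-Complex.I * conj z) = z * conj z := by
    linear_combination (- z * conj z) * Complex.I_sq
  simp only [poissonKer, map_mul, Complex.conj_I, this]

/-- A complex-valued function on the plane is multiplied by a constant `c ≠ 1` under a quarter
turn; then its integral vanishes. -/
lemma integral_eq_zero_of_comp_I_mul {Φ : ℂ → ℂ} {c : ℂ} (hc : c ≠ 1)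
    (h : ∀ z, Φ (Complex.I * z) = c * Φ z) : ∫ z, Φ z = 0 := by
  have hI : ‖Complex.I‖ = 1 := Complex.norm_I
  let a : Circle := ⟨Complex.I, by simp [Submonoid.unitSphere]⟩
  have h1 : ∫ z, Φ (rotation a z) = ∫ z, Φ z :=
    (rotation a).measurePreserving.integral_comp (rotation a).toHomeomorph.measurableEmbedding Φ
  have h2 : ∀ z, Φ (rotation a z) = c * Φ z := fun z => by rw [rotation_apply]; exact h z
  simp only [h2, integral_const_mul] at h1
  have h3 : (c - 1) * ∫ z, Φ z = 0 := by rw [sub_mul, h1, one_mul, sub_self]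
  exact (mul_eq_zero.1 h3).resolve_left (sub_ne_zero.2 hc)

/-- Continuous functions on the plane that decay at least like `|z|⁻³` at infinity. -/
def CubicDecay (Φ : ℂ → ℂ) : Prop :=
  Continuous Φ ∧ ∃ B, ∀ z, ‖Φ z‖ ≤ B * (√(1 + ‖z‖ ^ 2))⁻¹ ^ 3

lemma CubicDecay.integrable_rpow_mul {Φ : ℂ → ℂ} (h : CubicDecay Φ) {a : ℝ} (ha0 : 0 ≤ a)
    (ha1 : a < 1) : Integrable fun z => ‖z‖ ^ a * ‖Φ z‖ := by
  obtain ⟨hc, B, hB⟩ := h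
  have hi : Integrable (fun z : ℂ => B * (1 + ‖z‖ ^ 2) ^ (-(3 - a) / 2)) :=
    (integrable_rpow_neg_one_add_norm_sq (by
      rw [Complex.finrank_real_complex]; push_cast; linarith)).const_mul B
  refine hi.mono' ?_ (Eventually.of_forall fun z => ?_)
  · exact ((continuous_norm.rpow_const fun _ => Or.inr ha0).mul hc.norm).aestronglyMeasurable
  · have hpos : 0 < 1 + ‖z‖ ^ 2 := by positivity
    have h1 : ‖z‖ ^ a ≤ (1 + ‖z‖ ^ 2) ^ (a / 2) := by
      have : ‖z‖ ^ a = (‖z‖ ^ 2) ^ (a / 2) := by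
        rw [← Real.rpow_natCast, ← Real.rpow_mul (norm_nonneg _)]; congr 1; push_cast; ring
      rw [this]
      exact Real.rpow_le_rpow (by positivity) (by linarith) (by linarith)
    have h2 : (√(1 + ‖z‖ ^ 2))⁻¹ ^ 3 = (1 + ‖z‖ ^ 2) ^ (-3 / 2 : ℝ) := by
      rw [Real.sqrt_eq_rpow, ← Real.rpow_neg hpos.le, ← Real.rpow_natCast,
        ← Real.rpow_mul hpos.le]
      congr 1; norm_num
    rw [Real.norm_of_nonneg (by positivity)]
    calc ‖z‖ ^ a * ‖Φ z‖
        ≤ (1 + ‖z‖ ^ 2) ^ (a / 2) * (B * (1 + ‖z‖ ^ 2) ^ (-3 / 2 : ℝ)) := by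
          rw [← h2]; gcongr; exact hB z
      _ = B * ((1 + ‖z‖ ^ 2) ^ (a / 2) * (1 + ‖z‖ ^ 2) ^ (-3 / 2 : ℝ)) := by ring
      _ = B * (1 + ‖z‖ ^ 2) ^ (-(3 - a) / 2) := by
          rw [← Real.rpow_add hpos]; congr 2; ring

lemma CubicDecay.integrable {Φ : ℂ → ℂ} (h : CubicDecay Φ) : Integrable Φ := by
  have := h.integrable_rpow_mul le_rfl zero_lt_one
  simp only [Real.rpow_zero, one_mul] at this
  exact (integrable_norm_iff h.1.aestronglyMeasurable).1 this

lemma inv_sqrt_one_add_sq_facts (r : ℝ) : 0 < (√(1 + r ^ 2))⁻¹ ∧ (√(1 + r ^ 2))⁻¹ ≤ 1 ∧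
    (r ^ 2 + 1 ^ 2)⁻¹ = (√(1 + r ^ 2))⁻¹ ^ 2 ∧ r * (√(1 + r ^ 2))⁻¹ ≤ 1 := by
  have h1 : 0 < 1 + r ^ 2 := by positivity
  have h2 : 0 < √(1 + r ^ 2) := Real.sqrt_pos.2 h1
  refine ⟨by positivity, inv_le_one_of_one_le₀ (Real.one_le_sqrt.2 (by nlinarith)), ?_, ?_⟩
  · rw [inv_pow, Real.sq_sqrt h1.le]; congr 1; ring
  · rw [← div_eq_mul_inv, div_le_one h2]
    exact Real.le_sqrt_of_sq_le (by linarith)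

lemma norm_regCauchy_one_le (z : ℂ) : ‖regCauchy 1 z‖ ≤ (√(1 + ‖z‖ ^ 2))⁻¹ := by
  obtain ⟨h1, -, h3, h4⟩ := inv_sqrt_one_add_sq_facts ‖z‖
  rw [norm_regCauchy, div_eq_mul_inv, h3]
  calc ‖z‖ * (√(1 + ‖z‖ ^ 2))⁻¹ ^ 2 = (‖z‖ * (√(1 + ‖z‖ ^ 2))⁻¹) * (√(1 + ‖z‖ ^ 2))⁻¹ := by ring
    _ ≤ 1 * (√(1 + ‖z‖ ^ 2))⁻¹ := by gcongr
    _ = _ := one_mul _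

lemma norm_poissonKer_one (z : ℂ) : ‖poissonKer 1 z‖ = (√(1 + ‖z‖ ^ 2))⁻¹ ^ 4 := by
  obtain ⟨-, -, h3, -⟩ := inv_sqrt_one_add_sq_facts ‖z‖
  rw [norm_poissonKer, div_eq_mul_inv, ← inv_pow, h3]
  ring

lemma cubicDecay_poissonKer : CubicDecay (poissonKer 1) := by
  refine ⟨continuous_poissonKer one_pos, 1, fun z => ?_⟩
  obtain ⟨h1, h2, -, -⟩ := inv_sqrt_one_add_sq_facts ‖z‖
  rw [norm_poissonKer_one, one_mul]
  exact pow_le_pow_of_le_one h1.le h2 (by norm_num)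

lemma cubicDecay_regCauchy_pow : CubicDecay fun z => regCauchy 1 z ^ 3 := by
  refine ⟨(continuous_regCauchy one_pos).pow 3, 1, fun z => ?_⟩
  rw [norm_pow, one_mul]
  gcongr
  exact norm_regCauchy_one_le z

lemma cubicDecay_regCauchy_mul_poissonKer :
    CubicDecay fun z => regCauchy 1 z * poissonKer 1 z := by
  refine ⟨(continuous_regCauchy one_pos).mul (continuous_poissonKer one_pos), 1, fun z => ?_⟩
  obtain ⟨h1, h2, -, -⟩ := inv_sqrt_one_add_sq_facts ‖z‖
  rw [norm_mul, norm_poissonKer_one, one_mul]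
  calc _ ≤ (√(1 + ‖z‖ ^ 2))⁻¹ * (√(1 + ‖z‖ ^ 2))⁻¹ ^ 4 := by
        gcongr; exact norm_regCauchy_one_le z
    _ = (√(1 + ‖z‖ ^ 2))⁻¹ ^ 5 := by ring
    _ ≤ _ := pow_le_pow_of_le_one h1.le h2 (by norm_num)

lemma norm_regCauchy_sub_half_le (z : ℂ) :
    ‖regCauchy 1 z - regCauchy (1 / 2) z‖ ≤ 3 * (√(1 + ‖z‖ ^ 2))⁻¹ ^ 3 := by
  obtain ⟨h1, h2, h3, h4⟩ := inv_sqrt_one_add_sq_facts ‖z‖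
  have e : regCauchy 1 z - regCauchy (1 / 2) z =
      ((-3 / 4 * (‖z‖ ^ 2 + (1 / 2) ^ 2)⁻¹ : ℝ) : ℂ) * (((‖z‖ ^ 2 + 1 ^ 2)⁻¹ : ℝ) : ℂ) * conj z := by
    have p1 : ((‖z‖ ^ 2 + 1 ^ 2 : ℝ) : ℂ) ≠ 0 := by
      exact_mod_cast (by positivity : 0 < ‖z‖ ^ 2 + 1 ^ 2).ne'
    have p2 : ((‖z‖ ^ 2 + (1 / 2) ^ 2 : ℝ) : ℂ) ≠ 0 := by
      exact_mod_cast (by positivity : 0 < ‖z‖ ^ 2 + (1 / 2 : ℝ) ^ 2).ne'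
    have pq : ((‖z‖ ^ 2 + 1 ^ 2 : ℝ) : ℂ) = ((‖z‖ ^ 2 + (1 / 2) ^ 2 : ℝ) : ℂ) + 3 / 4 := by
      push_cast; ring
    rw [regCauchy, regCauchy, mul_conj_add_sq, mul_conj_add_sq, Complex.ofReal_mul,
      Complex.ofReal_inv, Complex.ofReal_inv]
    generalize ((‖z‖ ^ 2 + 1 ^ 2 : ℝ) : ℂ) = P at *
    generalize ((‖z‖ ^ 2 + (1 / 2) ^ 2 : ℝ) : ℂ) = Q at *
    push_cast
    field_simp
    rw [pq]
    ring
  have h5 : (‖z‖ ^ 2 + (1 / 2) ^ 2)⁻¹ ≤ 4 * (√(1 + ‖z‖ ^ 2))⁻¹ ^ 2 := by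
    rw [← h3, ← div_eq_mul_inv, inv_le_comm₀ (by positivity) (by positivity), inv_div]
    rw [div_le_iff₀ (by norm_num)]
    nlinarith [sq_nonneg ‖z‖]
  rw [e, norm_mul, norm_mul, RCLike.norm_conj, Complex.norm_real, Complex.norm_real, norm_mul,
    Real.norm_of_nonneg (by positivity : 0 ≤ (‖z‖ ^ 2 + (1 / 2 : ℝ) ^ 2)⁻¹),
    Real.norm_of_nonneg (by positivity : 0 ≤ (‖z‖ ^ 2 + (1 : ℝ) ^ 2)⁻¹), h3]
  have h6 : ‖(-3 / 4 : ℝ)‖ = 3 / 4 := by norm_num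
  rw [h6]
  calc _ ≤ 3 / 4 * (4 * (√(1 + ‖z‖ ^ 2))⁻¹ ^ 2) * (√(1 + ‖z‖ ^ 2))⁻¹ ^ 2 * ‖z‖ := by gcongr
    _ = 3 * (√(1 + ‖z‖ ^ 2))⁻¹ ^ 3 * (‖z‖ * (√(1 + ‖z‖ ^ 2))⁻¹) := by ring
    _ ≤ 3 * (√(1 + ‖z‖ ^ 2))⁻¹ ^ 3 * 1 := by gcongr
    _ = _ := mul_one _

lemma cubicDecay_regCauchy_sub :
    CubicDecay fun z => regCauchy 1 z - regCauchy (1 / 2) z :=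
  ⟨(continuous_regCauchy one_pos).sub (continuous_regCauchy (by norm_num)), 3,
    norm_regCauchy_sub_half_le⟩

lemma cubicDecay_regCauchy_sq_sub :
    CubicDecay fun z => regCauchy 1 z ^ 2 - regCauchy (1 / 2) z ^ 2 := by
  refine ⟨((continuous_regCauchy one_pos).pow 2).sub
    ((continuous_regCauchy (by norm_num)).pow 2), 15, fun z => ?_⟩
  obtain ⟨h1, h2, -, -⟩ := inv_sqrt_one_add_sq_facts ‖z‖
  have h3 := norm_regCauchy_sub_half_le z
  have h4 := norm_regCauchy_one_le z
  have h5 : ‖regCauchy 1 z + regCauchy (1 / 2) z‖ ≤ 5 := by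
    have e : regCauchy 1 z + regCauchy (1 / 2) z =
      2 * regCauchy 1 z - (regCauchy 1 z - regCauchy (1 / 2) z) := by ring
    rw [e]
    refine (norm_sub_le _ _).trans ?_
    rw [norm_mul, Complex.norm_ofNat]
    have := pow_le_one₀ (n := 3) h1.le h2
    linarith
  simp only [sq_sub_sq, norm_mul]
  calc _ ≤ 5 * (3 * (√(1 + ‖z‖ ^ 2))⁻¹ ^ 3) := by gcongr
    _ = _ := by ring

/-- The potential of the density `f` with respect to the convolution kernel `k`. -/
noncomputable def potential {E : Type*} [NormedAddCommGroup E] [NormedSpace ℝ E]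
    (f : ℂ → ℝ) (k : ℂ → E) (x : ℂ) : E := ∫ y, f y • k (x - y)

section potential

variable {E : Type*} [NormedAddCommGroup E] [NormedSpace ℝ E] {f : ℂ → ℝ}

lemma integrable_smul_comp_sub (hf : Continuous f) (hs : HasCompactSupport f) {k : ℂ → E}
    (hk : Continuous k) (x : ℂ) : Integrable fun y => f y • k (x - y) :=
  (hf.smul (hk.comp (continuous_const.sub continuous_id))).integrable_of_hasCompactSupport
    hs.smul_right

lemma potential_sub (hf : Continuous f) (hs : HasCompactSupport f) {k l : ℂ → E}
    (hk : Continuous k) (hl : Continuous l) (x : ℂ) :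
    potential f (fun z => k z - l z) x = potential f k x - potential f l x := by
  simp only [potential, smul_sub]
  exact integral_sub (integrable_smul_comp_sub hf hs hk x) (integrable_smul_comp_sub hf hs hl x)

lemma potential_const_mul (c : ℂ) (k : ℂ → ℂ) (x : ℂ) :
    potential f (fun z => c * k z) x = c * potential f k x := by
  simp only [potential, ← integral_const_mul, mul_smul_comm]

lemma norm_potential_le {B : ℝ} {k : ℂ → E} (hf : Continuous f) (hs : HasCompactSupport f)
    (hk : ∀ z, ‖k z‖ ≤ B) (x : ℂ) : ‖potential f k x‖ ≤ (∫ y, |f y|) * B := by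
  rw [potential, ← integral_mul_const]
  refine norm_integral_le_of_norm_le
    ((hf.integrable_of_hasCompactSupport hs).abs.mul_const B) (Eventually.of_forall fun y => ?_)
  rw [norm_smul, Real.norm_eq_abs]
  gcongr
  exact hk _

lemma hasFDerivAt_potential (hf : Continuous f) (hs : HasCompactSupport f) {k : ℂ → E}
    {k' : ℂ → ℂ →L[ℝ] E} (hk : ∀ z, HasFDerivAt k (k' z) z) (hk' : Continuous k') {B : ℝ}
    (hB : ∀ z, ‖k' z‖ ≤ B) (x : ℂ) :
    HasFDerivAt (potential f k) (potential f k' x) x := by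
  have hkc : Continuous k := continuous_iff_continuousAt.2 fun z => (hk z).continuousAt
  refine hasFDerivAt_integral_of_dominated_of_fderiv_le (𝕜 := ℝ) (s := Set.univ)
    (F := fun x y => f y • k (x - y)) (F' := fun x y => f y • k' (x - y))
    (bound := fun y => |f y| * B) Filter.univ_mem
    (Eventually.of_forall fun x => (integrable_smul_comp_sub hf hs hkc x).aestronglyMeasurable)
    (integrable_smul_comp_sub hf hs hkc x)
    (integrable_smul_comp_sub hf hs hk' x).aestronglyMeasurable
    (Eventually.of_forall fun y x _ => ?_)
    ((hf.integrable_of_hasCompactSupport hs).abs.mul_const B)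
    (Eventually.of_forall fun y x _ => ?_)
  · rw [norm_smul, Real.norm_eq_abs]
    gcongr
    exact hB _
  · exact (((hk (x - y)).comp x ((hasFDerivAt_id x).sub_const y)).const_smul (f y))

lemma potential_reMul (hf : Continuous f) (hs : HasCompactSupport f) {k : ℂ → ℂ}
    (hk : Continuous k) (x : ℂ) :
    potential f (fun z => reMul (k z)) x = reMul (potential f k x) := by
  simp only [potential, ← map_smul]
  exact reMul.integral_comp_comm (integrable_smul_comp_sub hf hs hk x)

lemma potential_mulAddMulConj (hf : Continuous f) (hs : HasCompactSupport f) {k l : ℂ → ℂ}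
    (hk : Continuous k) (hl : Continuous l) (x : ℂ) :
    potential f (fun z => mulAddMulConj (k z) (l z)) x =
      mulAddMulConj (potential f k x) (potential f l x) := by
  ext v
  have hc : Continuous fun z => mulAddMulConj (k z) (l z) :=
    continuous_mulAddMulConj.comp (hk.prodMk hl)
  rw [potential, ContinuousLinearMap.integral_apply (integrable_smul_comp_sub hf hs hc x),
    mulAddMulConj_apply, potential, potential, ← integral_mul_const, ← integral_mul_const,
    ← integral_add ((integrable_smul_comp_sub hf hs hk x).mul_const v)
      ((integrable_smul_comp_sub hf hs hl x).mul_const (conj v))]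
  congr 1 with y
  simp
  ring

lemma potential_comp_inv_smul (k : ℂ → E) {e : ℝ} (he : 0 < e) (x : ℂ) :
    potential f (fun z => k (e⁻¹ • z)) x = e ^ 2 • ∫ z, f (x - e • z) • k z := by
  rw [potential, ← integral_sub_left_eq_self _ volume x]
  simp only [sub_sub_cancel]
  have h := Measure.integral_comp_inv_smul_of_nonneg volume
    (fun z : ℂ => f (x - e • z) • k z) he.le
  rw [Complex.finrank_real_complex] at h
  rw [← h]
  simp only [smul_smul, mul_inv_cancel₀ he.ne', one_smul]

lemma norm_potential_scaled_le {Φ : ℂ → ℂ}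
    (hΦ : Integrable Φ) {M : ℝ} (hM : ∀ x, |f x| ≤ M) {e : ℝ}
    (he : 0 < e) (x : ℂ) :
    ‖potential f (fun z => Φ (e⁻¹ • z)) x‖ ≤ e ^ 2 * (M * ∫ z, ‖Φ z‖) := by
  rw [potential_comp_inv_smul Φ he, norm_smul, Real.norm_of_nonneg (by positivity)]
  gcongr
  rw [← integral_const_mul]
  refine norm_integral_le_of_norm_le (hΦ.norm.const_mul M) (Eventually.of_forall fun z => ?_)
  rw [norm_smul]
  gcongr
  exact hM _

/-- At scale `e`, the potential with a rescaled decaying kernel equals its mean times the density,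
up to an error of size `e ^ α` for `α`-Hölder densities. -/
lemma norm_potential_scaled_sub_le (hf : Continuous f) (hs : HasCompactSupport f) {Φ : ℂ → ℂ}
    (hΦ : CubicDecay Φ) {α M : ℝ} (hα0 : 0 < α) (hα1 : α < 1)
    (hH : ∀ x x', |f x - f x'| ≤ M * ‖x - x'‖ ^ α) {e : ℝ} (he : 0 < e) (x : ℂ) :
    ‖potential f (fun z => Φ (e⁻¹ • z)) x - (e ^ 2 * f x) • ∫ z, Φ z‖ ≤
      e ^ 2 * e ^ α * (M * ∫ z, ‖z‖ ^ α * ‖Φ z‖) := by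
  have hfΦ : Integrable fun z => f (x - e • z) • Φ z := by
    obtain ⟨B, hB⟩ := hf.bounded_above_of_compact_support hs
    refine (hΦ.integrable.norm.const_mul B).mono'
      ((hf.comp (by fun_prop)).smul hΦ.1).aestronglyMeasurable (Eventually.of_forall fun z => ?_)
    rw [norm_smul]
    gcongr
    exact hB _
  rw [potential_comp_inv_smul Φ he, mul_smul, ← smul_sub, ← integral_smul,
    ← integral_sub hfΦ (hΦ.integrable.smul (f x) : Integrable fun z => f x • Φ z), norm_smul,
    Real.norm_of_nonneg (by positivity), mul_assoc (e ^ 2)]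
  gcongr
  rw [← mul_assoc, ← integral_const_mul]
  refine norm_integral_le_of_norm_le ((hΦ.integrable_rpow_mul hα0.le hα1).const_mul _)
    (Eventually.of_forall fun z => ?_)
  rw [← sub_smul, norm_smul, Real.norm_eq_abs]
  have h := hH (x - e • z) x
  have h2 : ‖x - e • z - x‖ ^ α = e ^ α * ‖z‖ ^ α := by
    rw [sub_sub_cancel_left, norm_neg, norm_smul, Real.norm_of_nonneg he.le,
      Real.mul_rpow he.le (norm_nonneg _)]
  rw [h2] at h
  calc _ ≤ M * (e ^ α * ‖z‖ ^ α) * ‖Φ z‖ := by gcongr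
    _ = _ := by ring

end potential

lemma exists_limit_of_norm_sub_le_geometric {X E : Type*} [NormedAddCommGroup E] [CompleteSpace E]
    {a : ℕ → X → E} {K q : ℝ} (hq : q < 1)
    (h : ∀ n x, ‖a n x - a (n + 1) x‖ ≤ K * q ^ n) :
    ∃ A : X → E, ∀ n x, ‖a n x - A x‖ ≤ K / (1 - q) * q ^ n := by
  have hd : ∀ x n, dist (a n x) (a (n + 1) x) ≤ K * q ^ n := fun x n => by
    rw [dist_eq_norm]; exact h n x
  choose A hA using fun x => cauchySeq_tendsto_of_complete
    (cauchySeq_of_le_geometric q K hq (hd x))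
  refine ⟨A, fun n x => ?_⟩
  rw [← dist_eq_norm, div_mul_eq_mul_div]
  exact dist_le_of_le_geometric_of_tendsto q K hq (hd x) (hA x) n

lemma tendstoUniformly_of_norm_sub_le_geometric {X E : Type*} [NormedAddCommGroup E]
    {a : ℕ → X → E} {A : X → E} {K q : ℝ} (hq0 : 0 ≤ q) (hq : q < 1)
    (h : ∀ n x, ‖a n x - A x‖ ≤ K * q ^ n) : TendstoUniformly a A atTop := by
  rw [Metric.tendstoUniformly_iff]
  intro ε hε
  have ht : Tendsto (fun n : ℕ => K * q ^ n) atTop (𝓝 (K * 0)) :=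
    (tendsto_pow_atTop_nhds_zero_of_lt_one hq0 hq).const_mul K
  rw [mul_zero] at ht
  filter_upwards [ht.eventually_lt_const hε] with n hn x
  rw [dist_comm, dist_eq_norm]
  exact (h n x).trans_lt hn

lemma abs_regLog_le {e : ℝ} (he : 0 ≤ e) (he1 : e ≤ 1) {z : ℂ} (hz : z ≠ 0) :
    |regLog e z| ≤ ‖z‖ ^ 2 + ‖z‖⁻¹ := by
  have hr : 0 < ‖z‖ := norm_pos_iff.2 hz
  have hi : 0 < ‖z‖⁻¹ := inv_pos.2 hr
  have h1 : Real.log (‖z‖ ^ 2 + e ^ 2) ≤ ‖z‖ ^ 2 + e ^ 2 - 1 :=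
    Real.log_le_sub_one_of_pos (by positivity)
  have h2 : Real.log (‖z‖ ^ 2) ≤ Real.log (‖z‖ ^ 2 + e ^ 2) :=
    Real.log_le_log (by positivity) (by nlinarith)
  have h3 := Real.one_sub_inv_le_log_of_pos hr
  rw [Real.log_pow] at h2
  push_cast at h2
  rw [abs_le, regLog]
  constructor <;> nlinarith

lemma regLog_zero (z : ℂ) : regLog 0 z = Real.log ‖z‖ := by
  simp [regLog, Real.log_pow]

lemma locallyIntegrable_inv_norm : LocallyIntegrable fun z : ℂ => ‖z‖⁻¹ := by
  refine locallyIntegrable_of_norm_le_rpow (C := 1) (α := 1)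
    (by rw [Complex.finrank_real_complex]; norm_num)
    (by rw [Complex.finrank_real_complex]; norm_num)
    (Eventually.of_forall fun z => ?_) (by fun_prop)
  rw [Real.rpow_neg_one, one_mul, norm_inv, norm_norm]

lemma integrable_log_bound {f : ℂ → ℝ} (hf : Continuous f) (hs : HasCompactSupport f) (x : ℂ) :
    Integrable fun y => |f y| * (‖x - y‖ ^ 2 + ‖x - y‖⁻¹) := by
  have h1 : Integrable fun y => f y • ‖x - y‖ ^ 2 :=
    integrable_smul_comp_sub hf hs (k := fun z => ‖z‖ ^ 2) (by fun_prop) x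
  have h2 : Integrable fun y => f y • ‖x - y‖⁻¹ := by
    have hc : HasCompactSupport fun z => f (x - z) := hs.comp_homeomorph (Homeomorph.subLeft x)
    have := (locallyIntegrable_inv_norm.integrable_smul_left_of_hasCompactSupport
      (g := fun z => f (x - z)) (by fun_prop) hc).comp_sub_left x
    simpa using this
  refine (h1.norm.add h2.norm).congr (Eventually.of_forall fun y => ?_)
  simp only [Pi.add_apply, norm_smul, Real.norm_eq_abs, abs_pow, abs_inv, abs_norm]
  ring

lemma ae_ne_point (x : ℂ) : ∀ᵐ y : ℂ, y ≠ x :=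
  compl_mem_ae_iff.2 (measure_singleton x)

lemma integrable_mul_log {f : ℂ → ℝ} (hf : Continuous f) (hs : HasCompactSupport f) (x : ℂ) :
    Integrable fun y => f y * Real.log ‖x - y‖ := by
  refine (integrable_log_bound hf hs x).mono'
    (hf.measurable.mul (Real.measurable_log.comp
      (measurable_const.sub measurable_id).norm)).aestronglyMeasurable ?_
  filter_upwards [ae_ne_point x] with y hy
  rw [norm_mul, Real.norm_eq_abs, Real.norm_eq_abs, ← regLog_zero]
  gcongr
  exact abs_regLog_le le_rfl zero_le_one (sub_ne_zero.2 hy.symm)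

lemma tendsto_potential_regLog {f : ℂ → ℝ} (hf : Continuous f) (hs : HasCompactSupport f) (x : ℂ) :
    Tendsto (fun n : ℕ => potential f (regLog ((1 / 2) ^ n)) x) atTop
      (𝓝 (potential f (fun z => Real.log ‖z‖) x)) := by
  have hpos : ∀ n : ℕ, (0 : ℝ) < (1 / 2) ^ n := fun n => by positivity
  refine tendsto_integral_of_dominated_convergence _
    (fun n => (integrable_smul_comp_sub hf hs
      (continuous_regLog (hpos n)) x).aestronglyMeasurable)
    (integrable_log_bound hf hs x) (fun n => ?_) ?_
  · filter_upwards [ae_ne_point x] with y hy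
    rw [norm_smul, Real.norm_eq_abs, Real.norm_eq_abs]
    gcongr
    exact abs_regLog_le (hpos n).le (pow_le_one₀ (by norm_num) (by norm_num))
      (sub_ne_zero.2 hy.symm)
  · filter_upwards [ae_ne_point x] with y hy
    refine Tendsto.const_smul ?_ (f y)
    rw [← regLog_zero]
    have ht : Tendsto (fun n : ℕ => ((1 : ℝ) / 2) ^ n) atTop (𝓝 0) :=
      tendsto_pow_atTop_nhds_zero_of_lt_one (by norm_num) (by norm_num)
    have hxy : 0 < ‖x - y‖ := norm_pos_iff.2 (sub_ne_zero.2 hy.symm)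
    refine (Tendsto.log ((ht.pow 2).const_add _) ?_).const_mul _
    positivity

lemma norm_regCauchy_le {e : ℝ} (he : 0 < e) (z : ℂ) : ‖regCauchy e z‖ ≤ e⁻¹ := by
  have h := regCauchy_eq_scaled he 1 z
  rw [mul_one] at h
  rw [h, norm_mul, norm_inv, Complex.norm_real, Real.norm_of_nonneg he.le]
  refine mul_le_of_le_one_right (by positivity) ?_
  exact (norm_regCauchy_one_le _).trans (inv_sqrt_one_add_sq_facts _).2.1

lemma norm_poissonKer_le {e : ℝ} (he : 0 < e) (z : ℂ) : ‖poissonKer e z‖ ≤ e⁻¹ ^ 2 := by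
  rw [poissonKer_eq_scaled he z, norm_mul, norm_pow, norm_inv, Complex.norm_real,
    Real.norm_of_nonneg he.le]
  refine mul_le_of_le_one_right (by positivity) ?_
  rw [norm_poissonKer_one]
  exact pow_le_one₀ (inv_sqrt_one_add_sq_facts _).1.le (inv_sqrt_one_add_sq_facts _).2.1

section regularized

variable {f : ℂ → ℝ} {α M e : ℝ}

lemma hasFDerivAt_potential_regLog (hf : Continuous f) (hs : HasCompactSupport f) (he : 0 < e)
    (x : ℂ) :
    HasFDerivAt (potential f (regLog e)) (reMul (potential f (regCauchy e) x)) x := by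
  rw [← potential_reMul hf hs (continuous_regCauchy he)]
  exact hasFDerivAt_potential hf hs (hasFDerivAt_regLog he)
    (reMul.continuous.comp (continuous_regCauchy he))
    (fun z => (norm_reMul_apply_le _).trans (norm_regCauchy_le he z)) x

lemma hasFDerivAt_potential_regCauchy (hf : Continuous f) (hs : HasCompactSupport f) (he : 0 < e)
    (x : ℂ) :
    HasFDerivAt (potential f (regCauchy e))
      (mulAddMulConj (-potential f (fun z => regCauchy e z ^ 2) x)
        (potential f (poissonKer e) x)) x := by
  have hG := continuous_regCauchy he
  have hK := continuous_poissonKer he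
  have h1 := potential_const_mul (f := f) (-1) (fun z => regCauchy e z ^ 2) x
  simp only [neg_one_mul] at h1
  have hG2 : Continuous fun z => -regCauchy e z ^ 2 := (hG.pow 2).neg
  rw [← h1, ← potential_mulAddMulConj hf hs hG2 hK]
  refine hasFDerivAt_potential hf hs (hasFDerivAt_regCauchy he)
    (continuous_mulAddMulConj.comp (hG2.prodMk hK)) (B := e⁻¹ ^ 2 + e⁻¹ ^ 2)
    (fun z => (norm_mulAddMulConj_le _ _).trans ?_) x
  rw [norm_neg, norm_pow]
  gcongr
  · exact norm_regCauchy_le he z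
  · exact norm_poissonKer_le he z

lemma hasFDerivAt_potential_regCauchy_sq (hf : Continuous f) (hs : HasCompactSupport f)
    (he : 0 < e) (x : ℂ) :
    HasFDerivAt (potential f fun z => regCauchy e z ^ 2)
      (mulAddMulConj (-(2 * potential f (fun z => regCauchy e z ^ 3) x))
        (2 * potential f (fun z => regCauchy e z * poissonKer e z) x)) x := by
  have hG := continuous_regCauchy he
  have hK := continuous_poissonKer he
  have h1 := potential_const_mul (f := f) (-2) (fun z => regCauchy e z ^ 3) x
  simp only [neg_mul] at h1
  rw [← h1, ← potential_const_mul,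
    ← potential_mulAddMulConj hf hs (by fun_prop) (by fun_prop)]
  refine hasFDerivAt_potential hf hs (hasFDerivAt_regCauchy_sq he)
    (continuous_mulAddMulConj.comp (Continuous.prodMk (by fun_prop) (by fun_prop)))
    (B := 2 * e⁻¹ ^ 3 + 2 * (e⁻¹ * e⁻¹ ^ 2))
    (fun z => (norm_mulAddMulConj_le _ _).trans ?_) x
  rw [norm_neg, norm_mul, norm_mul, norm_pow, norm_mul, Complex.norm_ofNat]
  gcongr
  · exact norm_regCauchy_le he z
  · exact norm_regCauchy_le he z
  · exact norm_poissonKer_le he z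

lemma norm_potential_regCauchy_sub_le (hf : Continuous f) (hs : HasCompactSupport f)
    (hM : ∀ x, |f x| ≤ M) (he : 0 < e) (x : ℂ) :
    ‖potential f (regCauchy e) x - potential f (regCauchy (e * (1 / 2))) x‖ ≤
      M * (∫ z, ‖regCauchy 1 z - regCauchy (1 / 2) z‖) * e := by
  rw [← potential_sub hf hs (continuous_regCauchy he) (continuous_regCauchy (by positivity))]
  have h : (fun z => regCauchy e z - regCauchy (e * (1 / 2)) z) =
      fun z => (e : ℂ)⁻¹ * (regCauchy 1 (e⁻¹ • z) - regCauchy (1 / 2) (e⁻¹ • z)) := by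
    ext z
    rw [regCauchy_eq_scaled he, mul_sub, ← regCauchy_eq_scaled he 1, mul_one]
  rw [h, potential_const_mul, norm_mul, norm_inv, Complex.norm_real, Real.norm_of_nonneg he.le]
  have h2 := norm_potential_scaled_le (f := f) cubicDecay_regCauchy_sub.integrable hM he x
  calc _ ≤ e⁻¹ * (e ^ 2 * (M * ∫ z, ‖regCauchy 1 z - regCauchy (1 / 2) z‖)) := by gcongr
    _ = _ := by field_simp

lemma norm_potential_scaled_of_integral_eq_zero_le (hf : Continuous f) (hs : HasCompactSupport f)
    {Φ : ℂ → ℂ} (hΦ : CubicDecay Φ) (h0 : ∫ z, Φ z = 0) (hα0 : 0 < α) (hα1 : α < 1)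
    (hH : ∀ x x', |f x - f x'| ≤ M * ‖x - x'‖ ^ α) (he : 0 < e) (x : ℂ) :
    ‖potential f (fun z => Φ (e⁻¹ • z)) x‖ ≤
      e ^ 2 * e ^ α * (M * ∫ z, ‖z‖ ^ α * ‖Φ z‖) := by
  have h := norm_potential_scaled_sub_le hf hs hΦ hα0 hα1 hH he x
  rwa [h0, smul_zero, sub_zero] at h

lemma norm_potential_regCauchy_sq_sub_le (hf : Continuous f) (hs : HasCompactSupport f)
    (hα0 : 0 < α) (hα1 : α < 1) (hH : ∀ x x', |f x - f x'| ≤ M * ‖x - x'‖ ^ α)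
    (he : 0 < e) (x : ℂ) :
    ‖potential f (fun z => regCauchy e z ^ 2) x -
        potential f (fun z => regCauchy (e * (1 / 2)) z ^ 2) x‖ ≤
      M * (∫ z, ‖z‖ ^ α * ‖regCauchy 1 z ^ 2 - regCauchy (1 / 2) z ^ 2‖) * e ^ α := by
  have hc {t : ℝ} (ht : 0 < t) : Continuous fun z => regCauchy t z ^ 2 :=
    (continuous_regCauchy ht).pow 2
  rw [← potential_sub hf hs (hc he) (hc (by positivity))]
  have h : (fun z => regCauchy e z ^ 2 - regCauchy (e * (1 / 2)) z ^ 2) =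
      fun z => (e : ℂ)⁻¹ ^ 2 *
        (regCauchy 1 (e⁻¹ • z) ^ 2 - regCauchy (1 / 2) (e⁻¹ • z) ^ 2) := by
    ext z
    have h1 := regCauchy_eq_scaled he 1 z
    rw [mul_one] at h1
    rw [h1, regCauchy_eq_scaled he]
    ring
  have h0 : ∫ z, (regCauchy 1 z ^ 2 - regCauchy (1 / 2) z ^ 2) = 0 := by
    refine integral_eq_zero_of_comp_I_mul (c := -1) (by norm_num) fun z => ?_
    simp only [regCauchy_I_mul]
    linear_combination (regCauchy 1 z ^ 2 - regCauchy (1 / 2) z ^ 2) * Complex.I_sq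
  rw [h, potential_const_mul, norm_mul, norm_pow, norm_inv, Complex.norm_real,
    Real.norm_of_nonneg he.le]
  have h2 := norm_potential_scaled_of_integral_eq_zero_le hf hs cubicDecay_regCauchy_sq_sub h0
    hα0 hα1 hH he x
  refine (mul_le_mul_of_nonneg_left h2 (by positivity)).trans_eq ?_
  field_simp

lemma norm_potential_poissonKer_sub_le (hf : Continuous f) (hs : HasCompactSupport f)
    (hα0 : 0 < α) (hα1 : α < 1) (hH : ∀ x x', |f x - f x'| ≤ M * ‖x - x'‖ ^ α)
    (he : 0 < e) (x : ℂ) :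
    ‖potential f (poissonKer e) x - (∫ z, poissonKer 1 z) * f x‖ ≤
      M * (∫ z, ‖z‖ ^ α * ‖poissonKer 1 z‖) * e ^ α := by
  have hc : (e : ℂ) ≠ 0 := by exact_mod_cast he.ne'
  have h2 := norm_potential_scaled_sub_le hf hs cubicDecay_poissonKer hα0 hα1 hH he x
  have h : potential f (poissonKer e) x - (∫ z, poissonKer 1 z) * f x =
      (e : ℂ)⁻¹ ^ 2 * (potential f (fun z => poissonKer 1 (e⁻¹ • z)) x -
        (e ^ 2 * f x) • ∫ z, poissonKer 1 z) := by
    rw [funext (poissonKer_eq_scaled he), potential_const_mul, Complex.real_smul]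
    push_cast
    field_simp
  rw [h, norm_mul, norm_pow, norm_inv, Complex.norm_real, Real.norm_of_nonneg he.le]
  refine (mul_le_mul_of_nonneg_left h2 (by positivity)).trans_eq ?_
  field_simp

lemma norm_potential_regCauchy_pow_three_le (hf : Continuous f) (hs : HasCompactSupport f)
    (hα0 : 0 < α) (hα1 : α < 1) (hH : ∀ x x', |f x - f x'| ≤ M * ‖x - x'‖ ^ α)
    (he : 0 < e) (x : ℂ) :
    ‖potential f (fun z => regCauchy e z ^ 3) x‖ ≤
      M * (∫ z, ‖z‖ ^ α * ‖regCauchy 1 z ^ 3‖) * (e ^ α * e⁻¹) := by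
  have h : (fun z => regCauchy e z ^ 3) =
      fun z => (e : ℂ)⁻¹ ^ 3 * regCauchy 1 (e⁻¹ • z) ^ 3 := by
    ext z
    rw [← mul_pow, ← regCauchy_eq_scaled he 1, mul_one]
  have h0 : ∫ z, regCauchy 1 z ^ 3 = 0 := by
    refine integral_eq_zero_of_comp_I_mul (c := Complex.I) ?_ fun z => ?_
    · intro h; simpa using congrArg Complex.re h
    · simp only [regCauchy_I_mul]
      linear_combination (-Complex.I * regCauchy 1 z ^ 3) * Complex.I_sq
  rw [h, potential_const_mul, norm_mul, norm_pow, norm_inv, Complex.norm_real,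
    Real.norm_of_nonneg he.le]
  have h2 := norm_potential_scaled_of_integral_eq_zero_le hf hs cubicDecay_regCauchy_pow h0
    hα0 hα1 hH he x
  refine (mul_le_mul_of_nonneg_left h2 (by positivity)).trans_eq ?_
  field_simp

lemma norm_potential_regCauchy_mul_poissonKer_le (hf : Continuous f) (hs : HasCompactSupport f)
    (hα0 : 0 < α) (hα1 : α < 1) (hH : ∀ x x', |f x - f x'| ≤ M * ‖x - x'‖ ^ α)
    (he : 0 < e) (x : ℂ) :
    ‖potential f (fun z => regCauchy e z * poissonKer e z) x‖ ≤
      M * (∫ z, ‖z‖ ^ α * ‖regCauchy 1 z * poissonKer 1 z‖) * (e ^ α * e⁻¹) := by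
  have h : (fun z => regCauchy e z * poissonKer e z) =
      fun z => (e : ℂ)⁻¹ ^ 3 * (regCauchy 1 (e⁻¹ • z) * poissonKer 1 (e⁻¹ • z)) := by
    ext z
    have h1 := regCauchy_eq_scaled he 1 z
    rw [mul_one] at h1
    rw [h1, poissonKer_eq_scaled he]
    ring
  have h0 : ∫ z, regCauchy 1 z * poissonKer 1 z = 0 := by
    refine integral_eq_zero_of_comp_I_mul (c := -Complex.I) ?_ fun z => ?_
    · intro h; simpa using congrArg Complex.re h
    · rw [regCauchy_I_mul, poissonKer_I_mul]
      ring
  rw [h, potential_const_mul, norm_mul, norm_pow, norm_inv, Complex.norm_real,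
    Real.norm_of_nonneg he.le]
  have h2 := norm_potential_scaled_of_integral_eq_zero_le hf hs
    cubicDecay_regCauchy_mul_poissonKer h0 hα0 hα1 hH he x
  refine (mul_le_mul_of_nonneg_left h2 (by positivity)).trans_eq ?_
  field_simp

end regularized

/-- Scale-by-scale approximation by functions with controlled derivatives gives Hölder
continuity of the limit. -/
lemma norm_sub_le_of_dyadic_approximation {S : ℂ → ℂ} {a : ℕ → ℂ → ℂ} {α B K D : ℝ}
    (hα0 : 0 < α) (hα1 : α < 1) (hB : ∀ x, ‖S x‖ ≤ B) (hK0 : 0 ≤ K) (hD0 : 0 ≤ D)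
    (hK : ∀ n x, ‖a n x - S x‖ ≤ K * (((1 : ℝ) / 2) ^ n) ^ α)
    (hD : ∀ n x x', ‖a n x - a n x'‖ ≤
      D * ((((1 : ℝ) / 2) ^ n) ^ α * (((1 : ℝ) / 2) ^ n)⁻¹) * ‖x - x'‖) (x x' : ℂ) :
    ‖S x - S x'‖ ≤ (2 * B + 4 * K + D) * ‖x - x'‖ ^ α := by
  have hB0 : 0 ≤ B := (norm_nonneg _).trans (hB 0)
  rcases eq_or_ne x x' with rfl | hne
  · simp only [sub_self, norm_zero]; positivity
  have ht : 0 < ‖x - x'‖ := norm_pos_iff.2 (sub_ne_zero.2 hne)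
  have htα : 0 < ‖x - x'‖ ^ α := Real.rpow_pos_of_pos ht α
  rcases le_or_gt ‖x - x'‖ 1 with h1 | h1
  · obtain ⟨n, hn1, hn2⟩ := exists_nat_pow_near_of_lt_one ht h1
      (by norm_num : (0 : ℝ) < 1 / 2) (by norm_num)
    have he : (0 : ℝ) < (1 / 2) ^ n := by positivity
    have h2 : (((1 : ℝ) / 2) ^ n) ^ α ≤ 2 * ‖x - x'‖ ^ α := by
      calc (((1 : ℝ) / 2) ^ n) ^ α ≤ (2 * ‖x - x'‖) ^ α := by
            gcongr
            rw [pow_succ] at hn1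
            linarith
        _ = 2 ^ α * ‖x - x'‖ ^ α := Real.mul_rpow (by norm_num) ht.le
        _ ≤ 2 ^ (1 : ℝ) * ‖x - x'‖ ^ α := by
            gcongr
            norm_num
        _ = _ := by rw [Real.rpow_one]
    have h3 : ((((1 : ℝ) / 2) ^ n) ^ α * (((1 : ℝ) / 2) ^ n)⁻¹) * ‖x - x'‖ ≤ ‖x - x'‖ ^ α := by
      rw [← Real.rpow_neg_one (((1 : ℝ) / 2) ^ n), ← Real.rpow_add he]
      calc _ ≤ ‖x - x'‖ ^ (α + -1) * ‖x - x'‖ := by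
            refine mul_le_mul_of_nonneg_right ?_ ht.le
            exact Real.rpow_le_rpow_of_nonpos ht hn2 (by linarith)
        _ = ‖x - x'‖ ^ α := by
            rw [← Real.rpow_add_one ht.ne']
            congr 1
            ring
    have h4 : S x - S x' = -(a n x - S x) + (a n x' - S x') + (a n x - a n x') := by ring
    calc ‖S x - S x'‖
        ≤ ‖a n x - S x‖ + ‖a n x' - S x'‖ + ‖a n x - a n x'‖ := by
          rw [h4, ← norm_neg (a n x - S x)]
          exact norm_add₃_le
      _ ≤ K * (2 * ‖x - x'‖ ^ α) + K * (2 * ‖x - x'‖ ^ α) + D * ‖x - x'‖ ^ α := by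
          refine add_le_add (add_le_add ?_ ?_) ?_
          · exact (hK n x).trans (by gcongr)
          · exact (hK n x').trans (by gcongr)
          · refine (hD n x x').trans ?_
            rw [mul_assoc]
            gcongr
      _ = (4 * K + D) * ‖x - x'‖ ^ α := by ring
      _ ≤ _ := by gcongr; linarith
  · have h2 : 1 ≤ ‖x - x'‖ ^ α := Real.one_le_rpow h1.le hα0.le
    calc ‖S x - S x'‖ ≤ 2 * B * 1 := by
          refine (norm_sub_le _ _).trans ?_
          linarith [hB x, hB x']
      _ ≤ (2 * B + 4 * K + D) * ‖x - x'‖ ^ α := by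
          gcongr
          linarith

/-- The second-order Schauder estimate for the logarithmic potential of a compactly supported
Hölder continuous density: its gradient is given by a function `F`, whose differential has the
Beurling-type transform `S` as its complex-linear part and a multiple of the density as its
conjugate-linear part. -/
theorem exists_logPotential_estimate {α : ℝ} (V : ℝ) (hV : 0 ≤ V) (hα0 : 0 < α) (hα1 : α < 1) :
    ∃ C, 0 ≤ C ∧ ∀ (f : ℂ → ℝ) (M : ℝ), 0 ≤ M → Continuous f → HasCompactSupport f →
      (∀ x, |f x| ≤ M) → (∀ x x', |f x - f x'| ≤ M * ‖x - x'‖ ^ α) → ∫ y, |f y| ≤ M * V →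
      ∃ F S : ℂ → ℂ,
        (∀ x, HasFDerivAt (potential f fun z => Real.log ‖z‖) (reMul (F x)) x) ∧
        (∀ x, HasFDerivAt F (mulAddMulConj (S x) ((∫ z, poissonKer 1 z) * f x)) x) ∧
        (∀ x, ‖F x‖ ≤ C * M) ∧ (∀ x, ‖S x‖ ≤ C * M) ∧
        ∀ x x', ‖S x - S x'‖ ≤ C * M * ‖x - x'‖ ^ α := by
  set c₁ := ∫ z, ‖regCauchy 1 z - regCauchy (1 / 2) z‖
  set c₂ := ∫ z, ‖z‖ ^ α * ‖regCauchy 1 z ^ 2 - regCauchy (1 / 2) z ^ 2‖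
  set c₃ := ∫ z, ‖z‖ ^ α * ‖poissonKer 1 z‖
  set c₄ := ∫ z, ‖z‖ ^ α * ‖regCauchy 1 z ^ 3‖
  set c₅ := ∫ z, ‖z‖ ^ α * ‖regCauchy 1 z * poissonKer 1 z‖
  have hc₁ : 0 ≤ c₁ := integral_nonneg fun z => by positivity
  have hc₂ : 0 ≤ c₂ := integral_nonneg fun z => by positivity
  have hc₄ : 0 ≤ c₄ := integral_nonneg fun z => by positivity
  have hc₅ : 0 ≤ c₅ := integral_nonneg fun z => by positivity
  set q : ℝ := (1 / 2) ^ α with hq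
  have hq0 : 0 ≤ q := by positivity
  have hq1 : q < 1 := Real.rpow_lt_one (by norm_num) (by norm_num) hα0
  have hqn : ∀ n : ℕ, (((1 : ℝ) / 2) ^ n) ^ α = q ^ n := fun n => by
    rw [hq, ← Real.rpow_natCast, ← Real.rpow_natCast, ← Real.rpow_mul (by norm_num),
      ← Real.rpow_mul (by norm_num), mul_comm]
  have hq2 : 0 < 1 - q := by linarith
  set κ := c₂ / (1 - q)
  have hκ : 0 ≤ κ := by positivity
  refine ⟨V + 2 * c₁ + (2 * (V + κ) + 4 * κ + (2 * c₄ + 2 * c₅)), by positivity,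
    fun f M hM0 hf hs hM hH hfV => ?_⟩
  have hpos : ∀ n : ℕ, (0 : ℝ) < (1 / 2) ^ n := fun n => by positivity
  have hstart : ∀ z, ‖regCauchy ((1 / 2) ^ 0) z‖ ≤ 1 := fun z => by
    simpa using norm_regCauchy_le one_pos z
  obtain ⟨F, hF⟩ := exists_limit_of_norm_sub_le_geometric (q := 1 / 2) (K := M * c₁)
    (a := fun n => potential f (regCauchy ((1 / 2) ^ n))) (by norm_num) fun n x => by
      rw [pow_succ]; exact norm_potential_regCauchy_sub_le hf hs hM (hpos n) x
  obtain ⟨S, hS⟩ := exists_limit_of_norm_sub_le_geometric (q := q) (K := M * c₂)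
    (a := fun n => potential f (fun z => regCauchy ((1 / 2) ^ n) z ^ 2)) hq1 fun n x => by
      rw [pow_succ, ← hqn]
      exact norm_potential_regCauchy_sq_sub_le hf hs hα0 hα1 hH (hpos n) x
  have hK : ∀ n x, ‖potential f (poissonKer ((1 / 2) ^ n)) x - (∫ z, poissonKer 1 z) * f x‖ ≤
      M * c₃ * q ^ n := fun n x => by
    rw [← hqn]; exact norm_potential_poissonKer_sub_le hf hs hα0 hα1 hH (hpos n) x
  have hF' := tendstoUniformly_of_norm_sub_le_geometric (by norm_num) (by norm_num) hF
  have hFB : ∀ x, ‖F x‖ ≤ (V + 2 * c₁) * M := fun x => by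
    have h0 := hF 0 x
    have h1 := norm_potential_le hf hs hstart x
    have h2 := norm_le_norm_add_norm_sub (potential f (regCauchy ((1 / 2) ^ 0)) x) (F x)
    have h3 : M * c₁ / (1 - 1 / 2) * (1 / 2) ^ 0 = 2 * c₁ * M := by ring
    rw [h3] at h0
    linarith
  have hSB : ∀ x, ‖S x‖ ≤ (V + κ) * M := fun x => by
    have h0 := hS 0 x
    have h1 := norm_potential_le hf hs (k := fun z => regCauchy ((1 / 2) ^ 0) z ^ 2) (B := 1)
      (fun z => by rw [norm_pow]; exact pow_le_one₀ (norm_nonneg _) (hstart z)) x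
    have h2 := norm_le_norm_add_norm_sub
      (potential f (fun z => regCauchy ((1 / 2) ^ 0) z ^ 2) x) (S x)
    have h3 : M * c₂ / (1 - q) * q ^ 0 = κ * M := by simp only [κ]; ring
    rw [h3] at h0
    linarith
  have hSH : ∀ x x', ‖S x - S x'‖ ≤
      (2 * ((V + κ) * M) + 4 * (κ * M) + (2 * c₄ + 2 * c₅) * M) * ‖x - x'‖ ^ α := by
    refine norm_sub_le_of_dyadic_approximation
      (a := fun n => potential f (fun z => regCauchy ((1 / 2) ^ n) z ^ 2))
      hα0 hα1 hSB (by positivity) (by positivity) (fun n x => ?_) fun n x x' => ?_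
    · rw [hqn]
      refine (hS n x).trans_eq ?_
      simp only [κ]; ring
    · refine Convex.norm_image_sub_le_of_norm_hasFDerivWithin_le (s := Set.univ) (𝕜 := ℝ)
        (fun y _ => (hasFDerivAt_potential_regCauchy_sq hf hs (hpos n) y).hasFDerivWithinAt)
        (fun y _ => ?_) convex_univ (Set.mem_univ _) (Set.mem_univ _)
      refine (norm_mulAddMulConj_le _ _).trans ?_
      rw [norm_neg, norm_mul, norm_mul, Complex.norm_ofNat]
      have h1 := norm_potential_regCauchy_pow_three_le hf hs hα0 hα1 hH (hpos n) y
      have h2 := norm_potential_regCauchy_mul_poissonKer_le hf hs hα0 hα1 hH (hpos n) y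
      linarith
  refine ⟨F, fun x => -S x, ?_, ?_, fun x => ?_, fun x => ?_, fun x x' => ?_⟩
  · refine hasFDerivAt_of_tendstoUniformly (𝕜 := ℝ) (l := atTop)
      (f := fun n : ℕ => potential f (regLog ((1 / 2) ^ n)))
      (f' := fun n x => reMul (potential f (regCauchy ((1 / 2) ^ n)) x))
      ?_ (fun n x => hasFDerivAt_potential_regLog hf hs (hpos n) x)
      (tendsto_potential_regLog hf hs)
    exact reMul.uniformContinuous.comp_tendstoUniformly hF'
  · refine hasFDerivAt_of_tendstoUniformly (𝕜 := ℝ) (l := atTop)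
      (f := fun n : ℕ => potential f (regCauchy ((1 / 2) ^ n)))
      (f' := fun n x => mulAddMulConj (-potential f (fun z => regCauchy ((1 / 2) ^ n) z ^ 2) x)
        (potential f (poissonKer ((1 / 2) ^ n)) x))
      ?_ (fun n x => hasFDerivAt_potential_regCauchy hf hs (hpos n) x)
      fun x => hF'.tendsto_at x
    refine tendstoUniformly_of_norm_sub_le_geometric (q := q)
      (K := M * c₂ / (1 - q) + M * c₃) hq0 hq1 fun n x => ?_
    rw [mulAddMulConj_sub]
    refine (norm_mulAddMulConj_le _ _).trans ?_
    rw [← neg_sub', norm_neg, add_mul]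
    exact add_le_add (hS n x) (hK n x)
  · refine (hFB x).trans (mul_le_mul_of_nonneg_right ?_ hM0)
    linarith
  · rw [norm_neg]
    refine (hSB x).trans (mul_le_mul_of_nonneg_right ?_ hM0)
    linarith
  · rw [← neg_sub', norm_neg]
    refine (hSH x x').trans ?_
    gcongr
    nlinarith [mul_nonneg hV hM0, mul_nonneg hc₁ hM0]

/-- `g` is bounded by `B` on `s` and `α`-Hölder continuous on `s` with constant `B`. -/
def BoundedHolderOn (α B : ℝ) (s : Set ℂ) (g : ℂ → ℂ) : Prop :=
  ∀ x ∈ s, ‖g x‖ ≤ B ∧ ∀ x' ∈ s, ‖g x - g x'‖ ≤ B * ‖x - x'‖ ^ α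

namespace BoundedHolderOn

variable {α B B' : ℝ} {s t : Set ℂ} {g h : ℂ → ℂ}

lemma mono (hg : BoundedHolderOn α B s g) (hB : B ≤ B') : BoundedHolderOn α B' s g :=
  fun x hx => ⟨(hg x hx).1.trans hB, fun x' hx' => ((hg x hx).2 x' hx').trans (by gcongr)⟩

lemma mono_set (hg : BoundedHolderOn α B s g) (hst : t ⊆ s) : BoundedHolderOn α B t g :=
  fun x hx => ⟨(hg x (hst hx)).1, fun x' hx' => (hg x (hst hx)).2 x' (hst hx')⟩

lemma add (hg : BoundedHolderOn α B s g) (hh : BoundedHolderOn α B' s h) :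
    BoundedHolderOn α (B + B') s fun x => g x + h x := fun x hx => by
  refine ⟨(norm_add_le _ _).trans (add_le_add (hg x hx).1 (hh x hx).1), fun x' hx' => ?_⟩
  rw [add_sub_add_comm, add_mul]
  exact (norm_add_le _ _).trans (add_le_add ((hg x hx).2 x' hx') ((hh x hx).2 x' hx'))

lemma mul (hg : BoundedHolderOn α B s g) (hh : BoundedHolderOn α B' s h) :
    BoundedHolderOn α (2 * B * B') s fun x => g x * h x := fun x hx => by
  have hB : 0 ≤ B := (norm_nonneg _).trans (hg x hx).1
  have hB' : 0 ≤ B' := (norm_nonneg _).trans (hh x hx).1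
  refine ⟨?_, fun x' hx' => ?_⟩
  · rw [norm_mul]
    have := mul_le_mul (hg x hx).1 (hh x hx).1 (norm_nonneg _) hB
    nlinarith [mul_nonneg hB hB']
  · have e : g x * h x - g x' * h x' = g x * (h x - h x') + (g x - g x') * h x' := by ring
    rw [e]
    calc _ ≤ ‖g x‖ * ‖h x - h x'‖ + ‖g x - g x'‖ * ‖h x'‖ := by
          rw [← norm_mul, ← norm_mul]; exact norm_add_le _ _
      _ ≤ B * (B' * ‖x - x'‖ ^ α) + B * ‖x - x'‖ ^ α * B' := by
          gcongr
          · exact (hg x hx).1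
          · exact (hh x hx).2 x' hx'
          · exact (hg x hx).2 x' hx'
          · exact (hh x' hx').1
      _ = _ := by ring

lemma const_mul (hg : BoundedHolderOn α B s g) (c : ℂ) :
    BoundedHolderOn α (‖c‖ * B) s fun x => c * g x := fun x hx => by
  refine ⟨?_, fun x' hx' => ?_⟩
  · rw [norm_mul]; gcongr; exact (hg x hx).1
  · rw [← mul_sub, norm_mul, mul_assoc]; gcongr; exact (hg x hx).2 x' hx'

lemma neg (hg : BoundedHolderOn α B s g) : BoundedHolderOn α B s fun x => -g x := by
  simpa using hg.const_mul (-1)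

lemma star (hg : BoundedHolderOn α B s g) : BoundedHolderOn α B s fun x => conj (g x) :=
  fun x hx => ⟨by rw [RCLike.norm_conj]; exact (hg x hx).1, fun x' hx' => by
    rw [← map_sub, RCLike.norm_conj]; exact (hg x hx).2 x' hx'⟩

lemma comp (hg : BoundedHolderOn α B t g) (hα : 0 ≤ α) {σ : ℂ → ℂ} (hσ : ∀ x ∈ s, σ x ∈ t)
    (hL : ∀ x ∈ s, ∀ x' ∈ s, ‖σ x - σ x'‖ ≤ ‖x - x'‖) :
    BoundedHolderOn α B s fun x => g (σ x) := fun x hx => by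
  have hB : 0 ≤ B := (norm_nonneg _).trans (hg _ (hσ x hx)).1
  refine ⟨(hg _ (hσ x hx)).1, fun x' hx' => ((hg _ (hσ x hx)).2 _ (hσ x' hx')).trans ?_⟩
  gcongr
  exact hL x hx x' hx'

lemma of_lipschitz {L r : ℝ} (hα1 : α < 1) (hB : ∀ x ∈ s, ‖g x‖ ≤ B) (hL0 : 0 ≤ L)
    (hL : ∀ x ∈ s, ∀ x' ∈ s, ‖g x - g x'‖ ≤ L * ‖x - x'‖) (hs : s ⊆ Metric.ball 0 r) :
    BoundedHolderOn α (B + L * (2 * r) ^ (1 - α)) s g := fun x hx => by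
  have hB0 : 0 ≤ B := (norm_nonneg _).trans (hB x hx)
  have hx1 : ‖x‖ < r := by simpa using hs hx
  have hr : 0 < r := (norm_nonneg _).trans_lt hx1
  have hr1 : 0 ≤ (2 * r) ^ (1 - α) := by positivity
  refine ⟨(hB x hx).trans (le_add_of_nonneg_right (by positivity)), fun x' hx' => ?_⟩
  have hx2 : ‖x'‖ < r := by simpa using hs hx'
  rcases eq_or_ne x x' with rfl | hne
  · simp only [sub_self, norm_zero]; positivity
  have ht : 0 < ‖x - x'‖ := norm_pos_iff.2 (sub_ne_zero.2 hne)
  have h1 : ‖x - x'‖ = ‖x - x'‖ ^ (1 - α) * ‖x - x'‖ ^ α := by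
    rw [← Real.rpow_add ht, sub_add_cancel, Real.rpow_one]
  have h2 : ‖x - x'‖ ^ (1 - α) ≤ (2 * r) ^ (1 - α) := by
    apply Real.rpow_le_rpow ht.le _ (by linarith)
    linarith [norm_sub_le x x']
  calc _ ≤ L * ‖x - x'‖ := hL x hx x' hx'
    _ = L * (‖x - x'‖ ^ (1 - α) * ‖x - x'‖ ^ α) := by rw [← h1]
    _ ≤ L * ((2 * r) ^ (1 - α) * ‖x - x'‖ ^ α) := by gcongr
    _ = L * (2 * r) ^ (1 - α) * ‖x - x'‖ ^ α := by ring
    _ ≤ _ := by gcongr; linarith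

end BoundedHolderOn

/-- If the gradient of `u` is represented by `U` and the differential of `U` by `a` and `b`, then
bounds for `U`, `a`, `b` give bounds for the first two derivatives of `u`. -/
lemma fderiv_bounds_of_hasFDerivAt {u : ℂ → ℝ} {U a b : ℂ → ℂ} {s : Set ℂ} {α B₁ B₂ B₃ : ℝ}
    (hs : IsOpen s) (hu : ∀ x ∈ s, HasFDerivAt u (reMul (U x)) x)
    (hU : ∀ x ∈ s, HasFDerivAt U (mulAddMulConj (a x) (b x)) x)
    (hU' : BoundedHolderOn α B₁ s U) (ha : BoundedHolderOn α B₂ s a)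
    (hb : BoundedHolderOn α B₃ s b) {x : ℂ} (hx : x ∈ s) :
    ‖fderiv ℝ u x‖ ≤ B₁ ∧ ‖fderiv ℝ (fderiv ℝ u) x‖ ≤ B₂ + B₃ ∧ ∀ x' ∈ s,
      ‖fderiv ℝ u x - fderiv ℝ u x'‖ ≤ B₁ * ‖x - x'‖ ^ α ∧
      ‖fderiv ℝ (fderiv ℝ u) x - fderiv ℝ (fderiv ℝ u) x'‖ ≤ (B₂ + B₃) * ‖x - x'‖ ^ α := by
  have h1 : ∀ y ∈ s, fderiv ℝ u y = reMul (U y) := fun y hy => (hu y hy).fderiv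
  have h2 : ∀ y ∈ s, fderiv ℝ (fderiv ℝ u) y = reMul.comp (mulAddMulConj (a y) (b y)) :=
    fun y hy => by
      have he : fderiv ℝ u =ᶠ[𝓝 y] fun z => reMul (U z) :=
        eventually_of_mem (hs.mem_nhds hy) h1
      rw [he.fderiv_eq]
      exact (reMul.hasFDerivAt.comp y (hU y hy)).fderiv
  have h3 : ∀ p q : ℂ, ‖reMul.comp (mulAddMulConj p q)‖ ≤ ‖p‖ + ‖q‖ := fun p q => by
    refine (ContinuousLinearMap.opNorm_comp_le _ _).trans ?_
    refine (mul_le_of_le_one_left (norm_nonneg _) norm_reMul_le).trans ?_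
    exact norm_mulAddMulConj_le p q
  refine ⟨?_, ?_, fun x' hx' => ⟨?_, ?_⟩⟩
  · rw [h1 x hx]
    exact (norm_reMul_apply_le _).trans (hU' x hx).1
  · rw [h2 x hx]
    exact (h3 _ _).trans (add_le_add (ha x hx).1 (hb x hx).1)
  · rw [h1 x hx, h1 x' hx', ← map_sub]
    exact (norm_reMul_apply_le _).trans ((hU' x hx).2 x' hx')
  · rw [h2 x hx, h2 x' hx', ← ContinuousLinearMap.comp_sub, mulAddMulConj_sub, add_mul]
    exact (h3 _ _).trans (add_le_add ((ha x hx).2 x' hx') ((hb x hx).2 x' hx'))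

section inversion

variable {R : ℝ} {x : ℂ}

lemma hasFDerivAt_inversion (hx : x ≠ 0) :
    HasFDerivAt (fun z : ℂ => (R : ℂ) ^ 2 / conj z)
      (mulAddMulConj 0 (-(conj ((R : ℂ) / x)) ^ 2)) x := by
  have hx' : conj x ≠ 0 := (map_ne_zero _).2 hx
  have h2 : HasFDerivAt (fun z : ℂ => conj z) (Complex.conjCLE : ℂ →L[ℝ] ℂ) x :=
    Complex.conjCLE.hasFDerivAt
  have h := (((hasDerivAt_inv hx').hasFDerivAt.restrictScalars ℝ).comp x h2).const_mul
    ((R : ℂ) ^ 2)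
  refine h.congr_fderiv ?_
  ext v
  simp
  field_simp

lemma hasFDerivAt_const_div_sq (hx : x ≠ 0) (hR : R ≠ 0) :
    HasFDerivAt (fun z : ℂ => ((R : ℂ) / z) ^ 2)
      (mulAddMulConj (-(2 / R * ((R : ℂ) / x) ^ 3)) 0) x := by
  have hR' : (R : ℂ) ≠ 0 := by exact_mod_cast hR
  have h := ((((hasDerivAt_inv hx).const_mul (R : ℂ)).pow 2).hasFDerivAt.restrictScalars ℝ)
  refine h.congr_fderiv ?_
  ext v
  simp
  field_simp

/-- The gradient, in complex notation, of the composition with the inversion of a function with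
gradient `F`. -/
noncomputable def reflectedGradient (R : ℝ) (F : ℂ → ℂ) (x : ℂ) : ℂ :=
  -(conj (F ((R : ℂ) ^ 2 / conj x)) * ((R : ℂ) / x) ^ 2)

lemma hasFDerivAt_comp_inversion {N : ℂ → ℝ} {F : ℂ → ℂ}
    (hN : ∀ z, HasFDerivAt N (reMul (F z)) z) (hx : x ≠ 0) :
    HasFDerivAt (fun z => N ((R : ℂ) ^ 2 / conj z)) (reMul (reflectedGradient R F x)) x := by
  refine ((hN _).comp x (hasFDerivAt_inversion hx)).congr_fderiv ?_
  ext v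
  simp only [ContinuousLinearMap.comp_apply, reMul_apply, mulAddMulConj_apply]
  rw [← Complex.conj_re]
  congr 1
  simp [reflectedGradient]
  ring

lemma hasFDerivAt_reflectedGradient {F S P : ℂ → ℂ}
    (hF : ∀ z, HasFDerivAt F (mulAddMulConj (S z) (P z)) z) (hx : x ≠ 0) (hR : R ≠ 0) :
    HasFDerivAt (reflectedGradient R F)
      (mulAddMulConj
        (2 / R * (conj (F ((R : ℂ) ^ 2 / conj x)) * ((R : ℂ) / x) ^ 3) +
          conj (S ((R : ℂ) ^ 2 / conj x)) * (((R : ℂ) / x) ^ 2 * ((R : ℂ) / x) ^ 2))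
        (conj (P ((R : ℂ) ^ 2 / conj x)) * (((R : ℂ) / x) ^ 2 * conj (((R : ℂ) / x) ^ 2)))) x := by
  have h1 := (hF _).comp x (hasFDerivAt_inversion (R := R) hx)
  have h2 := (Complex.conjCLE : ℂ →L[ℝ] ℂ).hasFDerivAt.comp x h1
  refine (h2.mul (hasFDerivAt_const_div_sq hx hR)).neg.congr_fderiv ?_
  ext v
  simp
  ring

end inversion


section exterior

variable {R r d α : ℝ} {s : Set ℂ} {x x' : ℂ}

lemma norm_inversion_lt (hR : 0 < R) (hx : R < ‖x‖) : ‖(R : ℂ) ^ 2 / conj x‖ < R := by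
  rw [norm_div, RCLike.norm_conj, norm_pow, Complex.norm_real, Real.norm_of_nonneg hR.le,
    div_lt_iff₀ (hR.trans hx)]
  nlinarith

lemma norm_const_div_sub_const_div (hx : x ≠ 0) (hx' : x' ≠ 0) (a : ℂ) :
    ‖a / x - a / x'‖ = ‖a‖ / (‖x‖ * ‖x'‖) * ‖x - x'‖ := by
  have e : a / x - a / x' = a / (x * x') * -(x - x') := by field_simp; ring
  rw [e, norm_mul, norm_div, norm_mul, norm_neg]

lemma norm_inversion_sub_le (hR : 0 < R) (hx : R < ‖x‖) (hx' : R < ‖x'‖) :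
    ‖(R : ℂ) ^ 2 / conj x - (R : ℂ) ^ 2 / conj x'‖ ≤ ‖x - x'‖ := by
  have h0 : x ≠ 0 := norm_pos_iff.1 (hR.trans hx)
  have h0' : x' ≠ 0 := norm_pos_iff.1 (hR.trans hx')
  rw [norm_const_div_sub_const_div ((map_ne_zero _).2 h0) ((map_ne_zero _).2 h0'), ← map_sub,
    RCLike.norm_conj, RCLike.norm_conj, RCLike.norm_conj, norm_pow, Complex.norm_real,
    Real.norm_of_nonneg hR.le]
  refine mul_le_of_le_one_left (norm_nonneg _) (div_le_one_of_le₀ ?_ (by positivity))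
  nlinarith

lemma boundedHolderOn_const_div (hα1 : α < 1) (hd : 0 < d) (hdR : d ≤ R)
    (hs : ∀ x ∈ s, R < ‖x‖) (hsr : s ⊆ Metric.ball 0 r) :
    BoundedHolderOn α (1 + 1 / d * (2 * r) ^ (1 - α)) s fun x => (R : ℂ) / x := by
  have hR : 0 < R := hd.trans_le hdR
  refine .of_lipschitz hα1 (fun x hx => ?_) (by positivity) (fun x hx x' hx' => ?_) hsr
  · rw [norm_div, Complex.norm_real, Real.norm_of_nonneg hR.le]
    exact div_le_one_of_le₀ (hs x hx).le (norm_nonneg _)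
  · have h := hs x hx
    have h' := hs x' hx'
    rw [norm_const_div_sub_const_div (norm_pos_iff.1 (hR.trans h)) (norm_pos_iff.1 (hR.trans h')),
      Complex.norm_real, Real.norm_of_nonneg hR.le]
    have hp : 0 < ‖x‖ := hR.trans h
    have hp' : 0 < ‖x'‖ := hR.trans h'
    refine mul_le_mul_of_nonneg_right ?_ (norm_nonneg _)
    rw [div_le_div_iff₀ (by positivity) hd]
    nlinarith

lemma norm_neg_inv_two_pi_le : ‖(-(1 / (2 * Real.pi) : ℝ) : ℂ)‖ ≤ 1 := by
  rw [norm_neg, Complex.norm_real, Real.norm_of_nonneg (by positivity)]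
  exact div_le_one_of_le₀ (by linarith [Real.pi_gt_three]) (by positivity)

/-- Bounds for the gradient and the second derivatives of the logarithmic potential and its
reflection outside a disk. -/
lemma boundedHolderOn_reflection {F S P : ℂ → ℂ} {K B : ℝ} (hα0 : 0 < α)
    (hd : 0 < d) (hdR : d ≤ R) (hs : ∀ x ∈ s, R < ‖x‖) (hsr : s ⊆ Metric.ball 0 r) (hRr : R ≤ r)
    (hK : 0 ≤ K) (hB : 0 ≤ B) (hq : BoundedHolderOn α B s fun x => (R : ℂ) / x)
    (hF : BoundedHolderOn α K (Metric.ball 0 r) F) (hS : BoundedHolderOn α K (Metric.ball 0 r) S)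
    (hP : BoundedHolderOn α K (Metric.ball 0 r) P) :
    BoundedHolderOn α (K * (1 + 4 * B ^ 2)) s
      (fun x => (-(1 / (2 * Real.pi) : ℝ) : ℂ) * (F x + reflectedGradient R F x)) ∧
    BoundedHolderOn α (K * (1 + 2 / d * (8 * B ^ 3) + 16 * B ^ 4)) s
      (fun x => (-(1 / (2 * Real.pi) : ℝ) : ℂ) * (S x +
        (2 / R * (conj (F ((R : ℂ) ^ 2 / conj x)) * ((R : ℂ) / x) ^ 3) +
          conj (S ((R : ℂ) ^ 2 / conj x)) * (((R : ℂ) / x) ^ 2 * ((R : ℂ) / x) ^ 2)))) ∧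
    BoundedHolderOn α (K * (1 + 16 * B ^ 4)) s
      (fun x => (-(1 / (2 * Real.pi) : ℝ) : ℂ) * (P x +
        conj (P ((R : ℂ) ^ 2 / conj x)) * (((R : ℂ) / x) ^ 2 * conj (((R : ℂ) / x) ^ 2)))) := by
  have hR : 0 < R := hd.trans_le hdR
  have hσ : ∀ {g : ℂ → ℂ}, BoundedHolderOn α K (Metric.ball 0 r) g →
      BoundedHolderOn α K s fun x => conj (g ((R : ℂ) ^ 2 / conj x)) := fun hg =>
    (hg.comp hα0.le (fun x hx => by simpa using (norm_inversion_lt hR (hs x hx)).trans_le hRr)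
      fun x hx x' hx' => norm_inversion_sub_le hR (hs x hx) (hs x' hx')).star
  have hq2 : BoundedHolderOn α (2 * B ^ 2) s fun x => ((R : ℂ) / x) ^ 2 := by
    have h := hq.mul hq
    simp only [← sq] at h
    exact h.mono (by rw [mul_assoc, ← sq])
  have hq3 : BoundedHolderOn α (4 * B ^ 3) s fun x => ((R : ℂ) / x) ^ 3 := by
    have h := hq2.mul hq
    simp only [← pow_succ] at h
    exact h.mono (by ring_nf; rfl)
  have hπ : ∀ {g : ℂ → ℂ} {D : ℝ}, 0 ≤ D → BoundedHolderOn α D s g →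
      BoundedHolderOn α D s fun x => (-(1 / (2 * Real.pi) : ℝ) : ℂ) * g x := fun hD hg =>
    (hg.const_mul _).mono (mul_le_of_le_one_left hD norm_neg_inv_two_pi_le)
  have h2R : ‖(2 / R : ℂ)‖ ≤ 2 / d := by
    rw [norm_div, Complex.norm_real, Real.norm_of_nonneg hR.le, Complex.norm_ofNat]
    gcongr
  refine ⟨hπ (by positivity) ?_, hπ (by positivity) ?_, hπ (by positivity) ?_⟩
  · exact ((hF.mono_set hsr).add ((hσ hF).mul hq2).neg).mono (le_of_eq (by ring))
  · have h1 := ((hσ hF).mul hq3).const_mul (2 / R)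
    have h1' := h1.mono (mul_le_mul_of_nonneg_right h2R (by positivity))
    exact ((hS.mono_set hsr).add (h1'.add ((hσ hS).mul (hq2.mul hq2)))).mono
      (le_of_eq (by ring))
  · exact ((hP.mono_set hsr).add ((hσ hP).mul (hq2.mul hq2.star))).mono (le_of_eq (by ring))

end exterior

lemma integral_mul_GN {f : ℂ → ℝ} (hf : Continuous f) (hs : HasCompactSupport f) {R : ℝ} {x : ℂ}
    (hx : x ≠ 0) :
    ∫ y, f y * GN R x y = -(1 / (2 * Real.pi)) * (potential f (fun z => Real.log ‖z‖) x +
      potential f (fun z => Real.log ‖z‖) ((R : ℂ) ^ 2 / conj x)) +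
      ∫ y, f y * (‖y‖ ^ 2 / (4 * Real.pi * R ^ 2)) := by
  have hx' : conj x ≠ 0 := (map_ne_zero _).2 hx
  have e : (R ^ 2 / ‖x‖ ^ 2 : ℝ) • x = (R : ℂ) ^ 2 / conj x := by
    rw [Complex.real_smul, eq_div_iff hx', mul_assoc, Complex.mul_conj, Complex.normSq_eq_norm_sq,
      ← Complex.ofReal_mul, div_mul_cancel₀ _ (by positivity)]
    push_cast; rfl
  have h1 := integrable_mul_log hf hs x
  have h2 := integrable_mul_log hf hs ((R : ℂ) ^ 2 / conj x)
  have h12 : Integrable fun y => f y * Real.log ‖x - y‖ +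
      f y * Real.log ‖(R : ℂ) ^ 2 / conj x - y‖ := h1.add h2
  have h3 : Integrable fun y => f y * (‖y‖ ^ 2 / (4 * Real.pi * R ^ 2)) :=
    (hf.mul (by fun_prop)).integrable_of_hasCompactSupport hs.mul_right
  simp only [potential, smul_eq_mul]
  rw [← integral_add h1 h2, ← integral_const_mul, ← integral_add (h12.const_mul _) h3]
  refine integral_congr_ae (Eventually.of_forall fun y => ?_)
  simp only [GN, e]
  rw [norm_sub_rev y x, norm_sub_rev y]
  ring

lemma integral_abs_le_of_support_subset {f : ℂ → ℝ} {M r : ℝ} (hM : ∀ x, |f x| ≤ M)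
    (hf : Function.support f ⊆ Metric.ball 0 r) :
    ∫ y, |f y| ≤ M * volume.real (Metric.ball (0 : ℂ) r) := by
  have h0 : ∀ y ∉ Metric.ball (0 : ℂ) r, |f y| = 0 := fun y hy => by
    rw [abs_eq_zero]; by_contra h; exact hy (hf h)
  rw [← setIntegral_eq_integral_of_forall_compl_eq_zero h0]
  exact (le_abs_self _).trans (norm_setIntegral_le_of_norm_le_const (f := fun y => |f y|)
    Metric.isBounded_ball.measure_lt_top fun y _ => by simpa using hM y)

lemma continuous_of_holder {f : ℂ → ℝ} {M α : ℝ} (hα0 : 0 < α)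
    (hf : ∀ x x', |f x - f x'| ≤ M * ‖x - x'‖ ^ α) : Continuous f := by
  refine continuous_iff_continuousAt.2 fun x => ?_
  refine tendsto_iff_norm_sub_tendsto_zero.2 (squeeze_zero (fun _ => norm_nonneg _)
    (fun y => hf y x) ?_)
  have h : Continuous fun y : ℂ => M * ‖y - x‖ ^ α :=
    continuous_const.mul ((by fun_prop : Continuous fun y : ℂ => ‖y - x‖).rpow_const
      fun _ => Or.inr hα0.le)
  simpa [Real.zero_rpow hα0.ne'] using h.tendsto x

theorem stmt_10 (α d rmax : ℝ) (hα0 : 0 < α) (hα1 : α < 1) (hd : 0 < d) (hdr : d < rmax) :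
    ∃ C : ℝ, 0 < C ∧
      ∀ R : ℝ, d ≤ R → R ≤ rmax →
        ∀ f : ℂ → ℝ,
          Function.support f ⊆
            Metric.ball (0:ℂ) (R + 2 * d / 3) \ Metric.closedBall (0:ℂ) (R + d / 3) →
          ∀ M : ℝ, 0 ≤ M →
            (∀ x, |f x| ≤ M) →
            (∀ x x' : ℂ, |f x - f x'| ≤ M * ‖x - x'‖ ^ α) →
            ∀ u : ℂ → ℝ,
              (∀ x ∈ Metric.ball (0:ℂ) (R + d) \ Metric.closedBall (0:ℂ) R,
                u x = ∫ y : ℂ, f y * GN R x y) →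
              ∀ x ∈ Metric.ball (0:ℂ) (R + d) \ Metric.closedBall (0:ℂ) R,
                (‖fderiv ℝ u x‖ ≤ C * M) ∧
                (‖fderiv ℝ (fderiv ℝ u) x‖ ≤ C * M) ∧
                ∀ x' ∈ Metric.ball (0:ℂ) (R + d) \ Metric.closedBall (0:ℂ) R,
                  (‖fderiv ℝ u x - fderiv ℝ u x'‖ ≤ C * M * ‖x - x'‖ ^ α) ∧
                  (‖fderiv ℝ (fderiv ℝ u) x - fderiv ℝ (fderiv ℝ u) x'‖ ≤
                    C * M * ‖x - x'‖ ^ α) := by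
  set r := rmax + d
  have hr : 0 < r := by simp only [r]; linarith
  set c := ∫ z, poissonKer 1 z
  obtain ⟨C₀, hC₀, hest⟩ := exists_logPotential_estimate (volume.real (Metric.ball (0 : ℂ) r))
    measureReal_nonneg hα0 hα1
  set K := C₀ + (C₀ + ‖c‖) * (2 * r) ^ (1 - α) + ‖c‖
  set B := 1 + 1 / d * (2 * r) ^ (1 - α)
  have hp : 0 ≤ (2 * r) ^ (1 - α) := by positivity
  have hK : 0 ≤ K := by positivity
  have hB : 0 ≤ B := by positivity
  set D₁ := K * (1 + 4 * B ^ 2)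
  set D₂ := K * (1 + 2 / d * (8 * B ^ 3) + 16 * B ^ 4)
  set D₃ := K * (1 + 16 * B ^ 4)
  have hD₁ : 0 ≤ D₁ := by positivity
  have hD₂ : 0 ≤ D₂ := by positivity
  have hD₃ : 0 ≤ D₃ := by positivity
  refine ⟨D₁ + D₂ + D₃ + 1, by positivity, fun R hdR hRr f hsupp M hM hbd hhol u hu => ?_⟩
  have hR : 0 < R := hd.trans_le hdR
  have hsupp' : Function.support f ⊆ Metric.ball 0 r :=
    (hsupp.trans Set.sdiff_subset).trans (Metric.ball_subset_ball (by simp only [r]; linarith))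
  have hf : Continuous f := continuous_of_holder hα0 hhol
  have hs : HasCompactSupport f := HasCompactSupport.intro (isCompact_closedBall (0 : ℂ) r)
    fun y hy => by
      by_contra h; exact hy (Metric.ball_subset_closedBall (hsupp' h))
  obtain ⟨F, S, hN, hF, hF', hS', hS''⟩ := hest f M hM hf hs hbd hhol
    (integral_abs_le_of_support_subset hbd hsupp')
  set A := Metric.ball (0 : ℂ) (R + d) \ Metric.closedBall (0 : ℂ) R
  have hA : IsOpen A := Metric.isOpen_ball.sdiff Metric.isClosed_closedBall
  have hAR : ∀ x ∈ A, R < ‖x‖ := fun x hx => by simpa using hx.2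
  have hAr : A ⊆ Metric.ball 0 r :=
    Set.sdiff_subset.trans (Metric.ball_subset_ball (by simp only [r]; linarith))
  have hFL : ∀ x x', ‖F x - F x'‖ ≤ (C₀ + ‖c‖) * M * ‖x - x'‖ := fun x x' =>
    convex_univ.norm_image_sub_le_of_norm_hasFDerivWithin_le
      (fun y _ => (hF y).hasFDerivWithinAt) (fun y _ => by
        refine (norm_mulAddMulConj_le _ _).trans ?_
        rw [add_mul, norm_mul, Complex.norm_real]
        exact add_le_add (hS' y) (mul_le_mul_of_nonneg_left (hbd y) (norm_nonneg _)))
      (Set.mem_univ _) (Set.mem_univ _)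
  have hFB : BoundedHolderOn α (K * M) (Metric.ball 0 r) F := by
    refine (BoundedHolderOn.of_lipschitz hα1 (fun x _ => hF' x) (by positivity)
      (fun x _ x' _ => hFL x x') subset_rfl).mono ?_
    have : 0 ≤ ‖c‖ * M := by positivity
    simp only [K]
    linarith
  have hSB : BoundedHolderOn α (K * M) (Metric.ball 0 r) S := by
    have h : BoundedHolderOn α (C₀ * M) (Metric.ball 0 r) S :=
      fun x _ => ⟨hS' x, fun x' _ => hS'' x x'⟩
    refine h.mono (mul_le_mul_of_nonneg_right ?_ hM)
    have : 0 ≤ (C₀ + ‖c‖) * (2 * r) ^ (1 - α) := by positivity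
    linarith [norm_nonneg c]
  have hPB : BoundedHolderOn α (K * M) (Metric.ball 0 r) fun x => c * f x := by
    have h : BoundedHolderOn α M (Metric.ball 0 r) fun x => (f x : ℂ) := fun x _ =>
      ⟨by rw [Complex.norm_real]; exact hbd x, fun x' _ => by
        rw [← Complex.ofReal_sub, Complex.norm_real]; exact hhol x x'⟩
    refine (h.const_mul c).mono (mul_le_mul_of_nonneg_right ?_ hM)
    have : 0 ≤ (C₀ + ‖c‖) * (2 * r) ^ (1 - α) := by positivity
    linarith
  obtain ⟨hUB, haB, hbB⟩ := boundedHolderOn_reflection hα0 hd hdR hAR hAr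
    (by simp only [r]; linarith) (mul_nonneg hK hM) hB
    (boundedHolderOn_const_div hα1 hd hdR hAR hAr) hFB hSB hPB
  have hA0 : ∀ x ∈ A, x ≠ 0 := fun x hx => norm_pos_iff.1 (hR.trans (hAR x hx))
  have hu' : ∀ x ∈ A, HasFDerivAt u
      (reMul ((-(1 / (2 * Real.pi) : ℝ) : ℂ) * (F x + reflectedGradient R F x))) x :=
    fun x hx => by
      have h := (((hN x).add (hasFDerivAt_comp_inversion (R := R) hN (hA0 x hx))).const_mul
        (-(1 / (2 * Real.pi)))).add_const (∫ y, f y * (‖y‖ ^ 2 / (4 * Real.pi * R ^ 2)))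
      refine (h.congr_of_eventuallyEq ?_).congr_fderiv ?_
      · filter_upwards [hA.mem_nhds hx] with z hz
        rw [hu z hz, integral_mul_GN hf hs (hA0 z hz)]
        rfl
      · ext v
        rw [← Complex.ofReal_neg, smul_apply, reMul_apply, mul_assoc,
          Complex.re_ofReal_mul, add_mul, Complex.add_re]
        rfl
  have hU' := fun x (hx : x ∈ A) => (((hF x).add (hasFDerivAt_reflectedGradient hF (hA0 x hx)
    hR.ne')).const_mul (-(1 / (2 * Real.pi) : ℝ) : ℂ)).congr_fderiv (smul_mulAddMulConj_add ..)
  intro x hx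
  obtain ⟨h1, h2, h3⟩ := fderiv_bounds_of_hasFDerivAt hA hu' hU' hUB haB hbB hx
  have e1 : K * M * (1 + 4 * B ^ 2) ≤ (D₁ + D₂ + D₃ + 1) * M := by
    have : K * M * (1 + 4 * B ^ 2) = D₁ * M := by simp only [D₁]; ring
    rw [this]; exact mul_le_mul_of_nonneg_right (by linarith) hM
  have e2 : K * M * (1 + 2 / d * (8 * B ^ 3) + 16 * B ^ 4) + K * M * (1 + 16 * B ^ 4) ≤
      (D₁ + D₂ + D₃ + 1) * M := by
    have : K * M * (1 + 2 / d * (8 * B ^ 3) + 16 * B ^ 4) + K * M * (1 + 16 * B ^ 4) =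
      (D₂ + D₃) * M := by simp only [D₂, D₃]; ring
    rw [this]; exact mul_le_mul_of_nonneg_right (by linarith) hM
  refine ⟨h1.trans e1, h2.trans e2, fun x' hx' => ⟨((h3 x' hx').1).trans ?_,
    ((h3 x' hx').2).trans ?_⟩⟩ <;> gcongr
end

section
/- Let n ∈ ℕ, R₀ > 0, and suppose the cavitation configuration ((aᵢ)ᵢ₌₁ⁿ, (vᵢ)ᵢ₌₁ⁿ) in B_{R₀}(0) ⊂ ℝ² is attainable through an evolution of circular cavities, with evolutions zᵢ(t), Lᵢ(t), t ∈ [1,λ] (so πLᵢ(λ)² = vᵢ). Let R₁,…,Rₙ > 0 be such that, setting rᵢ(t) = √(Lᵢ(t)² + Rᵢ²), for every t ∈ [1,λ] the closed disks B̄_{rᵢ(t)}(zᵢ(t)), i = 1,…,n, are pairwise disjoint and contained in B_{tR₀}(0). Define u_near on ⋃ᵢ₌₁ⁿ (B̄_{Rᵢ}(aᵢ) ∖ {aᵢ}) by u_near(aᵢ + re^{iθ}) = zᵢ(λ) + √(Lᵢ(λ)² + r²) e^{iθ} for 0 < r ≤ Rᵢ and θ ∈ [0,2π]. Then: (i) u_near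 is injective on its domain; (ii) det Du_near(x) = 1 at every point x of its (open) domain; (iii) for each i and each 0 < ε < Rᵢ, u_near maps {x : ε < |x − aᵢ| ≤ Rᵢ} onto {y : √(vᵢ/π + ε²) < |y − zᵢ(λ)| ≤ √(vᵢ/π + Rᵢ²)}; and (iv) for every ε with 0 < ε < min{1, R₁, …, Rₙ}, ∫_{⋃ᵢ{x : ε<|x−aᵢ|<Rᵢ}} |Du_near|²/2 dx ≤ Σᵢ πRᵢ² + Σᵢ vᵢ log Rᵢ + (Σᵢ vᵢ)|log ε|. -/
open scoped BigOperators

/-- A cavitation configuration `(a, v)` attainable through an evolution of circular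
cavities: the data of the evolutions `z` (centers) and `L` (radii) with all the
required properties, for the stretch factor `lam`. -/
def IsCircEvolution (n : ℕ) (R₀ lam : ℝ) (a : Fin n → ℂ) (v : Fin n → ℝ)
    (z : Fin n → ℝ → ℂ) (L : Fin n → ℝ → ℝ) : Prop :=
  (∀ i, ContDiffOn ℝ 1 (z i) (Set.Icc 1 lam)) ∧
  (∀ i, ∀ t ∈ Set.Icc (1:ℝ) lam, 0 ≤ L i t) ∧
  (∀ t ∈ Set.Icc (1:ℝ) lam, ∑ i, Real.pi * L i t ^ 2 = (t ^ 2 - 1) * Real.pi * R₀ ^ 2) ∧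
  (∀ i, ContDiffOn ℝ 1 (fun t => L i t ^ 2) (Set.Icc 1 lam)) ∧
  (∀ i, z i 1 = a i) ∧
  (∀ i, L i 1 = 0) ∧
  (∀ i, Real.pi * L i lam ^ 2 = v i) ∧
  (∀ t ∈ Set.Icc (1:ℝ) lam, Pairwise (fun i j =>
    Disjoint (Metric.closedBall (z i t) (L i t)) (Metric.closedBall (z j t) (L j t)))) ∧
  (∀ t ∈ Set.Icc (1:ℝ) lam, ∀ i, Metric.closedBall (z i t) (L i t) ⊆ Metric.ball (0:ℂ) (t * R₀))

/-- The radial map of `ℂ` opening a circular cavity of area `π * c` at the origin. -/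
noncomputable def cavityMap (c : ℝ) (x : ℂ) : ℂ := (Real.sqrt (c + ‖x‖ ^ 2) / ‖x‖) • x

lemma norm_cavityMap (c : ℝ) {x : ℂ} (hx : x ≠ 0) :
    ‖cavityMap c x‖ = Real.sqrt (c + ‖x‖ ^ 2) := by
  have := norm_pos_iff.2 hx
  rw [cavityMap, norm_smul, Real.norm_of_nonneg (by positivity)]
  field_simp

lemma cavityMap_injOn {c : ℝ} (hc : 0 ≤ c) : Set.InjOn (cavityMap c) {0}ᶜ := by
  intro x hx y hy h
  have hx0 := norm_pos_iff.2 hx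
  have hy0 := norm_pos_iff.2 hy
  have hn : ‖x‖ = ‖y‖ := by
    have h1 := congrArg norm h
    rw [norm_cavityMap c hx, norm_cavityMap c hy, Real.sqrt_inj (by positivity) (by positivity)]
      at h1
    exact (pow_left_inj₀ hx0.le hy0.le two_ne_zero).1 (by linarith)
  rw [cavityMap, cavityMap, hn] at h
  have : Real.sqrt (c + ‖y‖ ^ 2) / ‖y‖ ≠ 0 := by positivity
  exact smul_right_injective ℂ this h

lemma cavityMap_image_annulus {c ε R : ℝ} (hc : 0 ≤ c) (hε : 0 ≤ ε) (hR : 0 ≤ R) :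
    cavityMap c '' {x | ε < ‖x‖ ∧ ‖x‖ ≤ R} =
      {y | Real.sqrt (c + ε ^ 2) < ‖y‖ ∧ ‖y‖ ≤ Real.sqrt (c + R ^ 2)} := by
  ext y
  constructor
  · rintro ⟨x, ⟨h1, h2⟩, rfl⟩
    have hx : x ≠ 0 := norm_pos_iff.1 (hε.trans_lt h1)
    rw [Set.mem_ofPred_eq, norm_cavityMap c hx]
    exact ⟨Real.sqrt_lt_sqrt (by positivity) (by gcongr), Real.sqrt_le_sqrt (by gcongr)⟩
  · rintro ⟨h1, h2⟩
    have hy : 0 < ‖y‖ := (Real.sqrt_nonneg _).trans_lt h1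
    rw [Real.sqrt_lt' hy] at h1
    rw [Real.le_sqrt hy.le (by positivity)] at h2
    have hd : 0 < ‖y‖ ^ 2 - c := by nlinarith [sq_nonneg ε]
    set r := Real.sqrt (‖y‖ ^ 2 - c) with hr
    have hr0 : 0 < r := Real.sqrt_pos.2 hd
    have hr2 : r ^ 2 = ‖y‖ ^ 2 - c := Real.sq_sqrt hd.le
    have hn : ‖(r / ‖y‖) • y‖ = r := by
      rw [norm_smul, Real.norm_of_nonneg (by positivity)]
      field_simp
    refine ⟨(r / ‖y‖) • y, ⟨?_, ?_⟩, ?_⟩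
    · rw [hn]
      exact lt_of_pow_lt_pow_left₀ 2 hr0.le (by linarith)
    · rw [hn]
      exact le_of_sq_le_sq (by linarith) hR
    · rw [cavityMap, hn, hr2, add_sub_cancel, Real.sqrt_sq hy.le, smul_smul,
        div_mul_div_cancel₀ hr0.ne', div_self hy.ne', one_smul]

lemma hasFDerivAt_cavityMap {c : ℝ} (hc : 0 ≤ c) {x : ℂ} (hx : x ≠ 0) :
    ∃ (φ k : ℝ) (D : ℂ →L[ℝ] ℂ), HasFDerivAt (cavityMap c) D x ∧
      φ ^ 2 = 1 + c / ‖x‖ ^ 2 ∧ φ * k * ‖x‖ ^ 2 = c / ‖x‖ ^ 2 ∧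
      ∀ h, D h = φ • h - (k * (x.re * h.re + x.im * h.im)) • x := by
  have hn := norm_pos_iff.2 hx
  have hne : 1 + c / ‖x‖ ^ 2 ≠ 0 := by positivity
  set φ := Real.sqrt (1 + c / ‖x‖ ^ 2) with hφ
  have hφ0 : 0 < φ := Real.sqrt_pos.2 (by positivity)
  have hφ2 : φ ^ 2 = 1 + c / ‖x‖ ^ 2 := Real.sq_sqrt (by positivity)
  have heq : cavityMap c =ᶠ[nhds x] fun y => Real.sqrt (1 + c * (‖y‖ ^ 2)⁻¹) • y := by
    filter_upwards [isOpen_ne.mem_nhds hx] with y hy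
    have hy0 := norm_pos_iff.2 hy
    rw [cavityMap]
    congr 1
    rw [show 1 + c * (‖y‖ ^ 2)⁻¹ = (c + ‖y‖ ^ 2) / ‖y‖ ^ 2 by field_simp; ring,
      Real.sqrt_div (by positivity), Real.sqrt_sq hy0.le]
  have hs := (hasStrictFDerivAt_norm_sq x).hasFDerivAt
  have hi := (hasDerivAt_inv (x := ‖x‖ ^ 2) (by positivity)).comp_hasFDerivAt x hs
  have hq := ((hi.const_mul c).const_add 1).sqrt (by simpa [div_eq_mul_inv] using hne)
  have hD := (hq.smul (hasFDerivAt_id x)).congr_of_eventuallyEq heq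
  refine ⟨φ, c / (φ * ‖x‖ ^ 4), _, hD, hφ2, by field_simp, fun h => ?_⟩
  simp only [← div_eq_mul_inv, Function.comp_apply, ← hφ]
  simp [Complex.inner, ← div_eq_mul_inv]
  have h1 : (φ : ℂ) ≠ 0 := Complex.ofReal_ne_zero.2 hφ0.ne'
  have h2 : (‖x‖ : ℂ) ≠ 0 := Complex.ofReal_ne_zero.2 hn.ne'
  field_simp
  ring

lemma det_fderiv_cavityMap {c : ℝ} (hc : 0 ≤ c) {x : ℂ} (hx : x ≠ 0) :
    LinearMap.det (fderiv ℝ (cavityMap c) x).toLinearMap = 1 := by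
  obtain ⟨φ, k, D, hD, h1, h2, h3⟩ := hasFDerivAt_cavityMap hc hx
  rw [hD.fderiv, ← LinearMap.det_toMatrix Complex.basisOneI, Matrix.det_fin_two]
  have hs : ‖x‖ ^ 2 = x.re * x.re + x.im * x.im := by
    rw [← Complex.normSq_eq_norm_sq, Complex.normSq_apply]
  simp [LinearMap.toMatrix_apply, h3]
  rw [← h2, hs] at h1
  linear_combination h1

lemma frobenius_fderiv_cavityMap_le {c : ℝ} (hc : 0 ≤ c) {x : ℂ} (hx : x ≠ 0) :
    (‖fderiv ℝ (cavityMap c) x 1‖ ^ 2 + ‖fderiv ℝ (cavityMap c) x Complex.I‖ ^ 2) / 2 ≤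
      1 + c / 2 * (‖x‖ ^ 2)⁻¹ := by
  obtain ⟨φ, k, D, hD, h1, h2, h3⟩ := hasFDerivAt_cavityMap hc hx
  have hn := norm_pos_iff.2 hx
  have hs : ‖x‖ ^ 2 = x.re * x.re + x.im * x.im := by
    rw [← Complex.normSq_eq_norm_sq, Complex.normSq_apply]
  have hfrob : ‖D 1‖ ^ 2 + ‖D Complex.I‖ ^ 2 =
      2 * φ ^ 2 - 2 * (φ * k * ‖x‖ ^ 2) + (k * ‖x‖ ^ 2) ^ 2 := by
    rw [← Complex.normSq_eq_norm_sq, ← Complex.normSq_eq_norm_sq, Complex.normSq_apply,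
      Complex.normSq_apply, hs]
    simp [h3]
    ring
  have hd : 0 ≤ c / ‖x‖ ^ 2 := by positivity
  have hk : (k * ‖x‖ ^ 2) ^ 2 ≤ c / ‖x‖ ^ 2 := by
    have hp : φ ^ 2 * (k * ‖x‖ ^ 2) ^ 2 = (c / ‖x‖ ^ 2) ^ 2 := by rw [← h2]; ring
    rw [h1] at hp
    set d := c / ‖x‖ ^ 2
    nlinarith [sq_nonneg (k * ‖x‖ ^ 2)]
  rw [hD.fderiv, hfrob, h1, h2, ← div_eq_mul_inv, div_right_comm]
  linarith

lemma integrable_and_integral_annulus {c ε R : ℝ} (hε : 0 < ε) (hεR : ε < R) (a : ℂ) :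
    let g : ℂ → ℝ := fun x =>
      (Set.Ioo ε R).indicator (fun r => 1 + c / 2 * (r ^ 2)⁻¹) ‖x - a‖
    MeasureTheory.Integrable g ∧
      ∫ x, g x = Real.pi * (R ^ 2 - ε ^ 2) + Real.pi * c * (Real.log R - Real.log ε) := by
  intro g
  set f : ℝ → ℝ := (Set.Ioo ε R).indicator (fun r => 1 + c / 2 * (r ^ 2)⁻¹) with hf
  have hR : 0 < R := hε.trans hεR
  have hmul : (fun y : ℝ => y ^ (Module.finrank ℝ ℂ - 1) • f y) =
      (Set.Ioo ε R).indicator (fun r => r + c / 2 * r⁻¹) := by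
    ext y
    by_cases hy : y ∈ Set.Ioo ε R
    · have : y ≠ 0 := (hε.trans hy.1).ne'
      simp [hf, hy, Complex.finrank_real_complex]
      field_simp
    · simp [hf, hy]
  have hcont : ContinuousOn (fun r : ℝ => r + c / 2 * r⁻¹) (Set.uIcc ε R) := by
    rw [Set.uIcc_of_le hεR.le]
    refine continuousOn_id.add (continuousOn_const.mul (continuousOn_id.inv₀ fun r hr => ?_))
    exact (hε.trans_le hr.1).ne'
  have hint := hcont.intervalIntegrable (μ := MeasureTheory.volume)
  have hsubs : Set.Ioo ε R ⊆ Set.Ioi 0 := fun r hr => hε.trans hr.1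
  constructor
  · refine MeasureTheory.Integrable.comp_sub_right (f := fun x : ℂ => f ‖x‖) ?_ a
    rw [MeasureTheory.integrable_fun_norm_addHaar, hmul]
    refine MeasureTheory.Integrable.integrableOn ?_
    rw [MeasureTheory.integrable_indicator_iff measurableSet_Ioo,
      ← intervalIntegrable_iff_integrableOn_Ioo_of_le hεR.le]
    exact hint
  · have h1 : ∫ x, g x = ∫ x : ℂ, f ‖x‖ :=
      MeasureTheory.integral_sub_right_eq_self (fun x : ℂ => f ‖x‖) a
    have h2 : MeasureTheory.volume.real (Metric.ball (0 : ℂ) 1) = Real.pi := by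
      simp [MeasureTheory.Measure.real, Complex.volume_ball]
    rw [h1, MeasureTheory.integral_fun_norm_addHaar, hmul, h2, Complex.finrank_real_complex,
      MeasureTheory.setIntegral_indicator measurableSet_Ioo, Set.inter_eq_right.2 hsubs,
      ← MeasureTheory.integral_Ioc_eq_integral_Ioo, ← intervalIntegral.integral_of_le hεR.le,
      intervalIntegral.integral_add intervalIntegral.intervalIntegrable_id,
      intervalIntegral.integral_const_mul, integral_id, integral_inv_of_pos hε hR,
      Real.log_div hR.ne' hε.ne']
    · simp
      ring
    · exact (intervalIntegral.intervalIntegrable_inv (fun r hr => by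
        rw [Set.uIcc_of_le hεR.le] at hr
        exact (hε.trans_le hr.1).ne') continuousOn_id).const_mul _

theorem stmt_14 (n : ℕ) (R₀ lam : ℝ) (hR₀ : 0 < R₀) (hlam : 1 < lam)
    (a : Fin n → ℂ) (v : Fin n → ℝ) (ha : ∀ i, a i ∈ Metric.ball (0:ℂ) R₀) (hv : ∀ i, 0 < v i)
    (hsum : ∑ i, v i = (lam ^ 2 - 1) * Real.pi * R₀ ^ 2)
    (z : Fin n → ℝ → ℂ) (L : Fin n → ℝ → ℝ)
    (hevol : IsCircEvolution n R₀ lam a v z L)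
    (R : Fin n → ℝ) (hR : ∀ i, 0 < R i)
    (hdisj : ∀ t ∈ Set.Icc (1:ℝ) lam, Pairwise (fun i j =>
      Disjoint (Metric.closedBall (z i t) (Real.sqrt (L i t ^ 2 + R i ^ 2)))
               (Metric.closedBall (z j t) (Real.sqrt (L j t ^ 2 + R j ^ 2)))))
    (hsub : ∀ t ∈ Set.Icc (1:ℝ) lam, ∀ i,
      Metric.closedBall (z i t) (Real.sqrt (L i t ^ 2 + R i ^ 2)) ⊆
        Metric.ball (0:ℂ) (t * R₀))
    (u : ℂ → ℂ)
    -- `u = u_near`: the radially symmetric incompressible cavitation map near each `aᵢ`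
    (hu : ∀ i, ∀ x ∈ Metric.closedBall (a i) (R i) \ {a i},
      u x = z i lam + (Real.sqrt (L i lam ^ 2 + ‖x - a i‖ ^ 2) / ‖x - a i‖) • (x - a i)) :
    -- (i) injectivity
    Set.InjOn u (⋃ i, Metric.closedBall (a i) (R i) \ {a i}) ∧
    -- (ii) incompressibility at every point of the open domain
    (∀ x ∈ ⋃ i, Metric.ball (a i) (R i) \ {a i},
      DifferentiableAt ℝ u x ∧ LinearMap.det (fderiv ℝ u x).toLinearMap = 1) ∧
    -- (iii) each punctured annulus is mapped onto the corresponding annulus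
    (∀ i, ∀ ε : ℝ, 0 < ε → ε < R i →
      u '' {x | ε < ‖x - a i‖ ∧ ‖x - a i‖ ≤ R i} =
        {y | Real.sqrt (v i / Real.pi + ε ^ 2) < ‖y - z i lam‖ ∧
             ‖y - z i lam‖ ≤ Real.sqrt (v i / Real.pi + R i ^ 2)}) ∧
    -- (iv) energy upper bound (`‖·‖` of the derivative taken as the Frobenius norm)
    (∀ ε : ℝ, 0 < ε → ε < 1 → (∀ i, ε < R i) →
      (∫ x in ⋃ i, (Metric.ball (a i) (R i) \ Metric.closedBall (a i) ε),
        (‖fderiv ℝ u x 1‖ ^ 2 + ‖fderiv ℝ u x Complex.I‖ ^ 2) / 2) ≤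
        (∑ i, Real.pi * R i ^ 2) + (∑ i, v i * Real.log (R i)) +
          (∑ i, v i) * |Real.log ε|) := by
  obtain ⟨-, -, -, -, -, -, hLv, -, -⟩ := hevol
  have hlam' : lam ∈ Set.Icc 1 lam := ⟨hlam.le, le_rfl⟩
  have hc : ∀ i, 0 ≤ L i lam ^ 2 := fun i => sq_nonneg _
  have hcv : ∀ i, v i / Real.pi = L i lam ^ 2 := fun i => by
    rw [← hLv i]; field_simp
  have hu' : ∀ i, ∀ x ∈ Metric.closedBall (a i) (R i) \ {a i},
      u x = z i lam + cavityMap (L i lam ^ 2) (x - a i) := hu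
  have hnorm : ∀ i, ∀ x ∈ Metric.closedBall (a i) (R i) \ {a i},
      u x ∈ Metric.closedBall (z i lam) (Real.sqrt (L i lam ^ 2 + R i ^ 2)) := by
    intro i x hx
    have hx1 : ‖x - a i‖ ≤ R i := mem_closedBall_iff_norm.1 hx.1
    rw [mem_closedBall_iff_norm, hu' i x hx, add_sub_cancel_left,
      norm_cavityMap _ (sub_ne_zero.2 hx.2)]
    gcongr
  have hev : ∀ i, ∀ x ∈ Metric.ball (a i) (R i) \ {a i},
      u =ᶠ[nhds x] fun y => z i lam + cavityMap (L i lam ^ 2) (y - a i) := by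
    intro i x hx
    filter_upwards [(Metric.isOpen_ball.sdiff isClosed_singleton).mem_nhds hx] with y hy
    exact hu' i y ⟨Metric.ball_subset_closedBall hy.1, hy.2⟩
  have hfd : ∀ i, ∀ x ∈ Metric.ball (a i) (R i) \ {a i},
      fderiv ℝ u x = fderiv ℝ (cavityMap (L i lam ^ 2)) (x - a i) := by
    intro i x hx
    rw [(hev i x hx).fderiv_eq, fderiv_const_add, fderiv_comp_sub]
  refine ⟨?_, ?_, ?_, ?_⟩
  · intro x hx y hy hxy
    obtain ⟨i, hi⟩ := Set.mem_iUnion.1 hx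
    obtain ⟨j, hj⟩ := Set.mem_iUnion.1 hy
    obtain rfl : i = j := by
      by_contra hij
      exact Set.disjoint_left.1 (hdisj lam hlam' hij) (hnorm i x hi) (hxy ▸ hnorm j y hj)
    rw [hu' i x hi, hu' i y hj] at hxy
    exact sub_left_injective (cavityMap_injOn (hc i) (sub_ne_zero.2 hi.2) (sub_ne_zero.2 hj.2)
      (add_left_cancel hxy))
  · intro x hx
    obtain ⟨i, hi⟩ := Set.mem_iUnion.1 hx
    have hne : x - a i ≠ 0 := sub_ne_zero.2 hi.2
    refine ⟨?_, by rw [hfd i x hi, det_fderiv_cavityMap (hc i) hne]⟩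
    obtain ⟨-, -, D, hD, -⟩ := hasFDerivAt_cavityMap (hc i) hne
    have hDx := hD.comp x ((hasFDerivAt_id x).sub_const (a i))
    exact ((hDx.const_add (z i lam)).congr_of_eventuallyEq (hev i x hi)).differentiableAt
  · intro i ε hε hεR
    have himg := cavityMap_image_annulus (hc i) hε.le (hR i).le
    have hmem : ∀ x, ε < ‖x - a i‖ → ‖x - a i‖ ≤ R i →
        x ∈ Metric.closedBall (a i) (R i) \ {a i} := fun x h1 h2 =>
      ⟨mem_closedBall_iff_norm.2 h2, sub_ne_zero.1 (norm_pos_iff.1 (hε.trans h1))⟩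
    rw [hcv i]
    ext y
    have hy := Set.ext_iff.1 himg (y - z i lam)
    refine Iff.trans ?_ hy
    constructor
    · rintro ⟨x, hx, rfl⟩
      exact ⟨x - a i, hx, by rw [hu' i x (hmem x hx.1 hx.2), add_sub_cancel_left]⟩
    · rintro ⟨w, hw, hwy⟩
      have hw' : w + a i - a i = w := add_sub_cancel_right _ _
      refine ⟨w + a i, by simpa only [Set.mem_ofPred_eq, hw'] using hw, ?_⟩
      rw [hu' i _ (hmem _ (hw'.symm ▸ hw.1) (hw'.symm ▸ hw.2)), hw', hwy, add_sub_cancel]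
  · intro ε hε hε1 hεR
    set g : Fin n → ℂ → ℝ := fun i x =>
      (Set.Ioo ε (R i)).indicator (fun r => 1 + L i lam ^ 2 / 2 * (r ^ 2)⁻¹) ‖x - a i‖ with hg
    have hgi : ∀ i, MeasureTheory.Integrable (g i) ∧ _ := fun i =>
      integrable_and_integral_annulus (c := L i lam ^ 2) hε (hεR i) (a i)
    have hg0 : ∀ i x, 0 ≤ g i x := fun i x =>
      Set.indicator_nonneg (fun r _ => by have := hc i; positivity) _
    have hgs : MeasureTheory.Integrable (fun x => ∑ i, g i x) :=
      MeasureTheory.integrable_finsetSum _ fun i _ => (hgi i).1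
    have hmeas : MeasurableSet (⋃ i, (Metric.ball (a i) (R i) \ Metric.closedBall (a i) ε)) :=
      MeasurableSet.iUnion fun i => measurableSet_ball.diff measurableSet_closedBall
    calc _ ≤ ∫ x in ⋃ i, (Metric.ball (a i) (R i) \ Metric.closedBall (a i) ε), ∑ i, g i x := by
          refine MeasureTheory.integral_mono_of_nonneg (Filter.Eventually.of_forall fun x => by
            positivity) hgs.integrableOn ?_
          refine (MeasureTheory.ae_restrict_iff' hmeas).2 (Filter.Eventually.of_forall fun x hx => ?_)
          obtain ⟨i, hi⟩ := Set.mem_iUnion.1 hx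
          have h1 : ε < ‖x - a i‖ := by simpa [dist_eq_norm] using hi.2
          have h2 : ‖x - a i‖ < R i := by simpa [dist_eq_norm] using hi.1
          have hne : x - a i ≠ 0 := norm_pos_iff.1 (hε.trans h1)
          refine le_trans ?_ (Finset.single_le_sum (fun j _ => hg0 j x) (Finset.mem_univ i))
          simp only [hg]
          rw [hfd i x ⟨hi.1, sub_ne_zero.1 hne⟩, Set.indicator_of_mem (Set.mem_Ioo.2 ⟨h1, h2⟩)]
          exact frobenius_fderiv_cavityMap_le (hc i) hne
      _ ≤ ∫ x, ∑ i, g i x := MeasureTheory.setIntegral_le_integral hgs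
          (Filter.Eventually.of_forall fun x => Finset.sum_nonneg fun i _ => hg0 i x)
      _ = ∑ i, (Real.pi * (R i ^ 2 - ε ^ 2) +
            Real.pi * L i lam ^ 2 * (Real.log (R i) - Real.log ε)) := by
          rw [MeasureTheory.integral_finsetSum _ fun i _ => (hgi i).1]
          exact Finset.sum_congr rfl fun i _ => (hgi i).2
      _ ≤ _ := by
          rw [abs_of_neg (Real.log_neg hε hε1), Finset.sum_mul, ← Finset.sum_add_distrib,
            ← Finset.sum_add_distrib]
          refine Finset.sum_le_sum fun i _ => ?_
          rw [hLv i]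
          nlinarith [mul_nonneg Real.pi_pos.le (sq_nonneg ε)]
end

section
/- Let n ∈ ℕ, R₀ > 0, and suppose the cavitation configuration ((aᵢ)ᵢ₌₁ⁿ, (vᵢ)ᵢ₌₁ⁿ) in 𝓑 = B_{R₀}(0) ⊂ ℝ² is attainable through an evolution of circular cavities, with evolutions zᵢ(t), Lᵢ(t), t ∈ [1,λ] (so πLᵢ(λ)² = vᵢ). Let R₁,…,Rₙ > 0 be such that, setting rᵢ(t) = √(Lᵢ(t)² + Rᵢ²), for every t ∈ [1,λ] the closed disks B̄_{rᵢ(t)}(zᵢ(t)), i = 1,…,n, are pairwise disjoint and contained in B_{tR₀}(0). Then there exists an injective map u_far : 𝓑̄ ∖ ⋃ᵢ₌₁ⁿ B_{Rᵢ}(aᵢ) → ℝ², belonging to H¹ and continuously differentiable on the open set 𝓑 ∖ ⋃ᵢ₌₁ⁿ B̄_{Rᵢ}(aᵢ), such that: det Du_far(x) = 1 at every point; u_far(x) = λx for all x ∈ ∂𝓑; and u_far(aᵢ + Rᵢe^{iθ}) = zᵢ(λ) + √(Lᵢ(λ)² + Rᵢ²) e^{iθ} for all i ∈ {1,…,n}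 and all θ ∈ [0,2π]. Moreover u_far maps 𝓑̄ ∖ ⋃ᵢ B_{Rᵢ}(aᵢ) onto B̄_{λR₀}(0) ∖ ⋃ᵢ B_{rᵢ(λ)}(zᵢ(λ)). -/
open scoped BigOperators

section Transport

open Set Metric Filter Topology
open scoped NNReal

section Flow

variable {E : Type*} [NormedAddCommGroup E] [NormedSpace ℝ E]

theorem exists_isIntegralCurveOn_of_bounded [CompleteSpace E] {f : ℝ → E → E} {a b : ℝ} {C K : ℝ≥0}
    (hlip : ∀ t ∈ Icc a b, LipschitzWith K (f t)) (hcont : ∀ x, ContinuousOn (f · x) (Icc a b))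
    (hb : ∀ t ∈ Icc a b, ∀ x, ‖f t x‖ ≤ C) {t₀ : ℝ} (ht₀ : t₀ ∈ Icc a b) (x₀ : E) :
    ∃ γ : ℝ → E, γ t₀ = x₀ ∧ IsIntegralCurveOn γ f (Icc a b) := by
  have hab : 0 ≤ b - a := by linarith [ht₀.1, ht₀.2]
  have hf : IsPicardLindelof f (⟨t₀, ht₀⟩ : Icc a b) x₀ (C * (b - a).toNNReal) 0 C K := by
    refine ⟨fun t ht => (hlip t ht).lipschitzOnWith, fun x _ => hcont x,
      fun t ht x _ => hb t ht x, ?_⟩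
    simp only [NNReal.coe_mul, Real.coe_toNNReal _ hab, NNReal.coe_zero, sub_zero]
    gcongr
    exact max_le (by linarith [ht₀.1]) (by linarith [ht₀.2])
  exact hf.exists_eq_forall_mem_Icc_hasDerivWithinAt₀

theorem IsIntegralCurveOn.hasDerivWithinAt_Ici {f : ℝ → E → E} {γ : ℝ → E} {a b t : ℝ}
    (h : IsIntegralCurveOn γ f (Icc a b)) (ht : t ∈ Ico a b) :
    HasDerivWithinAt γ (f t (γ t)) (Ici t) t :=
  ((h t (Ico_subset_Icc_self ht)).mono_of_mem_nhdsWithin (Icc_mem_nhdsGE_of_mem ht))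

theorem IsIntegralCurveOn.eqOn_Icc {f : ℝ → E → E} {γ γ' : ℝ → E} {a b t₀ : ℝ} {K : ℝ≥0}
    (hlip : ∀ t ∈ Icc a b, LipschitzWith K (f t))
    (h : IsIntegralCurveOn γ f (Icc a b)) (h' : IsIntegralCurveOn γ' f (Icc a b))
    (ht₀ : t₀ ∈ Icc a b) (heq : γ t₀ = γ' t₀) : EqOn γ γ' (Icc a b) := by
  have hl : EqOn γ γ' (Icc a t₀) := by
    have hss : Ioc a t₀ ⊆ Icc a b := fun t ht => ⟨ht.1.le, ht.2.trans ht₀.2⟩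
    have key : ∀ t ∈ Ioc a t₀, Icc a b ∈ 𝓝[≤] t := fun t ht =>
      mem_of_superset (Icc_mem_nhdsLE_of_mem ht) (Icc_subset_Icc_right ht₀.2)
    exact ODE_solution_unique_of_mem_Icc_left (s := fun _ => univ)
      (fun t ht => (hlip t (hss ht)).lipschitzOnWith)
      (h.continuousOn.mono (Icc_subset_Icc_right ht₀.2))
      (fun t ht => (h t (hss ht)).mono_of_mem_nhdsWithin (key t ht)) (fun _ _ => trivial)
      (h'.continuousOn.mono (Icc_subset_Icc_right ht₀.2))
      (fun t ht => (h' t (hss ht)).mono_of_mem_nhdsWithin (key t ht)) (fun _ _ => trivial) heq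
  have hss : Ico a b ⊆ Icc a b := Ico_subset_Icc_self
  exact ODE_solution_unique_of_mem_Icc_right (s := fun _ => univ)
    (fun t ht => (hlip t (hss ht)).lipschitzOnWith)
    h.continuousOn (fun t ht => h.hasDerivWithinAt_Ici ht) (fun _ _ => trivial)
    h'.continuousOn (fun t ht => h'.hasDerivWithinAt_Ici ht) (fun _ _ => trivial)
    (hl ⟨le_rfl, ht₀.1⟩)

theorem exists_linear_isIntegralCurveOn [FiniteDimensional ℝ E] {B : ℝ → E →L[ℝ] E} {a b : ℝ}
    {K : ℝ≥0} (hab : a ≤ b) (hB : ContinuousOn B (Icc a b)) (hK : ∀ t ∈ Icc a b, ‖B t‖ ≤ K)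
    (x₀ : E) :
    ∃ γ : ℝ → E, γ a = x₀ ∧ IsIntegralCurveOn γ (fun t x => B t x) (Icc a b) := by
  have : CompleteSpace E := FiniteDimensional.complete ℝ E
  have : ProperSpace E := FiniteDimensional.proper_real E
  set ρ : ℝ := ‖x₀‖ * Real.exp (K * (b - a)) + 1 with hρ
  have hρ0 : 0 < ρ := by positivity
  let χ : ContDiffBump (0 : E) := ⟨ρ, 2 * ρ, hρ0, by linarith⟩
  let g : E → E := fun x => χ x • x
  have hg : ContDiff ℝ 1 g := χ.contDiff.smul contDiff_id
  have hgs : HasCompactSupport g := χ.hasCompactSupport.smul_right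
  obtain ⟨Kg, hKg⟩ := hg.lipschitzWith_of_hasCompactSupport hgs (by simp)
  obtain ⟨Cg, hCg⟩ := hgs.exists_bound_of_continuous hg.continuous
  lift Cg to ℝ≥0 using (norm_nonneg _).trans (hCg 0)
  obtain ⟨γ, h0, hγ⟩ := exists_isIntegralCurveOn_of_bounded (f := fun t x => B t (g x))
    (C := K * Cg) (K := K * Kg) (a := a) (b := b) (t₀ := a)
    (fun t ht => ((B t).lipschitz.weaken (hK t ht)).comp hKg)
    (fun x => hB.clm_apply continuousOn_const)
    (fun t ht x => ((B t).le_opNorm _).trans (by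
      have := hK t ht; have := hCg x; rw [NNReal.coe_mul]; gcongr))
    ⟨le_rfl, hab⟩ x₀
  refine ⟨γ, h0, fun t ht => ?_⟩
  have hbd : ‖γ t‖ ≤ gronwallBound ‖x₀‖ K 0 (t - a) :=
    norm_le_gronwallBound_of_norm_deriv_right_le hγ.continuousOn
      (fun t ht => hγ.hasDerivWithinAt_Ici ht) (by rw [h0])
      (fun t ht => by
        have h1 : ‖g (γ t)‖ ≤ ‖γ t‖ := by
          simp only [g, norm_smul, Real.norm_eq_abs, abs_of_nonneg χ.nonneg]
          exact mul_le_of_le_one_left (norm_nonneg _) χ.le_one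
        have h2 := hK t (Ico_subset_Icc_self ht)
        calc ‖B t (g (γ t))‖ ≤ ‖B t‖ * ‖g (γ t)‖ := (B t).le_opNorm _
          _ ≤ K * ‖γ t‖ := by gcongr
          _ = K * ‖γ t‖ + 0 := by ring) t ht
  rw [gronwallBound_ε0] at hbd
  have hle : ‖γ t‖ ≤ ρ := by
    refine hbd.trans ?_
    have : Real.exp (K * (t - a)) ≤ Real.exp (K * (b - a)) := by
      gcongr; exact ht.2
    have := mul_le_mul_of_nonneg_left this (norm_nonneg x₀)
    linarith
  have h1 : χ (γ t) = 1 := χ.one_of_mem_closedBall (by simpa using hle)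
  have := hγ t ht
  simpa [g, h1] using this

/-- The assumptions on a time-dependent vector field `v` with spatial derivative `A` under which its
flow is globally defined and continuously differentiable. -/
structure IsC1Field (v : ℝ → E → E) (A : ℝ → E → E →L[ℝ] E) (C K : ℝ≥0) : Prop where
  cont : ∀ x, Continuous (v · x)
  hasFDerivAt : ∀ t x, HasFDerivAt (v t) (A t x) x
  contDeriv : Continuous (Function.uncurry A)
  norm_le : ∀ t x, ‖v t x‖ ≤ C
  norm_deriv_le : ∀ t x, ‖A t x‖ ≤ K

namespace IsC1Field

variable {v : ℝ → E → E} {A : ℝ → E → E →L[ℝ] E} {C K : ℝ≥0}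

theorem lipschitzWith (h : IsC1Field v A C K) (t : ℝ) : LipschitzWith K (v t) :=
  lipschitzOnWith_univ.1 <| convex_univ.lipschitzOnWith_of_nnnorm_hasFDerivWithin_le
    (fun x _ => (h.hasFDerivAt t x).hasFDerivWithinAt) (fun x _ => h.norm_deriv_le t x)

theorem exists_isIntegralCurveOn [CompleteSpace E] (h : IsC1Field v A C K) {a b t₀ : ℝ}
    (ht₀ : t₀ ∈ Icc a b) (x₀ : E) :
    ∃ γ : ℝ → E, γ t₀ = x₀ ∧ IsIntegralCurveOn γ v (Icc a b) :=
  exists_isIntegralCurveOn_of_bounded (fun t _ => h.lipschitzWith t)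
    (fun x => (h.cont x).continuousOn) (fun t _ => h.norm_le t) ht₀ x₀

/-- Near a given integral curve, `v` is uniformly well approximated by its linearization. -/
theorem exists_pos_norm_sub_sub_le (h : IsC1Field v A C K) {a b : ℝ} {γ : ℝ → E}
    (hγ : ContinuousOn γ (Icc a b)) {ε : ℝ} (hε : 0 < ε) :
    ∃ δ > 0, ∀ t ∈ Icc a b, ∀ y ∈ ball (γ t) δ, ∀ y' ∈ ball (γ t) δ,
      ‖v t y - v t y' - A t (γ t) (y - y')‖ ≤ ε * ‖y - y'‖ := by
  have hK : IsCompact ((fun t => (t, γ t)) '' Icc a b) :=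
    isCompact_Icc.image_of_continuousOn (continuousOn_id.prodMk hγ)
  obtain ⟨δ, hδ, H⟩ : ∃ δ > 0, ∀ t ∈ Icc a b, ∀ x ∈ ball (γ t) δ,
      ‖A t x - A t (γ t)‖ ≤ ε := by
    have hu := hK.uniformContinuousAt_of_continuousAt (Function.uncurry A)
      (fun p _ => h.contDeriv.continuousAt) (dist_mem_uniformity hε)
    obtain ⟨δ, hδ, H⟩ := Metric.mem_uniformity_dist.1 hu
    refine ⟨δ, hδ, fun t ht x hx => ?_⟩
    have h1 : dist (t, γ t) (t, x) < δ := by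
      rw [Prod.dist_eq]; simpa [hδ, dist_comm] using hx
    have h2 := H h1
    rw [mem_ofPred_eq] at h2
    have h3 := h2 (mem_image_of_mem _ ht)
    rw [mem_ofPred_eq, dist_comm, dist_eq_norm] at h3
    exact h3.le
  refine ⟨δ, hδ, fun t ht y hy y' hy' => ?_⟩
  exact Convex.norm_image_sub_le_of_norm_hasFDerivWithin_le' (f := v t) (f' := A t)
    (fun x _ => (h.hasFDerivAt t x).hasFDerivWithinAt) (fun x hx => H t ht x hx)
    (convex_ball (γ t) δ) hy' hy

/-- The flow is strictly differentiable, with derivative given by the linearized flow. -/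
theorem hasStrictFDerivAt_flow (h : IsC1Field v A C K) {a b : ℝ} (hab : a ≤ b)
    {Φ : E → ℝ → E} (h0 : ∀ x, Φ x a = x) (hΦ : ∀ x, IsIntegralCurveOn (Φ x) v (Icc a b))
    {x : E} {M : ℝ → E →L[ℝ] E} (hM0 : M a = 1)
    (hM : IsIntegralCurveOn M (fun t N => A t (Φ x t) ∘L N) (Icc a b)) :
    HasStrictFDerivAt (fun y => Φ y b) (M b) x := by
  have hdist : ∀ y y' : E, ∀ t ∈ Icc a b,
      ‖Φ y t - Φ y' t‖ ≤ ‖y - y'‖ * Real.exp (K * (b - a)) := by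
    intro y y' t ht
    have h1 := dist_le_of_trajectories_ODE (fun t => h.lipschitzWith t)
      (hΦ y).continuousOn (fun t ht => (hΦ y).hasDerivWithinAt_Ici ht)
      (hΦ y').continuousOn (fun t ht => (hΦ y').hasDerivWithinAt_Ici ht)
      (le_refl (dist (Φ y a) (Φ y' a))) t ht
    rw [h0, h0, dist_eq_norm, dist_eq_norm] at h1
    refine h1.trans ?_
    gcongr
    exact ht.2
  set c := Real.exp (K * (b - a)) with hc
  have hc0 : 0 < c := Real.exp_pos _
  rw [hasStrictFDerivAt_iff_isLittleO, Asymptotics.isLittleO_iff]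
  intro ε hε
  obtain ⟨η, hη, hηε⟩ : ∃ η > 0, η * (c * (b - a) * c) ≤ ε := by
    refine ⟨ε / (c * (b - a) * c + 1), by have := sub_nonneg.2 hab; positivity, ?_⟩
    have := sub_nonneg.2 hab
    rw [div_mul_eq_mul_div, div_le_iff₀ (by positivity)]
    nlinarith
  obtain ⟨δ, hδ, H⟩ := h.exists_pos_norm_sub_sub_le (hΦ x).continuousOn hη
  have hnear : ball (x, x) (δ / c) ∈ 𝓝 (x, x) := ball_mem_nhds _ (by positivity)
  filter_upwards [hnear] with p hp
  obtain ⟨y, y'⟩ := p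
  rw [← ball_prod_same, mem_prod, mem_ball_iff_norm, mem_ball_iff_norm, lt_div_iff₀ hc0,
    lt_div_iff₀ hc0] at hp
  have hw : ∀ t ∈ Icc a b, HasDerivWithinAt (fun t => Φ y t - Φ y' t - M t (y - y'))
      (v t (Φ y t) - v t (Φ y' t) - A t (Φ x t) (M t (y - y'))) (Icc a b) t := by
    intro t ht
    have h1 := (hM t ht).clm_apply (hasDerivWithinAt_const t (Icc a b) (y - y'))
    refine (((hΦ y t ht).sub (hΦ y' t ht)).sub h1).congr_deriv ?_
    simp
  have hG := norm_le_gronwallBound_of_norm_deriv_right_le (δ := 0) (K := K)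
    (ε := η * (‖y - y'‖ * c)) (fun t ht => (hw t ht).continuousWithinAt)
    (fun t ht => (hw t (Ico_subset_Icc_self ht)).mono_of_mem_nhdsWithin
      (Icc_mem_nhdsGE_of_mem ht)) (by simp [h0, hM0])
    (fun t ht => by
      have ht' := Ico_subset_Icc_self ht
      have h1 := H t ht' (Φ y t) (by
        rw [mem_ball_iff_norm]; exact (hdist y x t ht').trans_lt hp.1) (Φ y' t) (by
        rw [mem_ball_iff_norm]; exact (hdist y' x t ht').trans_lt hp.2)
      have h2 := hdist y y' t ht'
      have h3 : v t (Φ y t) - v t (Φ y' t) - A t (Φ x t) (M t (y - y')) =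
          A t (Φ x t) (Φ y t - Φ y' t - M t (y - y')) +
          (v t (Φ y t) - v t (Φ y' t) - A t (Φ x t) (Φ y t - Φ y' t)) := by
        rw [map_sub (A t (Φ x t)) (Φ y t - Φ y' t)]; abel
      rw [h3]
      refine (norm_add_le _ _).trans (add_le_add ?_ (h1.trans (by gcongr)))
      refine ((A t (Φ x t)).le_opNorm _).trans ?_
      have := h.norm_deriv_le t (Φ x t)
      gcongr) b ⟨hab, le_rfl⟩
  refine hG.trans ?_
  have h4 : gronwallBound 0 K (η * (‖y - y'‖ * c)) (b - a) ≤ η * (‖y - y'‖ * c) * ((b - a) * c) := by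
    have hba := sub_nonneg.2 hab
    rcases eq_or_ne (K : ℝ) 0 with hK | hK
    · rw [hK, gronwallBound_K0]
      have : 1 ≤ c := Real.one_le_exp (by positivity)
      simp only [zero_add]
      refine mul_le_mul_of_nonneg_left ?_ (by positivity)
      nlinarith
    · have hK0 : 0 < (K : ℝ) := lt_of_le_of_ne K.2 (Ne.symm hK)
      rw [gronwallBound_of_K_ne_0 hK]
      simp only [zero_mul, zero_add]
      rw [div_mul_eq_mul_div, mul_div_assoc]
      refine mul_le_mul_of_nonneg_left ?_ (by positivity)
      rw [div_le_iff₀ hK0, ← hc]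
      have := Real.add_one_le_exp (-(K * (b - a)))
      rw [Real.exp_neg, ← hc] at this
      have h5 := mul_le_mul_of_nonneg_right this hc0.le
      rw [inv_mul_cancel₀ hc0.ne'] at h5
      nlinarith
  refine h4.trans ?_
  calc η * (‖y - y'‖ * c) * ((b - a) * c) = η * (c * (b - a) * c) * ‖y - y'‖ := by ring
    _ ≤ ε * ‖y - y'‖ := by gcongr

end IsC1Field

theorem contDiff_one_of_hasStrictFDerivAt {F : Type*} [NormedAddCommGroup F] [NormedSpace ℝ F]
    {f : E → F} {f' : E → E →L[ℝ] F} (h : ∀ x, HasStrictFDerivAt f (f' x) x) : ContDiff ℝ 1 f := by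
  refine contDiff_one_iff_fderiv.2 ⟨fun x => (h x).differentiableAt, ?_⟩
  have hf : fderiv ℝ f = f' := funext fun x => (h x).hasFDerivAt.fderiv
  rw [hf, continuous_iff_continuousAt]
  intro x
  rw [Metric.continuousAt_iff']
  intro ε hε
  obtain ⟨s, hs, hlip⟩ := (h x).approximates_deriv_on_nhds (c := (ε / 2).toNNReal)
    (Or.inr (by simpa using hε))
  filter_upwards [eventually_mem_nhds_iff.2 hs] with y hy
  rw [dist_eq_norm]
  have h1 : HasFDerivAt (fun z => f z - f' x z) (f' y - f' x) y :=
    (h y).hasFDerivAt.sub (f' x).hasFDerivAt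
  have := h1.le_of_lipschitzOn hy hlip.lipschitzOnWith
  rw [Real.coe_toNNReal _ (by positivity)] at this
  linarith

end Flow

section Planar

open Complex

theorem Complex.det_eq_re_mul_im_sub (f : ℂ →ₗ[ℝ] ℂ) :
    LinearMap.det f = (f 1).re * (f I).im - (f 1).im * (f I).re := by
  rw [← LinearMap.det_toMatrix Complex.basisOneI, Matrix.det_fin_two]
  simp [LinearMap.toMatrix_apply]
  ring

/-- **Liouville's formula** in the plane, for a linear equation with traceless coefficients. -/
theorem det_eq_one_of_isIntegralCurveOn {B M : ℝ → ℂ →L[ℝ] ℂ} {a b : ℝ} (hab : a ≤ b)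
    (hM0 : M a = 1) (hM : IsIntegralCurveOn M (fun t N => B t ∘L N) (Icc a b))
    (htr : ∀ t ∈ Icc a b, (B t 1).re + (B t I).im = 0) :
    LinearMap.det (M b).toLinearMap = 1 := by
  have happ : ∀ (L : ℂ →L[ℝ] ℂ) (w : ℂ), L w = w.re * L 1 + w.im * L I := by
    intro L w
    conv_lhs => rw [← re_add_im w, ← mul_one (w.re : ℂ), ← real_smul, ← real_smul, map_add,
      map_smul, map_smul, real_smul, real_smul]
  have hd : ∀ h : ℂ, ∀ t ∈ Icc a b, HasDerivWithinAt (fun t => M t h) (B t (M t h)) (Icc a b) t :=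
    fun h t ht => by simpa using (hM t ht).clm_apply (hasDerivWithinAt_const t (Icc a b) h)
  have hdet : ∀ t ∈ Icc a b, HasDerivWithinAt
      (fun t => (M t 1).re * (M t I).im - (M t 1).im * (M t I).re) 0 (Icc a b) t := by
    intro t ht
    have hre : ∀ h : ℂ, HasDerivWithinAt (fun t => (M t h).re) (B t (M t h)).re (Icc a b) t :=
      fun h => (reCLM.hasFDerivAt.comp_hasDerivWithinAt t (hd h t ht))
    have him : ∀ h : ℂ, HasDerivWithinAt (fun t => (M t h).im) (B t (M t h)).im (Icc a b) t :=
      fun h => (imCLM.hasFDerivAt.comp_hasDerivWithinAt t (hd h t ht))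
    refine (((hre 1).mul (him I)).sub ((him 1).mul (hre I))).congr_deriv ?_
    rw [happ (B t) (M t 1), happ (B t) (M t I)]
    simp only [add_re, add_im, re_ofReal_mul, im_ofReal_mul]
    linear_combination ((M t 1).re * (M t I).im - (M t 1).im * (M t I).re) * htr t ht
  have hconst := constant_of_has_deriv_right_zero (fun t ht => (hdet t ht).continuousWithinAt)
    (fun t ht => (hdet t (Ico_subset_Icc_self ht)).mono_of_mem_nhdsWithin
      (Icc_mem_nhdsGE_of_mem ht)) b ⟨hab, le_rfl⟩
  rw [Complex.det_eq_re_mul_im_sub]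
  simpa [hM0] using hconst

theorem IsC1Field.exists_flow {v : ℝ → ℂ → ℂ} {A : ℝ → ℂ → ℂ →L[ℝ] ℂ} {C K : ℝ≥0}
    (h : IsC1Field v A C K) {a b : ℝ} (hab : a ≤ b) :
    ∃ Φ : ℂ → ℝ → ℂ, (∀ x, Φ x a = x) ∧ (∀ x, IsIntegralCurveOn (Φ x) v (Icc a b)) ∧
      ContDiff ℝ 1 (fun x => Φ x b) ∧
      ∀ x, (∀ t ∈ Icc a b, (A t (Φ x t) 1).re + (A t (Φ x t) I).im = 0) →
        LinearMap.det (fderiv ℝ (fun x => Φ x b) x).toLinearMap = 1 := by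
  choose Φ h0 hΦ using fun x => h.exists_isIntegralCurveOn (left_mem_Icc.2 hab) x
  have hlin : ∀ x, ∃ M : ℝ → ℂ →L[ℝ] ℂ, M a = 1 ∧
      IsIntegralCurveOn M (fun t N => A t (Φ x t) ∘L N) (Icc a b) := fun x =>
    exists_linear_isIntegralCurveOn
      (B := fun t => ContinuousLinearMap.compL ℝ ℂ ℂ ℂ (A t (Φ x t))) (K := K) hab
      ((ContinuousLinearMap.compL ℝ ℂ ℂ ℂ).continuous.comp_continuousOn
        (h.contDeriv.comp_continuousOn (continuousOn_id.prodMk (hΦ x).continuousOn)))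
      (fun t _ => ContinuousLinearMap.opNorm_le_bound _ K.2 fun N =>
        (ContinuousLinearMap.opNorm_comp_le _ _).trans
          (mul_le_mul_of_nonneg_right (h.norm_deriv_le t _) (norm_nonneg N))) 1
  choose M hM0 hM using hlin
  have hs : ∀ x, HasStrictFDerivAt (fun y => Φ y b) (M x b) x := fun x =>
    h.hasStrictFDerivAt_flow hab h0 hΦ (hM0 x) (hM x)
  refine ⟨Φ, h0, hΦ, contDiff_one_of_hasStrictFDerivAt hs, fun x htr => ?_⟩
  rw [(hs x).hasFDerivAt.fderiv]
  exact det_eq_one_of_isIntegralCurveOn hab (hM0 x) (hM x) htr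

end Planar

section CavityField

open Complex ComplexConjugate

/-- Centres and velocities of the cavities, squares of their radii, half the rates of change of
those squares, and the square of the outer radius. -/
abbrev CavityData (n : ℕ) : Type :=
  (Fin n → ℂ) × (Fin n → ℂ) × (Fin n → ℝ) × (Fin n → ℝ) × ℝ

namespace CavityData

variable {n : ℕ}

/-- The centres of the cavities. -/
abbrev center (p : CavityData n) : Fin n → ℂ := p.1

/-- The velocities of the centres. -/
abbrev velocity (p : CavityData n) : Fin n → ℂ := p.2.1

/-- The squared radii of the cavities. -/
abbrev sqRadius (p : CavityData n) : Fin n → ℝ := p.2.2.1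

/-- Half the rates of change of the squared radii. -/
abbrev rate (p : CavityData n) : Fin n → ℝ := p.2.2.2.1

/-- The squared outer radius. -/
abbrev outer (p : CavityData n) : ℝ := p.2.2.2.2

/-- The cavities, enlarged by the factor `q`, are separated from each other and from the outer
circle. -/
structure IsSeparated (q : ℝ) (p : CavityData n) : Prop where
  one_lt : 1 < q
  sqRadius_pos : ∀ i, 0 < p.sqRadius i
  outer_pos : 0 < p.outer
  sep : ∀ i j, i ≠ j → q * (√(p.sqRadius i) + √(p.sqRadius j)) < ‖p.center i - p.center j‖
  inside : ∀ i, q * (‖p.center i‖ + q * √(p.sqRadius i)) < √p.outer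

/-- Squared distance to the `j`-th centre, relative to the squared radius. -/
noncomputable def relDist (j : Fin n) (y : CavityData n × ℂ) : ℝ :=
  ‖y.2 - y.1.center j‖ ^ 2 / y.1.sqRadius j

/-- Squared distance to the origin, relative to the squared outer radius. -/
noncomputable def relOuter (y : CavityData n × ℂ) : ℝ :=
  ‖y.2‖ ^ 2 / y.1.outer

/-- Cutoff equal to `1` on `σ ≤ q` and to `0` on `q ^ 2 ≤ σ`. -/
noncomputable def nearCutoff (q σ : ℝ) : ℝ := Real.smoothTransition ((q ^ 2 - σ) / (q ^ 2 - q))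

/-- Cutoff equal to `0` on `σ ≤ q⁻¹ ^ 2` and to `1` on `q⁻¹ ≤ σ`. -/
noncomputable def farCutoff (q σ : ℝ) : ℝ :=
  Real.smoothTransition ((σ - q⁻¹ ^ 2) / (q⁻¹ - q⁻¹ ^ 2))

/-- Holomorphic potential of the correction near the `j`-th cavity: it cancels the sources in the
other cavities and adds the velocity of the centre. -/
noncomputable def nearPotential (j : Fin n) (y : CavityData n × ℂ) : ℂ :=
  conj (y.1.velocity j) * (y.2 - y.1.center j) - ∑ i ∈ Finset.univ.erase j,
    (y.1.rate i : ℂ) * log ((y.2 - y.1.center i) / (y.1.center j - y.1.center i))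

/-- Holomorphic potential of the correction near the outer circle: it moves all sources to the
origin. -/
noncomputable def farPotential (y : CavityData n × ℂ) : ℂ :=
  -∑ i, (y.1.rate i : ℂ) * log ((y.2 - y.1.center i) / y.2)

/-- The stream function of the correction. -/
noncomputable def stream (q : ℝ) (y : CavityData n × ℂ) : ℝ :=
  ∑ j, nearCutoff q (relDist j y) * (nearPotential j y).im +
    farCutoff q (relOuter y) * (farPotential y).im

/-- The rotated gradient of the stream function with respect to position. -/
noncomputable def streamField (q : ℝ) (y : CavityData n × ℂ) : ℂ :=
  (fderiv ℝ (stream q) y (0, I) : ℂ) - I * (fderiv ℝ (stream q) y (0, 1) : ℂ)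

/-- Cutoff removing the singularities at the centres and making the field compactly supported. -/
noncomputable def coreCutoff (y : CavityData n × ℂ) : ℝ :=
  (∏ i, Real.smoothTransition (4 * relDist i y - 1)) * Real.smoothTransition (3 - relOuter y)

/-- The velocity field which transports the cavities and the outer circle and is divergence free
in between. -/
noncomputable def field (q : ℝ) (y : CavityData n × ℂ) : ℂ :=
  coreCutoff y • (∑ i, (y.1.rate i : ℂ) * conj (y.2 - y.1.center i)⁻¹ + streamField q y)

theorem nearCutoff_eq_one {q σ : ℝ} (hq : 1 < q) (h : σ ≤ q) : nearCutoff q σ = 1 := by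
  refine Real.smoothTransition.one_of_one_le ?_
  rw [le_div_iff₀ (by nlinarith)]
  linarith

theorem nearCutoff_eq_zero {q σ : ℝ} (hq : 1 < q) (h : q ^ 2 ≤ σ) : nearCutoff q σ = 0 :=
  Real.smoothTransition.zero_of_nonpos (div_nonpos_of_nonpos_of_nonneg (by linarith) (by nlinarith))

theorem inv_sq_lt_inv {q : ℝ} (hq : 1 < q) : q⁻¹ ^ 2 < q⁻¹ := by
  have h0 : 0 < q⁻¹ := by positivity
  have h1 : q⁻¹ < 1 := inv_lt_one_of_one_lt₀ hq
  nlinarith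

theorem farCutoff_eq_one {q σ : ℝ} (hq : 1 < q) (h : q⁻¹ ≤ σ) : farCutoff q σ = 1 := by
  refine Real.smoothTransition.one_of_one_le ?_
  rw [le_div_iff₀ (sub_pos.2 (inv_sq_lt_inv hq))]
  linarith

theorem farCutoff_eq_zero {q σ : ℝ} (hq : 1 < q) (h : σ ≤ q⁻¹ ^ 2) : farCutoff q σ = 0 :=
  Real.smoothTransition.zero_of_nonpos
    (div_nonpos_of_nonpos_of_nonneg (by linarith) (sub_pos.2 (inv_sq_lt_inv hq)).le)

variable {q : ℝ} {y : CavityData n × ℂ}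

theorem contDiffAt_relDist {m : WithTop ℕ∞} (h : y.1.IsSeparated q) (j : Fin n) :
    ContDiffAt ℝ m (relDist j) y := by
  unfold relDist
  refine ContDiffAt.div ?_ (by fun_prop) (h.sqRadius_pos j).ne'
  exact ContDiffAt.norm_sq ℝ (by fun_prop)

theorem contDiffAt_relOuter {m : WithTop ℕ∞} (h : y.1.IsSeparated q) :
    ContDiffAt ℝ m relOuter y := by
  unfold relOuter
  refine ContDiffAt.div ?_ (by fun_prop) h.outer_pos.ne'
  exact ContDiffAt.norm_sq ℝ (by fun_prop)

theorem eventually_nearCutoff_eq_one (h : y.1.IsSeparated q) {j : Fin n} (hj : relDist j y < q) :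
    ∀ᶠ y' in 𝓝 y, nearCutoff q (relDist j y') = 1 := by
  filter_upwards [(contDiffAt_relDist (m := 0) h j).continuousAt.eventually_lt_const hj] with y' hy'
  exact nearCutoff_eq_one h.one_lt hy'.le

theorem eventually_nearCutoff_eq_zero (h : y.1.IsSeparated q) {j : Fin n}
    (hj : q * √(y.1.sqRadius j) < ‖y.2 - y.1.center j‖) :
    ∀ᶠ y' in 𝓝 y, nearCutoff q (relDist j y') = 0 := by
  have hσ : q ^ 2 < relDist j y := by
    have hq := h.one_lt
    rw [relDist, lt_div_iff₀ (h.sqRadius_pos j)]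
    nth_rw 1 [← Real.sq_sqrt (h.sqRadius_pos j).le]
    rw [← mul_pow]
    gcongr
  filter_upwards [(contDiffAt_relDist (m := 0) h j).continuousAt.eventually_const_lt hσ] with y' hy'
  exact nearCutoff_eq_zero h.one_lt hy'.le

theorem eventually_farCutoff_eq_one (h : y.1.IsSeparated q) (hy : q⁻¹ < relOuter y) :
    ∀ᶠ y' in 𝓝 y, farCutoff q (relOuter y') = 1 := by
  filter_upwards [(contDiffAt_relOuter (m := 0) h).continuousAt.eventually_const_lt hy] with y' hy'
  exact farCutoff_eq_one h.one_lt hy'.le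

theorem eventually_farCutoff_eq_zero (h : y.1.IsSeparated q) (hy : q * ‖y.2‖ < √y.1.outer) :
    ∀ᶠ y' in 𝓝 y, farCutoff q (relOuter y') = 0 := by
  have hσ : relOuter y < q⁻¹ ^ 2 := by
    have hq : 0 < q := one_pos.trans h.one_lt
    rw [relOuter, div_lt_iff₀ h.outer_pos, inv_pow, ← div_eq_inv_mul, lt_div_iff₀ (by positivity),
      mul_comm, ← mul_pow, ← Real.sq_sqrt h.outer_pos.le]
    gcongr
  filter_upwards [(contDiffAt_relOuter (m := 0) h).continuousAt.eventually_lt_const hσ] with y' hy'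
  exact farCutoff_eq_zero h.one_lt hy'.le

theorem div_mem_slitPlane_of_norm_sub_lt {u w : ℂ} (h : ‖u - w‖ < ‖w‖) : u / w ∈ slitPlane := by
  have hw : w ≠ 0 := fun hw => by simp [hw] at h; exact (norm_nonneg u).not_gt h
  have h1 : ‖u / w - 1‖ < 1 := by
    rw [div_sub_one hw, norm_div, div_lt_one (norm_pos_iff.2 hw)]
    exact h
  have := mem_slitPlane_of_norm_lt_one h1
  simpa using this

theorem contDiffAt_clog_comp {G : Type*} [NormedAddCommGroup G] [NormedSpace ℝ G]
    {m : WithTop ℕ∞} {g : G → ℂ} {y : G} (hg : ContDiffAt ℝ m g y) (hy : g y ∈ slitPlane) :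
    ContDiffAt ℝ m (fun y => log (g y)) y :=
  ((Complex.contDiffAt_log hy).restrict_scalars ℝ).comp y hg

theorem center_ne (h : y.1.IsSeparated q) {i j : Fin n} (hij : i ≠ j) :
    y.1.center j - y.1.center i ≠ 0 := by
  have := h.sep j i hij.symm
  have hq := h.one_lt
  exact norm_pos_iff.1 (lt_of_le_of_lt (by positivity) this)

theorem contDiffAt_nearPotential {m : WithTop ℕ∞} (h : y.1.IsSeparated q) {j : Fin n}
    (hj : ∀ i, i ≠ j → ‖y.2 - y.1.center j‖ < ‖y.1.center j - y.1.center i‖) :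
    ContDiffAt ℝ m (nearPotential j) y := by
  unfold nearPotential
  refine ContDiffAt.sub (ContDiffAt.mul ?_ (by fun_prop)) (ContDiffAt.sum fun i hi => ?_)
  · exact conjCLE.contDiff.contDiffAt.comp y (by fun_prop)
  · have hij := Finset.ne_of_mem_erase hi
    refine ContDiffAt.mul (ofRealCLM.contDiff.contDiffAt.comp y (by fun_prop))
      (contDiffAt_clog_comp ?_ ?_)
    · simp only [div_eq_mul_inv]
      exact ContDiffAt.mul (by fun_prop) (ContDiffAt.inv (by fun_prop) (center_ne h hij))
    · refine div_mem_slitPlane_of_norm_sub_lt ?_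
      simpa using hj i hij

theorem contDiffAt_farPotential {m : WithTop ℕ∞} (hy : y.2 ≠ 0)
    (hi : ∀ i, ‖y.1.center i‖ < ‖y.2‖) :
    ContDiffAt ℝ m (farPotential) y := by
  unfold farPotential
  refine ContDiffAt.neg (ContDiffAt.sum fun i _ => ?_)
  refine ContDiffAt.mul (ofRealCLM.contDiff.contDiffAt.comp y (by fun_prop))
    (contDiffAt_clog_comp ?_ ?_)
  · simp only [div_eq_mul_inv]
    exact ContDiffAt.mul (by fun_prop) (ContDiffAt.inv (by fun_prop) hy)
  · refine div_mem_slitPlane_of_norm_sub_lt ?_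
    simpa using hi i

theorem contDiffAt_stream {m : ℕ∞} (h : y.1.IsSeparated q) : ContDiffAt ℝ m (stream q) y := by
  have hq := h.one_lt
  unfold stream
  refine ContDiffAt.add (ContDiffAt.sum fun j _ => ?_) ?_
  · by_cases hj : ∀ i, i ≠ j → ‖y.2 - y.1.center j‖ < ‖y.1.center j - y.1.center i‖
    · refine ContDiffAt.mul ?_ (imCLM.contDiff.contDiffAt.comp y (contDiffAt_nearPotential h hj))
      refine Real.smoothTransition.contDiff.contDiffAt.comp y (ContDiffAt.div_const ?_ _)
      exact contDiffAt_const.sub (contDiffAt_relDist h j)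
    · push Not at hj
      obtain ⟨i, hij, hle⟩ := hj
      refine (contDiffAt_const (c := (0 : ℝ))).congr_of_eventuallyEq ?_
      have hlt : q * √(y.1.sqRadius j) < ‖y.2 - y.1.center j‖ := by
        refine lt_of_le_of_lt ?_ ((h.sep j i hij.symm).trans_le hle)
        rw [mul_add]
        exact le_add_of_nonneg_right (by positivity)
      filter_upwards [eventually_nearCutoff_eq_zero h hlt] with y' hy'
      rw [hy', zero_mul]
  · by_cases hy : y.2 ≠ 0 ∧ ∀ i, ‖y.1.center i‖ < ‖y.2‖
    · refine ContDiffAt.mul ?_ (imCLM.contDiff.contDiffAt.comp y (contDiffAt_farPotential hy.1 hy.2))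
      refine Real.smoothTransition.contDiff.contDiffAt.comp y (ContDiffAt.div_const ?_ _)
      exact (contDiffAt_relOuter h).sub contDiffAt_const
    · refine (contDiffAt_const (c := (0 : ℝ))).congr_of_eventuallyEq ?_
      have hlt : q * ‖y.2‖ < √y.1.outer := by
        by_cases h0 : y.2 = 0
        · rw [h0, norm_zero, mul_zero]
          exact Real.sqrt_pos.2 h.outer_pos
        · simp only [ne_eq, h0, not_false_eq_true, true_and, not_forall, not_lt] at hy
          obtain ⟨i, hi⟩ := hy
          refine lt_of_le_of_lt ?_ (h.inside i)
          gcongr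
          exact hi.trans (le_add_of_nonneg_right (by positivity))
      filter_upwards [eventually_farCutoff_eq_zero h hlt] with y' hy'
      rw [hy', zero_mul]

theorem contDiffAt_streamField (h : y.1.IsSeparated q) :
    ContDiffAt ℝ 1 (streamField q) y := by
  have hd : ContDiffAt ℝ 1 (fderiv ℝ (stream q)) y :=
    (contDiffAt_stream (m := 2) h).fderiv_right (by norm_num)
  have he : ∀ e : CavityData n × ℂ, ContDiffAt ℝ 1 (fun y => (fderiv ℝ (stream q) y e : ℂ)) y :=
    fun e => ofRealCLM.contDiff.contDiffAt.comp y (hd.clm_apply contDiffAt_const)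
  unfold streamField
  exact (he _).sub (contDiffAt_const.mul (he _))

theorem contDiffAt_coreCutoff {m : ℕ∞} (h : y.1.IsSeparated q) :
    ContDiffAt ℝ m coreCutoff y := by
  unfold coreCutoff
  refine ContDiffAt.mul (contDiffAt_prod fun i _ => ?_) ?_
  · exact Real.smoothTransition.contDiff.contDiffAt.comp y
      ((contDiffAt_const.mul (contDiffAt_relDist h i)).sub contDiffAt_const)
  · exact Real.smoothTransition.contDiff.contDiffAt.comp y
      (contDiffAt_const.sub (contDiffAt_relOuter h))

theorem contDiffAt_field (h : y.1.IsSeparated q) : ContDiffAt ℝ 1 (field q) y := by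
  unfold field
  by_cases hy : ∀ i, y.2 - y.1.center i ≠ 0
  · refine (contDiffAt_coreCutoff h).smul (ContDiffAt.add (ContDiffAt.sum fun i _ => ?_)
      (contDiffAt_streamField h))
    refine ContDiffAt.mul (ofRealCLM.contDiff.contDiffAt.comp y (by fun_prop)) ?_
    exact conjCLE.contDiff.contDiffAt.comp y (ContDiffAt.inv (by fun_prop) (hy i))
  · push Not at hy
    obtain ⟨i, hi⟩ := hy
    refine (contDiffAt_const (c := (0 : ℂ))).congr_of_eventuallyEq ?_
    have h0 : relDist i y < 1 / 4 := by
      rw [relDist, hi]; norm_num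
    filter_upwards [(contDiffAt_relDist (m := 0) h i).continuousAt.eventually_lt_const h0]
      with y' hy'
    have : coreCutoff y' = 0 := by
      unfold coreCutoff
      rw [Finset.prod_eq_zero (Finset.mem_univ i)
        (Real.smoothTransition.zero_of_nonpos (by linarith)), zero_mul]
    rw [this, zero_smul]

theorem coreCutoff_eq_one {y : CavityData n × ℂ} (h1 : ∀ i, 1 / 2 ≤ relDist i y)
    (h2 : relOuter y ≤ 2) : coreCutoff y = 1 := by
  unfold coreCutoff
  rw [Finset.prod_eq_one fun i _ => Real.smoothTransition.one_of_one_le (by linarith [h1 i]),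
    Real.smoothTransition.one_of_one_le (by linarith), one_mul]

theorem eventually_coreCutoff_eq_one (h : y.1.IsSeparated q)
    (h1 : ∀ i, y.1.sqRadius i ≤ ‖y.2 - y.1.center i‖ ^ 2) (h2 : ‖y.2‖ ^ 2 ≤ y.1.outer) :
    ∀ᶠ y' in 𝓝 y, coreCutoff y' = 1 := by
  have h1' : ∀ i, 1 / 2 < relDist i y := fun i => by
    rw [relDist, lt_div_iff₀ (h.sqRadius_pos i)]
    linarith [h1 i, h.sqRadius_pos i]
  have h2' : relOuter y < 2 := by
    rw [relOuter, div_lt_iff₀ h.outer_pos]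
    linarith [h.outer_pos]
  filter_upwards [eventually_all.2 fun i =>
    (contDiffAt_relDist (m := 0) h i).continuousAt.eventually_const_lt (h1' i),
    (contDiffAt_relOuter (m := 0) h).continuousAt.eventually_lt_const h2'] with y' h3 h4
  exact coreCutoff_eq_one (fun i => (h3 i).le) h4.le

theorem field_eq_zero (h : y.1.IsSeparated q) (hy : 3 * y.1.outer ≤ ‖y.2‖ ^ 2) :
    field q y = 0 := by
  have : coreCutoff y = 0 := by
    unfold coreCutoff
    rw [Real.smoothTransition.zero_of_nonpos (x := 3 - relOuter y), mul_zero]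
    rw [relOuter, sub_nonpos, le_div_iff₀ h.outer_pos]
    exact hy
  rw [field, this, zero_smul]

theorem streamField_eq_conj {p : CavityData n} {x : ℂ} (h : p.IsSeparated q) {f : ℂ → ℂ} {f' : ℂ}
    (hf : HasDerivAt f f' x) (heq : ∀ᶠ x' in 𝓝 x, stream q (p, x') = (f x').im) :
    streamField q (p, x) = conj f' := by
  have h1 : HasFDerivAt (fun x' => stream q (p, x'))
      ((fderiv ℝ (stream q) (p, x)).comp (ContinuousLinearMap.inr ℝ (CavityData n) ℂ)) x :=
    HasFDerivAt.comp x ((contDiffAt_stream (y := (p, x)) (m := 1) h).differentiableAt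
      (by norm_num)).hasFDerivAt (hasFDerivAt_prodMk_right p x)
  have h2 := (imCLM.hasFDerivAt.comp x (hf.hasFDerivAt.restrictScalars ℝ)).congr_of_eventuallyEq heq
  have h3 : ∀ e : ℂ, fderiv ℝ (stream q) (p, x) (0, e) = (e * f').im := fun e => by
    simpa using DFunLike.congr_fun (h1.unique h2) e
  rw [streamField, h3, h3]
  apply Complex.ext <;> simp

theorem hasDerivAt_nearPotential {p : CavityData n} {x : ℂ} (h : p.IsSeparated q) {j : Fin n}
    (hj : ∀ i, i ≠ j → ‖x - p.center j‖ < ‖p.center j - p.center i‖) :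
    HasDerivAt (fun x => nearPotential j (p, x))
      (conj (p.velocity j) - ∑ i ∈ Finset.univ.erase j, (p.rate i : ℂ) * (x - p.center i)⁻¹) x := by
  unfold nearPotential
  dsimp only
  refine HasDerivAt.sub ?_ (HasDerivAt.fun_sum fun i hi => HasDerivAt.const_mul _ ?_)
  · simpa using ((hasDerivAt_id x).sub_const (p.center j)).const_mul (conj (p.velocity j))
  · have hij := Finset.ne_of_mem_erase hi
    have hc : p.center j - p.center i ≠ 0 := center_ne (y := (p, x)) h hij
    have hs : (x - p.center i) / (p.center j - p.center i) ∈ slitPlane :=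
      div_mem_slitPlane_of_norm_sub_lt (by simpa using hj i hij)
    have hx : x - p.center i ≠ 0 := fun h0 => slitPlane_ne_zero hs (by rw [h0, zero_div])
    refine ((((hasDerivAt_id x).sub_const (p.center i)).div_const
      (p.center j - p.center i)).clog hs).congr_deriv ?_
    dsimp only [id]
    field_simp

theorem hasDerivAt_farPotential {p : CavityData n} {x : ℂ} (hx : x ≠ 0)
    (hi : ∀ i, ‖p.center i‖ < ‖x‖) :
    HasDerivAt (fun x => farPotential (p, x))
      (-∑ i, (p.rate i : ℂ) * ((x - p.center i)⁻¹ - x⁻¹)) x := by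
  unfold farPotential
  dsimp only
  refine HasDerivAt.neg (HasDerivAt.fun_sum fun i _ => HasDerivAt.const_mul _ ?_)
  have hs : (x - p.center i) / x ∈ slitPlane :=
    div_mem_slitPlane_of_norm_sub_lt (by simpa using hi i)
  have hxi : x - p.center i ≠ 0 := fun h0 => slitPlane_ne_zero hs (by rw [h0, zero_div])
  refine ((((hasDerivAt_id x).sub_const (p.center i)).div (hasDerivAt_id x) hx).clog
    hs).congr_deriv ?_
  dsimp only [id, Pi.div_apply]
  field_simp

/-- On the boundary of a cavity the field moves with the centre and dilates the radius. -/
theorem field_of_norm_sub_center {p : CavityData n} {x : ℂ} (h : p.IsSeparated q) {j : Fin n}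
    (hx : ‖x - p.center j‖ ^ 2 = p.sqRadius j) :
    field q (p, x) = p.velocity j + (p.rate j / p.sqRadius j) • (x - p.center j) := by
  have hq := h.one_lt
  have hr : ‖x - p.center j‖ = √(p.sqRadius j) := by rw [← hx, Real.sqrt_sq (norm_nonneg _)]
  have hfar : ∀ i, i ≠ j → q * √(p.sqRadius i) < ‖x - p.center i‖ := fun i hij => by
    have h1 := h.sep i j hij
    have h2 : ‖p.center i - p.center j‖ ≤ ‖x - p.center i‖ + ‖x - p.center j‖ := by
      rw [← norm_neg (x - p.center i)]
      refine le_of_eq_of_le ?_ (norm_add_le _ _)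
      congr 1; ring
    have h3 : √(p.sqRadius j) ≤ q * √(p.sqRadius j) := le_mul_of_one_le_left (by positivity) hq.le
    linarith
  have hin : q * ‖x‖ < √p.outer := by
    refine lt_of_le_of_lt ?_ (h.inside j)
    gcongr
    have h2 : ‖x‖ ≤ ‖p.center j‖ + ‖x - p.center j‖ := by
      simpa using norm_add_le (p.center j) (x - p.center j)
    have h3 : √(p.sqRadius j) ≤ q * √(p.sqRadius j) := le_mul_of_one_le_left (by positivity) hq.le
    linarith
  have hslit : ∀ i, i ≠ j → ‖x - p.center j‖ < ‖p.center j - p.center i‖ := fun i hij => by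
    refine lt_of_le_of_lt ?_ (h.sep j i hij.symm)
    rw [hr, mul_add]
    exact (le_mul_of_one_le_left (by positivity) hq.le).trans
      (le_add_of_nonneg_right (by positivity))
  have hcore : coreCutoff (p, x) = 1 := by
    refine (eventually_coreCutoff_eq_one (y := (p, x)) h (fun i => ?_) ?_).self_of_nhds
    · by_cases hij : i = j
      · subst hij; exact hx.ge
      · refine (Real.sqrt_le_left (norm_nonneg _)).1 ?_
        exact (le_mul_of_one_le_left (by positivity) hq.le).trans (hfar i hij).le
    · refine (Real.le_sqrt (norm_nonneg _) h.outer_pos.le).1 ?_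
      exact (le_mul_of_one_le_left (by positivity) hq.le).trans hin.le
  have hstream : ∀ᶠ y' in 𝓝 (p, x), stream q y' = (nearPotential j y').im := by
    filter_upwards [eventually_nearCutoff_eq_one (y := (p, x)) h (j := j)
      (by rw [relDist, hx, div_self (h.sqRadius_pos j).ne']; exact hq),
      eventually_all.2 fun i : {i // i ≠ j} =>
        eventually_nearCutoff_eq_zero (y := (p, x)) h (hfar i i.2),
      eventually_farCutoff_eq_zero (y := (p, x)) h hin] with y' h1 h2 h3
    rw [stream, h3, zero_mul, add_zero, Finset.sum_eq_single j, h1, one_mul]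
    · exact fun i _ hij => by rw [h2 ⟨i, hij⟩, zero_mul]
    · simp
  have hslice : ∀ᶠ x' in 𝓝 x, stream q (p, x') = (nearPotential j (p, x')).im :=
    (Continuous.prodMk_right p).continuousAt.eventually hstream
  rw [field, hcore, one_smul, streamField_eq_conj h (hasDerivAt_nearPotential h hslit) hslice,
    ← Finset.add_sum_erase _ _ (Finset.mem_univ j)]
  have hinv : conj (x - p.center j)⁻¹ = ((p.sqRadius j)⁻¹ : ℝ) * (x - p.center j) := by
    rw [inv_def, map_mul, conj_conj, conj_ofReal, normSq_eq_norm_sq, hx, mul_comm]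
  simp only [map_sub, map_sum, map_mul, conj_conj, conj_ofReal, real_smul, ofReal_div, hinv,
    ofReal_inv]
  ring

/-- On the outer circle the field is the dilation compensating the growth of the cavities. -/
theorem field_of_norm_sq_eq_outer {p : CavityData n} {x : ℂ} (h : p.IsSeparated q)
    (hx : ‖x‖ ^ 2 = p.outer) :
    field q (p, x) = ((∑ i, p.rate i) / p.outer) • x := by
  have hq := h.one_lt
  have hr : ‖x‖ = √p.outer := by rw [← hx, Real.sqrt_sq (norm_nonneg _)]
  have hx0 : x ≠ 0 := norm_pos_iff.1 (hr ▸ Real.sqrt_pos.2 h.outer_pos)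
  have hc : ∀ i, ‖p.center i‖ + q * √(p.sqRadius i) < ‖x‖ := fun i => by
    rw [hr]
    exact (le_mul_of_one_le_left (by positivity) hq.le).trans_lt (h.inside i)
  have hfar : ∀ i, q * √(p.sqRadius i) < ‖x - p.center i‖ := fun i => by
    have h2 := norm_sub_norm_le x (p.center i)
    linarith [hc i]
  have hslit : ∀ i, ‖p.center i‖ < ‖x‖ := fun i =>
    (le_add_of_nonneg_right (by positivity)).trans_lt (hc i)
  have hcore : coreCutoff (p, x) = 1 := by
    refine (eventually_coreCutoff_eq_one (y := (p, x)) h (fun i => ?_) hx.le).self_of_nhds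
    refine (Real.sqrt_le_left (norm_nonneg _)).1 ?_
    exact (le_mul_of_one_le_left (by positivity) hq.le).trans (hfar i).le
  have hstream : ∀ᶠ y' in 𝓝 (p, x), stream q y' = (farPotential y').im := by
    filter_upwards [eventually_farCutoff_eq_one (y := (p, x)) h
      (by rw [relOuter, hx, div_self h.outer_pos.ne']; exact inv_lt_one_of_one_lt₀ hq),
      eventually_all.2 fun i =>
        eventually_nearCutoff_eq_zero (y := (p, x)) h (hfar i)] with y' h1 h2
    rw [stream, h1, one_mul, Finset.sum_eq_zero, zero_add]
    exact fun i _ => by rw [h2 i, zero_mul]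
  have hslice : ∀ᶠ x' in 𝓝 x, stream q (p, x') = (farPotential (p, x')).im :=
    (Continuous.prodMk_right p).continuousAt.eventually hstream
  rw [field, hcore, one_smul, streamField_eq_conj h (hasDerivAt_farPotential hx0 hslit) hslice]
  have hinv : conj x⁻¹ = (p.outer⁻¹ : ℝ) * x := by
    rw [inv_def, map_mul, conj_conj, conj_ofReal, normSq_eq_norm_sq, hx, mul_comm]
  have hsum : conj (-∑ i, (p.rate i : ℂ) * ((x - p.center i)⁻¹ - x⁻¹)) =
      -∑ i, (p.rate i : ℂ) * (conj (x - p.center i)⁻¹ - (p.outer⁻¹ : ℝ) * x) := by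
    rw [map_neg, map_sum]
    congr! 2 with i
    rw [map_mul, conj_ofReal, map_sub, hinv]
  rw [hsum, real_smul]
  simp only [mul_sub, Finset.sum_sub_distrib, ← Finset.sum_mul]
  push_cast
  ring

theorem hasFDerivAt_field {p : CavityData n} (h : p.IsSeparated q) (x : ℂ) :
    HasFDerivAt (fun x => field q (p, x))
      ((fderiv ℝ (field q) (p, x)).comp (ContinuousLinearMap.inr ℝ (CavityData n) ℂ)) x :=
  HasFDerivAt.comp x ((contDiffAt_field (y := (p, x)) h).differentiableAt
    (by norm_num)).hasFDerivAt (hasFDerivAt_prodMk_right p x)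

/-- The field is divergence free between the cavities and the outer circle. -/
theorem fderiv_field_trace {p : CavityData n} {x : ℂ} (h : p.IsSeparated q)
    (h1 : ∀ i, p.sqRadius i ≤ ‖x - p.center i‖ ^ 2) (h2 : ‖x‖ ^ 2 ≤ p.outer) :
    (fderiv ℝ (field q) (p, x) (0, 1)).re + (fderiv ℝ (field q) (p, x) (0, I)).im = 0 := by
  have hxi : ∀ i, x - p.center i ≠ 0 := fun i h0 => by
    have := h1 i
    rw [h0, norm_zero] at this
    linarith [h.sqRadius_pos i]
  have hsrc : ∀ i, HasFDerivAt (fun x' => (p.rate i : ℂ) * conj (x' - p.center i)⁻¹)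
      ((p.rate i : ℂ) • (conjCLE : ℂ →L[ℝ] ℂ).comp (((ContinuousLinearMap.toSpanSingleton ℂ
        (-1 / (x - p.center i) ^ 2))).restrictScalars ℝ)) x := fun i =>
    ((conjCLE : ℂ →L[ℝ] ℂ).hasFDerivAt.comp x ((((hasDerivAt_id x).sub_const
      (p.center i)).inv (hxi i)).hasFDerivAt.restrictScalars ℝ)).const_mul _
  set D := fderiv ℝ (fderiv ℝ (stream q)) (p, x)
  have hst2 := contDiffAt_stream (y := (p, x)) (m := 2) h
  have hD1 : HasFDerivAt (fderiv ℝ (stream q)) D (p, x) :=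
    ((hst2.fderiv_right (m := 1) (by norm_num)).differentiableAt (by norm_num)).hasFDerivAt
  have hsymm : ∀ u w, D u w = D w u := fun u w =>
    (hst2.isSymmSndFDerivAt (by simp)).eq u w
  have hstr : ∀ e : ℂ, HasFDerivAt (fun x' => (fderiv ℝ (stream q) (p, x') (0, e) : ℂ))
      (ofRealCLM.comp ((ContinuousLinearMap.apply ℝ ℝ ((0, e) : CavityData n × ℂ)).comp
        (D.comp (ContinuousLinearMap.inr ℝ (CavityData n) ℂ)))) x := fun e =>
    ofRealCLM.hasFDerivAt.comp x ((ContinuousLinearMap.apply ℝ ℝ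
      ((0, e) : CavityData n × ℂ)).hasFDerivAt.comp x
        (hD1.comp x (hasFDerivAt_prodMk_right p x)))
  have hG := (HasFDerivAt.fun_sum (u := Finset.univ) fun i _ => hsrc i).add
    ((hstr I).sub ((hstr 1).const_mul I))
  have heq := (hasFDerivAt_field h x).unique (hG.congr_of_eventuallyEq ?_)
  · have e1 := DFunLike.congr_fun heq 1
    have e2 := DFunLike.congr_fun heq I
    simp only [ContinuousLinearMap.comp_apply, ContinuousLinearMap.inr_apply] at e1 e2
    rw [e1, e2]
    have hs := hsymm (0, 1) (0, I)
    simp [hs]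
    ring
  · filter_upwards [(Continuous.prodMk_right p).continuousAt.eventually
      (eventually_coreCutoff_eq_one (y := (p, x)) h h1 h2)] with x' hx'
    simp only [field, hx', one_smul]
    rfl

theorem exists_isSeparated {p : ℝ → CavityData n} (hp : Continuous p) {S : Set ℝ}
    (hS : IsCompact S) (hs : ∀ t ∈ S, ∀ i, 0 < (p t).sqRadius i) (ho : ∀ t ∈ S, 0 < (p t).outer)
    (hsep : ∀ t ∈ S, ∀ i j, i ≠ j →
      √((p t).sqRadius i) + √((p t).sqRadius j) < ‖(p t).center i - (p t).center j‖)
    (hin : ∀ t ∈ S, ∀ i, ‖(p t).center i‖ + √((p t).sqRadius i) < √(p t).outer) :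
    ∃ q, ∀ t ∈ S, (p t).IsSeparated q := by
  have hev : ∀ᶠ q in 𝓝 (1 : ℝ), ∀ t ∈ S,
      (∀ i j, i ≠ j → q * (√((p t).sqRadius i) + √((p t).sqRadius j)) <
        ‖(p t).center i - (p t).center j‖) ∧
      ∀ i, q * (‖(p t).center i‖ + q * √((p t).sqRadius i)) < √(p t).outer := by
    refine hS.eventually_forall_of_forall_eventually fun t ht => ?_
    refine (eventually_all.2 fun i => eventually_all.2 fun j => ?_).and
      (eventually_all.2 fun i => ?_)
    · by_cases hij : i = j
      · exact Eventually.of_forall fun y h => absurd hij h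
      · filter_upwards [(isOpen_lt (f := fun y : ℝ × ℝ =>
          y.1 * (√((p y.2).sqRadius i) + √((p y.2).sqRadius j)))
          (g := fun y => ‖(p y.2).center i - (p y.2).center j‖) (by fun_prop)
          (by fun_prop)).mem_nhds (by simpa using hsep t ht i j hij)] with y hy _ using hy
    · refine (isOpen_lt (f := fun y : ℝ × ℝ =>
          y.1 * (‖(p y.2).center i‖ + y.1 * √((p y.2).sqRadius i)))
          (g := fun y => √(p y.2).outer) (by fun_prop) (by fun_prop)).mem_nhds ?_
      simpa using hin t ht i
  obtain ⟨q, hq, h1⟩ := ((hev.filter_mono nhdsWithin_le_nhds).and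
    (self_mem_nhdsWithin (s := Ioi (1 : ℝ)))).exists
  exact ⟨q, fun t ht => ⟨h1, hs t ht, ho t ht, (hq t ht).1, (hq t ht).2⟩⟩

theorem continuousAt_fderiv_comp_inr {E F G : Type*} [NormedAddCommGroup E] [NormedSpace ℝ E]
    [NormedAddCommGroup F] [NormedSpace ℝ F] [NormedAddCommGroup G] [NormedSpace ℝ G]
    {f : E × F → G} {y : E × F} (hf : ContDiffAt ℝ 1 f y) :
    ContinuousAt (fun y => (fderiv ℝ f y).comp (ContinuousLinearMap.inr ℝ E F)) y :=
  (hf.fderiv_right (m := 0) (by norm_num)).continuousAt.clm_comp continuousAt_const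

theorem exists_isC1Field {p : ℝ → CavityData n} (hp : Continuous p) (hS : IsCompact (range p))
    (h : ∀ t, (p t).IsSeparated q) :
    ∃ C K, IsC1Field (fun t x => field q (p t, x)) (fun t x =>
      (fderiv ℝ (field q) (p t, x)).comp (ContinuousLinearMap.inr ℝ (CavityData n) ℂ)) C K := by
  obtain ⟨M, hM⟩ := hS.exists_bound_of_continuousOn (f := fun p : CavityData n => p.outer)
    (by fun_prop)
  have hball : ∀ t (x : ℂ), x ∉ closedBall (0 : ℂ) √(3 * M) → 3 * (p t).outer < ‖x‖ ^ 2 := by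
    intro t x hx
    rw [mem_closedBall_zero_iff, not_le] at hx
    have h1 := hM _ (mem_range_self t)
    have h2 := Real.lt_sq_of_sqrt_lt hx
    have h3 := le_abs_self (p t).outer
    rw [Real.norm_eq_abs] at h1
    linarith
  have hcpt := hS.prod (isCompact_closedBall (0 : ℂ) √(3 * M))
  have hcont : ∀ y : CavityData n × ℂ, y.1 ∈ range p → ContinuousAt (field q) y := by
    rintro y ⟨t, ht⟩
    exact (contDiffAt_field (ht ▸ h t)).continuousAt
  have hcont' : ∀ y : CavityData n × ℂ, y.1 ∈ range p → ContinuousAt (fun y =>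
      (fderiv ℝ (field q) y).comp (ContinuousLinearMap.inr ℝ (CavityData n) ℂ)) y := by
    rintro y ⟨t, ht⟩
    exact continuousAt_fderiv_comp_inr (contDiffAt_field (ht ▸ h t))
  obtain ⟨C, hC⟩ := hcpt.exists_bound_of_continuousOn (f := field q)
    fun y hy => (hcont y hy.1).continuousWithinAt
  obtain ⟨K, hK⟩ := hcpt.exists_bound_of_continuousOn
    fun y hy => (hcont' y hy.1).continuousWithinAt
  refine ⟨C.toNNReal, K.toNNReal, ⟨fun x => ?_, fun t x => hasFDerivAt_field (h t) x, ?_,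
    fun t x => ?_, fun t x => ?_⟩⟩
  · exact continuous_iff_continuousAt.2 fun t => ContinuousAt.comp
      (f := fun t => (p t, x)) (hcont (p t, x) (mem_range_self t)) (by fun_prop)
  · exact continuous_iff_continuousAt.2 fun y => ContinuousAt.comp
      (f := fun y : ℝ × ℂ => (p y.1, y.2)) (hcont' (p y.1, y.2) (mem_range_self y.1)) (by fun_prop)
  · by_cases hx : x ∈ closedBall (0 : ℂ) √(3 * M)
    · exact (hC (p t, x) ⟨mem_range_self t, hx⟩).trans (Real.le_coe_toNNReal C)
    · rw [field_eq_zero (y := (p t, x)) (h t) (hball t x hx).le, norm_zero]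
      positivity
  · by_cases hx : x ∈ closedBall (0 : ℂ) √(3 * M)
    · exact (hK (p t, x) ⟨mem_range_self t, hx⟩).trans (Real.le_coe_toNNReal K)
    · have h0 : (fun x => field q (p t, x)) =ᶠ[𝓝 x] fun _ => 0 := by
        filter_upwards [isClosed_closedBall.isOpen_compl.mem_nhds hx] with x' hx'
        exact field_eq_zero (y := (p t, x')) (h t) (hball t x' hx').le
      rw [(hasFDerivAt_field (h t) x).unique
        ((hasFDerivAt_const (0 : ℂ) x).congr_of_eventuallyEq h0), norm_zero]
      positivity

/-- The closed region between the cavities and the outer circle. -/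
def region (p : CavityData n) : Set ℂ :=
  closedBall 0 (√p.outer) \ ⋃ i, ball (p.center i) (√(p.sqRadius i))

theorem mem_region {p : CavityData n} {x : ℂ} :
    x ∈ p.region ↔ ‖x‖ ≤ √p.outer ∧ ∀ i, √(p.sqRadius i) ≤ ‖x - p.center i‖ := by
  simp [region, dist_eq_norm]

/-- The data vary along a curve in accordance with their velocities and rates. -/
structure IsEvolution (p : ℝ → CavityData n) (a b : ℝ) : Prop where
  center : ∀ i, ∀ t ∈ Icc a b,
    HasDerivWithinAt (fun t => (p t).center i) ((p t).velocity i) (Icc a b) t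
  sqRadius : ∀ i, ∀ t ∈ Icc a b,
    HasDerivWithinAt (fun t => (p t).sqRadius i) (2 * (p t).rate i) (Icc a b) t
  outer : ∀ t ∈ Icc a b, HasDerivWithinAt (fun t => (p t).outer) (2 * ∑ i, (p t).rate i) (Icc a b) t

variable {p : ℝ → CavityData n} {a b : ℝ}

theorem IsEvolution.isIntegralCurveOn_cavity (hev : IsEvolution p a b)
    (h : ∀ t, (p t).IsSeparated q) (i : Fin n) {e : ℂ} (he : ‖e‖ = 1) :
    IsIntegralCurveOn (fun t => (p t).center i + √((p t).sqRadius i) • e)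
      (fun t x => field q (p t, x)) (Icc a b) := by
  intro t ht
  have hs := (h t).sqRadius_pos i
  refine ((hev.center i t ht).add
    (((hev.sqRadius i t ht).sqrt hs.ne').smul_const e)).congr_deriv ?_
  dsimp only
  rw [field_of_norm_sub_center (h t) (j := i), add_sub_cancel_left, smul_smul]
  · congr 2
    nth_rw 2 [← Real.sq_sqrt hs.le]
    have := Real.sqrt_pos.2 hs
    field_simp
  · rw [add_sub_cancel_left, norm_smul, he, mul_one, Real.norm_of_nonneg (Real.sqrt_nonneg _),
      Real.sq_sqrt hs.le]

theorem IsEvolution.isIntegralCurveOn_outer (hev : IsEvolution p a b)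
    (h : ∀ t, (p t).IsSeparated q) {e : ℂ} (he : ‖e‖ = 1) :
    IsIntegralCurveOn (fun t => √(p t).outer • e) (fun t x => field q (p t, x)) (Icc a b) := by
  intro t ht
  have hs := (h t).outer_pos
  refine (((hev.outer t ht).sqrt hs.ne').smul_const e).congr_deriv ?_
  dsimp only
  rw [field_of_norm_sq_eq_outer (h t), smul_smul]
  · congr 1
    nth_rw 2 [← Real.sq_sqrt hs.le]
    have := Real.sqrt_pos.2 hs
    field_simp
  · rw [norm_smul, he, mul_one, Real.norm_of_nonneg (Real.sqrt_nonneg _), Real.sq_sqrt hs.le]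

theorem exists_smul_of_norm_eq {w : ℂ} {r : ℝ} (hr : 0 < r) (hw : ‖w‖ = r) :
    ∃ e : ℂ, ‖e‖ = 1 ∧ w = r • e := by
  refine ⟨r⁻¹ • w, ?_, ?_⟩
  · rw [norm_smul, hw, Real.norm_of_nonneg (by positivity), inv_mul_cancel₀ hr.ne']
  · rw [smul_smul, mul_inv_cancel₀ hr.ne', one_smul]

theorem nonneg_of_eq_zero_imp {F : ℝ → ℝ} (hF : ContinuousOn F (Icc a b))
    (h0 : ∀ s ∈ Icc a b, F s = 0 → ∀ t ∈ Icc a b, F t = 0) {s t : ℝ} (hs : s ∈ Icc a b)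
    (ht : t ∈ Icc a b) (h : 0 ≤ F s) : 0 ≤ F t := by
  by_contra! hlt
  obtain ⟨r, hr, hr0⟩ := isPreconnected_Icc.intermediate_value ht hs hF ⟨hlt.le, h⟩
  exact hlt.ne (h0 r hr hr0 t ht)

/-- The region between the cavities and the outer circle is invariant. -/
theorem IsEvolution.mem_region_of_mem_region (hev : IsEvolution p a b) (hp : Continuous p)
    (h : ∀ t, (p t).IsSeparated q) {K : ℝ≥0}
    (hlip : ∀ t ∈ Icc a b, LipschitzWith K fun x => field q (p t, x)) {γ : ℝ → ℂ}
    (hγ : IsIntegralCurveOn γ (fun t x => field q (p t, x)) (Icc a b)) {s t : ℝ}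
    (hs : s ∈ Icc a b) (ht : t ∈ Icc a b) (hmem : γ s ∈ (p s).region) : γ t ∈ (p t).region := by
  have hc := hγ.continuousOn
  rw [mem_region] at hmem ⊢
  constructor
  · refine sub_nonneg.1 (nonneg_of_eq_zero_imp (F := fun t => √(p t).outer - ‖γ t‖)
      (by fun_prop) (fun r hr h0 t ht => ?_) hs ht (sub_nonneg.2 hmem.1))
    obtain ⟨e, he, hre⟩ := exists_smul_of_norm_eq (Real.sqrt_pos.2 (h r).outer_pos)
      (sub_eq_zero.1 h0).symm
    rw [hγ.eqOn_Icc hlip (hev.isIntegralCurveOn_outer h he) hr hre ht]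
    simp [he, abs_of_nonneg]
  · refine fun i => sub_nonneg.1 (nonneg_of_eq_zero_imp
      (F := fun t => ‖γ t - (p t).center i‖ - √((p t).sqRadius i))
      (by fun_prop) (fun r hr h0 t ht => ?_) hs ht (sub_nonneg.2 (hmem.2 i)))
    obtain ⟨e, he, hre⟩ := exists_smul_of_norm_eq (Real.sqrt_pos.2 ((h r).sqRadius_pos i))
      (sub_eq_zero.1 h0)
    rw [hγ.eqOn_Icc hlip (hev.isIntegralCurveOn_cavity h i he) hr (sub_eq_iff_eq_add'.1 hre) ht]
    simp [he, abs_of_nonneg]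

/-- Every evolution of separated cavities is followed by a bijection of the plane which is
incompressible between the cavities and the outer circle. -/
theorem IsEvolution.exists_bijective (hev : IsEvolution p a b) (hab : a ≤ b) (hp : Continuous p)
    (hS : IsCompact (range p)) (h : ∀ t, (p t).IsSeparated q) :
    ∃ u : ℂ → ℂ, Function.Bijective u ∧ ContDiff ℝ 1 u ∧
      (∀ x ∈ (p a).region, LinearMap.det (fderiv ℝ u x).toLinearMap = 1) ∧
      (∀ e : ℂ, ‖e‖ = 1 → u (√(p a).outer • e) = √(p b).outer • e) ∧
      (∀ i, ∀ e : ℂ, ‖e‖ = 1 → u ((p a).center i + √((p a).sqRadius i) • e) =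
        (p b).center i + √((p b).sqRadius i) • e) ∧
      u '' (p a).region = (p b).region := by
  obtain ⟨C, K, hv⟩ := exists_isC1Field hp hS h
  obtain ⟨Φ, h0, hΦ, hcd, hdet⟩ := hv.exists_flow hab
  have hlip : ∀ t ∈ Icc a b, LipschitzWith K fun x => field q (p t, x) :=
    fun t _ => hv.lipschitzWith t
  have ha : a ∈ Icc a b := left_mem_Icc.2 hab
  have hb : b ∈ Icc a b := right_mem_Icc.2 hab
  have heq : ∀ γ : ℝ → ℂ, IsIntegralCurveOn γ (fun t x => field q (p t, x)) (Icc a b) →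
      Φ (γ a) b = γ b := fun γ hγ => (hΦ _).eqOn_Icc hlip hγ ha (h0 _) hb
  have hsurj : ∀ y, ∃ γ : ℝ → ℂ, IsIntegralCurveOn γ (fun t x => field q (p t, x)) (Icc a b) ∧
      γ b = y := fun y => by
    obtain ⟨γ, hγb, hγ⟩ := hv.exists_isIntegralCurveOn hb y
    exact ⟨γ, hγ, hγb⟩
  refine ⟨fun x => Φ x b, ⟨fun x y hxy => ?_, fun y => ?_⟩, hcd, fun x hx => hdet x fun t ht => ?_,
    fun e he => heq _ (hev.isIntegralCurveOn_outer h he),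
    fun i e he => heq _ (hev.isIntegralCurveOn_cavity h i he), Subset.antisymm ?_ fun y hy => ?_⟩
  · simpa only [h0] using (hΦ x).eqOn_Icc hlip (hΦ y) hb hxy ha
  · obtain ⟨γ, hγ, rfl⟩ := hsurj y
    exact ⟨γ a, heq γ hγ⟩
  · have hm := mem_region.1 (hev.mem_region_of_mem_region hp h hlip (hΦ x) ha ht
      ((h0 x).symm ▸ hx))
    exact fderiv_field_trace (h t) (fun i => (Real.sqrt_le_left (norm_nonneg _)).1 (hm.2 i))
      ((Real.le_sqrt (norm_nonneg _) (h t).outer_pos.le).1 hm.1)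
  · rintro _ ⟨x, hx, rfl⟩
    exact hev.mem_region_of_mem_region hp h hlip (hΦ x) ha hb ((h0 x).symm ▸ hx)
  · obtain ⟨γ, hγ, rfl⟩ := hsurj y
    exact ⟨γ a, hev.mem_region_of_mem_region hp h hlip hγ hb ha hy, heq γ hγ⟩

end CavityData

end CavityField

section Assembly

open Complex

theorem norm_add_lt_of_closedBall_subset_ball {w : ℂ} {r ρ : ℝ} (hr : 0 ≤ r)
    (h : closedBall w r ⊆ ball 0 ρ) : ‖w‖ + r < ρ := by
  obtain ⟨e, he, hw⟩ : ∃ e : ℂ, ‖e‖ = 1 ∧ w = ‖w‖ • e := by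
    rcases eq_or_ne w 0 with rfl | hw
    · exact ⟨1, by simp, by simp⟩
    · exact CavityData.exists_smul_of_norm_eq (norm_pos_iff.2 hw) rfl
  have hmem : w + r • e ∈ closedBall w r := by
    simp [he, abs_of_nonneg hr]
  have hlt := mem_ball_zero_iff.1 (h hmem)
  rw [hw, norm_smul, he, mul_one, norm_norm]
  rwa [hw, ← add_smul, norm_smul, he, mul_one, Real.norm_of_nonneg (by positivity)] at hlt

/-- The data of an evolution of circular cavities with initial radii `R i`, kept constant outside
`[1, lam]`. -/
noncomputable def evolutionData {n : ℕ} (R₀ : ℝ) {lam : ℝ} (hlam : 1 ≤ lam) (z : Fin n → ℝ → ℂ)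
    (L : Fin n → ℝ → ℝ) (R : Fin n → ℝ) : ℝ → CavityData n :=
  IccExtend hlam (domRestrict (Icc 1 lam) fun t =>
    (fun i => z i t, fun i => derivWithin (z i) (Icc 1 lam) t, fun i => L i t ^ 2 + R i ^ 2,
      fun i => derivWithin (fun t => L i t ^ 2) (Icc 1 lam) t / 2, (t * R₀) ^ 2))

variable {n : ℕ} {R₀ lam : ℝ} {a : Fin n → ℂ} {v : Fin n → ℝ} {z : Fin n → ℝ → ℂ}
  {L : Fin n → ℝ → ℝ} {R : Fin n → ℝ}

theorem evolutionData_of_mem (hlam : 1 ≤ lam) {t : ℝ} (ht : t ∈ Icc 1 lam) :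
    evolutionData R₀ hlam z L R t =
      (fun i => z i t, fun i => derivWithin (z i) (Icc 1 lam) t, fun i => L i t ^ 2 + R i ^ 2,
        fun i => derivWithin (fun t => L i t ^ 2) (Icc 1 lam) t / 2, (t * R₀) ^ 2) :=
  IccExtend_of_mem hlam _ ht

theorem evolutionData_projIcc (hlam : 1 ≤ lam) (t : ℝ) :
    evolutionData R₀ hlam z L R (projIcc 1 lam hlam t) = evolutionData R₀ hlam z L R t := by
  rw [evolutionData, IccExtend_val]
  rfl

namespace IsCircEvolution

theorem continuous_evolutionData (h : IsCircEvolution n R₀ lam a v z L) (hlam : 1 < lam) :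
    Continuous (evolutionData R₀ hlam.le z L R) := by
  have hd : ∀ {F : Type} [NormedAddCommGroup F] [NormedSpace ℝ F] {f : ℝ → F},
      ContDiffOn ℝ 1 f (Icc 1 lam) → ContinuousOn (derivWithin f (Icc 1 lam)) (Icc 1 lam) :=
    fun hf => hf.continuousOn_derivWithin (uniqueDiffOn_Icc hlam) le_rfl
  have hz := fun i => (h.1 i).continuousOn
  have hz' := fun i => hd (h.1 i)
  have hL := fun i => (h.2.2.2.1 i).continuousOn
  have hL' := fun i => hd (h.2.2.2.1 i)
  refine ContinuousOn.domRestrict ?_ |>.Icc_extend'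
  refine (continuousOn_pi.2 hz).prodMk ((continuousOn_pi.2 hz').prodMk
    ((continuousOn_pi.2 fun i => (hL i).add continuousOn_const).prodMk
      ((continuousOn_pi.2 fun i => (hL' i).div_const 2).prodMk (by fun_prop))))

theorem isEvolution_evolutionData (h : IsCircEvolution n R₀ lam a v z L) (hlam : 1 < lam) :
    CavityData.IsEvolution (evolutionData R₀ hlam.le z L R) 1 lam := by
  have hL := fun i t ht => (((h.2.2.2.1 i).differentiableOn one_ne_zero) t ht).hasDerivWithinAt
  refine ⟨fun i t ht => ?_, fun i t ht => ?_, fun t ht => ?_⟩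
  · rw [evolutionData_of_mem hlam.le ht]
    refine ((((h.1 i).differentiableOn one_ne_zero) t ht).hasDerivWithinAt).congr_of_mem
      (fun s hs => ?_) ht
    rw [evolutionData_of_mem hlam.le hs]
  · rw [evolutionData_of_mem hlam.le ht]
    refine (((hL i t ht).add_const (R i ^ 2)).congr_of_mem (fun s hs => ?_) ht).congr_deriv ?_
    · rw [evolutionData_of_mem hlam.le hs]
    · exact (mul_div_cancel₀ _ two_ne_zero).symm
  · rw [evolutionData_of_mem hlam.le ht]
    refine (((HasDerivWithinAt.fun_sum (u := Finset.univ) fun i _ => hL i t ht).add_const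
      (R₀ ^ 2)).congr_of_mem (fun s hs => ?_) ht).congr_deriv ?_
    · rw [evolutionData_of_mem hlam.le hs]
      have := h.2.2.1 s hs
      rw [← Finset.mul_sum] at this
      have h2 : Real.pi * ∑ i, L i s ^ 2 = Real.pi * ((s ^ 2 - 1) * R₀ ^ 2) := by
        rw [this]; ring
      rw [mul_left_cancel₀ Real.pi_ne_zero h2]
      ring
    · rw [← Finset.sum_div, mul_div_cancel₀ _ two_ne_zero]

end IsCircEvolution

end Assembly

end Transport

theorem stmt_15 (n : ℕ) (R₀ lam : ℝ) (hR₀ : 0 < R₀) (hlam : 1 < lam)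
    (a : Fin n → ℂ) (v : Fin n → ℝ) (ha : ∀ i, a i ∈ Metric.ball (0:ℂ) R₀) (hv : ∀ i, 0 < v i)
    (hsum : ∑ i, v i = (lam ^ 2 - 1) * Real.pi * R₀ ^ 2)
    (z : Fin n → ℝ → ℂ) (L : Fin n → ℝ → ℝ)
    (hevol : IsCircEvolution n R₀ lam a v z L)
    (R : Fin n → ℝ) (hR : ∀ i, 0 < R i)
    (hdisj : ∀ t ∈ Set.Icc (1:ℝ) lam, Pairwise (fun i j =>
      Disjoint (Metric.closedBall (z i t) (Real.sqrt (L i t ^ 2 + R i ^ 2)))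
               (Metric.closedBall (z j t) (Real.sqrt (L j t ^ 2 + R j ^ 2)))))
    (hsub : ∀ t ∈ Set.Icc (1:ℝ) lam, ∀ i,
      Metric.closedBall (z i t) (Real.sqrt (L i t ^ 2 + R i ^ 2)) ⊆
        Metric.ball (0:ℂ) (t * R₀)) :
    ∃ u : ℂ → ℂ,
      -- injective on `𝓑̄ ∖ ⋃ B_{Rᵢ}(aᵢ)`
      Set.InjOn u (Metric.closedBall (0:ℂ) R₀ \ ⋃ i, Metric.ball (a i) (R i)) ∧
      -- continuously differentiable on the open set `𝓑 ∖ ⋃ B̄_{Rᵢ}(aᵢ)`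
      ContDiffOn ℝ 1 u (Metric.ball (0:ℂ) R₀ \ ⋃ i, Metric.closedBall (a i) (R i)) ∧
      -- `H¹` membership: `u` and its derivative are square-integrable
      MeasureTheory.IntegrableOn (fun x => ‖u x‖ ^ 2)
        (Metric.ball (0:ℂ) R₀ \ ⋃ i, Metric.closedBall (a i) (R i)) ∧
      MeasureTheory.IntegrableOn
        (fun x => ‖fderiv ℝ u x 1‖ ^ 2 + ‖fderiv ℝ u x Complex.I‖ ^ 2)
        (Metric.ball (0:ℂ) R₀ \ ⋃ i, Metric.closedBall (a i) (R i)) ∧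
      -- incompressibility at every point
      (∀ x ∈ Metric.ball (0:ℂ) R₀ \ ⋃ i, Metric.closedBall (a i) (R i),
        LinearMap.det (fderiv ℝ u x).toLinearMap = 1) ∧
      -- boundary condition on the outer boundary
      (∀ x ∈ Metric.sphere (0:ℂ) R₀, u x = lam • x) ∧
      -- boundary condition on the circles around the cavities
      (∀ i, ∀ θ : ℝ,
        u (a i + (R i : ℂ) * Complex.exp (θ * Complex.I)) =
          z i lam + (Real.sqrt (L i lam ^ 2 + R i ^ 2) : ℂ) * Complex.exp (θ * Complex.I)) ∧
      -- `u` maps `𝓑̄ ∖ ⋃ B_{Rᵢ}(aᵢ)` onto `B̄_{λR₀}(0) ∖ ⋃ B_{rᵢ(λ)}(zᵢ(λ))`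
      u '' (Metric.closedBall (0:ℂ) R₀ \ ⋃ i, Metric.ball (a i) (R i)) =
        Metric.closedBall (0:ℂ) (lam * R₀) \
          ⋃ i, Metric.ball (z i lam) (Real.sqrt (L i lam ^ 2 + R i ^ 2)) := by
  set p := evolutionData R₀ hlam.le z L R
  have hp : Continuous p := hevol.continuous_evolutionData hlam
  have hval : ∀ t (ht : t ∈ Set.Icc 1 lam), p t = _ := fun t ht => evolutionData_of_mem hlam.le ht
  have hr : ∀ t i, 0 ≤ √(L i t ^ 2 + R i ^ 2) := fun t i => Real.sqrt_nonneg _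
  have htR : ∀ t ∈ Set.Icc 1 lam, 0 < t * R₀ := fun t ht => mul_pos (one_pos.trans_le ht.1) hR₀
  obtain ⟨q, hq⟩ := CavityData.exists_isSeparated hp (isCompact_Icc (a := 1) (b := lam))
    (fun t ht i => by
      rw [hval t ht]
      have := hR i
      positivity)
    (fun t ht => by
      rw [hval t ht]
      have := htR t ht
      positivity)
    (fun t ht i j hij => by
      rw [hval t ht]
      have := (disjoint_closedBall_closedBall_iff (hr t i) (hr t j)).1 (hdisj t ht hij)
      rwa [dist_eq_norm] at this)
    (fun t ht i => by
      rw [hval t ht]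
      simp only [CavityData.outer]
      rw [Real.sqrt_sq (htR t ht).le]
      exact norm_add_lt_of_closedBall_subset_ball (hr t i) (hsub t ht i))
  have hproj : ∀ t, p t = p (Set.projIcc 1 lam hlam.le t) := fun t =>
    (evolutionData_projIcc hlam.le t).symm
  have hsep : ∀ t, (p t).IsSeparated q := fun t => hproj t ▸ hq _ (Set.projIcc 1 lam hlam.le t).2
  have hcpt : IsCompact (Set.range p) := by
    have himage : Set.range p = p '' Set.Icc 1 lam := by
      refine Set.Subset.antisymm ?_ (Set.image_subset_range _ _)
      rintro _ ⟨t, rfl⟩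
      exact ⟨_, (Set.projIcc 1 lam hlam.le t).2, (hproj t).symm⟩
    exact himage ▸ isCompact_Icc.image hp
  have hev : CavityData.IsEvolution p 1 lam := hevol.isEvolution_evolutionData hlam
  obtain ⟨u, hbij, hcd, hdet, houter, hcav, himg⟩ :=
    hev.exists_bijective hlam.le hp hcpt hsep
  have h1 := hval 1 (Set.left_mem_Icc.2 hlam.le)
  have h2 := hval lam (Set.right_mem_Icc.2 hlam.le)
  have hreg1 : (p 1).region = Metric.closedBall (0 : ℂ) R₀ \ ⋃ i, Metric.ball (a i) (R i) := by
    rw [CavityData.region, h1]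
    simp [CavityData.center, CavityData.sqRadius, CavityData.outer,
      hevol.2.2.2.2.1, hevol.2.2.2.2.2.1, Real.sqrt_sq, hR₀.le, fun i => (hR i).le]
  have hreg2 : (p lam).region = Metric.closedBall (0 : ℂ) (lam * R₀) \
      ⋃ i, Metric.ball (z i lam) (√(L i lam ^ 2 + R i ^ 2)) := by
    rw [CavityData.region, h2]
    simp [CavityData.center, CavityData.sqRadius, CavityData.outer,
      Real.sqrt_sq (htR lam (Set.right_mem_Icc.2 hlam.le)).le]
  have hsubset : Metric.ball (0 : ℂ) R₀ \ ⋃ i, Metric.closedBall (a i) (R i) ⊆ (p 1).region := by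
    rw [hreg1]
    exact Set.sdiff_subset_sdiff Metric.ball_subset_closedBall
      (Set.iUnion_mono fun i => Metric.ball_subset_closedBall)
  have hint : ∀ f : ℂ → ℝ, Continuous f →
      MeasureTheory.IntegrableOn f (Metric.ball (0 : ℂ) R₀ \ ⋃ i, Metric.closedBall (a i) (R i)) :=
    fun f hf => (hf.continuousOn.integrableOn_compact (isCompact_closedBall (0 : ℂ) R₀)).mono_set
      (Set.sdiff_subset.trans Metric.ball_subset_closedBall)
  have hfd : ∀ e : ℂ, Continuous fun x => fderiv ℝ u x e := fun e =>
    (hcd.continuous_fderiv one_ne_zero).clm_apply continuous_const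
  refine ⟨u, hbij.1.injOn, hcd.contDiffOn, hint _ (by fun_prop), hint _ ?_,
    fun x hx => hdet x (hsubset hx), fun x hx => ?_, fun i θ => ?_, ?_⟩
  · exact ((hfd 1).norm.pow 2).add ((hfd Complex.I).norm.pow 2)
  · obtain ⟨e, he, rfl⟩ := CavityData.exists_smul_of_norm_eq hR₀ (mem_sphere_zero_iff_norm.1 hx)
    have := houter e he
    rw [h1, h2] at this
    simp only [CavityData.outer] at this
    rw [Real.sqrt_sq (htR 1 (Set.left_mem_Icc.2 hlam.le)).le,
      Real.sqrt_sq (htR lam (Set.right_mem_Icc.2 hlam.le)).le, one_mul] at this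
    rw [this, mul_smul]
  · have := hcav i (Complex.exp (θ * Complex.I)) (Complex.norm_exp_ofReal_mul_I θ)
    rw [h1, h2] at this
    simpa [CavityData.center, CavityData.sqRadius, CavityData.outer,
      hevol.2.2.2.2.1, hevol.2.2.2.2.2.1, Real.sqrt_sq, (hR i).le] using this
  · rw [← hreg1, ← hreg2, himg]
end
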